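/- arXiv:1711.05358 — 2 statements merged into one kernel-verified Lean document; each statement's English description precedes it below -/
import Mathlib

section
/- For every ε > 0 there exists a constant C = C(ε, q) such that the following holds. Let l ≥ 0 be an integer, let Q ∈ F_q[t] be a nonzero polynomial of degree m ≥ 0, and let λ be a character of G_{l,Q}. Then for every d ≥ 1, |∑_{f monic, deg f = d} μ(f) λ(f)| ≤ C · q^{(1/2 + ε)d + ε(m + l)}. -/
open Polynomial

/- The Möbius function on `F_q[t]`. -/
open scoped Classical in
noncomputable def polyMu {F : Type*} [Field F] (f : Polynomial F) : ℤ :=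
  if Squarefree f then (-1) ^ (UniqueFactorizationMonoid.normalizedFactors f).card else 0

/-- The monic polynomial of degree `d` whose lower coefficient vector is `x ∈ F_q^d`. -/
noncomputable def monicPoly (F : Type*) [Field F] (d : ℕ) (x : Fin d → F) : Polynomial F :=
  X ^ d + ∑ i : Fin d, C (x i) * X ^ (i : ℕ)

/-- The `i`-th coefficient from the top of `f = t^d + a_1 t^{d-1} + ⋯ + a_d`:
`a_i = coeff (d - i)` for `i ≤ d`, and `0` for `i > d`. -/
noncomputable def firstCoeff {F : Type*} [Field F] (f : Polynomial F) (i : ℕ) : F :=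
  if i ≤ f.natDegree then f.coeff (f.natDegree - i) else 0

open scoped DirectSum

section Stepanov

variable {k B ι : Type*} [Field k] [CommRing B] [Algebra k[X] B] [Algebra k B]
  [IsScalarTower k k[X] B] [Fintype ι]

lemma mul_mem_degreeLT {p r : k[X]} {D E : ℕ} (hp : p ∈ degreeLT k D) (hr : r ∈ degreeLT k E) :
    p * r ∈ degreeLT k (D + E) := by
  by_cases h : p * r = 0
  · rw [h]; exact Submodule.zero_mem _
  have hp0 : p ≠ 0 := left_ne_zero_of_mul h
  have hr0 : r ≠ 0 := right_ne_zero_of_mul h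
  rw [mem_degreeLT, ← natDegree_lt_iff_degree_lt (by assumption)] at *
  rw [natDegree_mul hp0 hr0]; omega

/-- Elements of `B` whose coordinates in the `k[X]`-basis `ω` have degree `< D`. -/
noncomputable def coordLT (ω : Module.Basis ι k[X] B) (D : ℕ) : Submodule k B :=
  (Submodule.pi Set.univ (fun _ : ι => degreeLT k D)).comap
    (ω.equivFun.toLinearMap.restrictScalars k)

lemma mem_coordLT {ω : Module.Basis ι k[X] B} {D : ℕ} {u : B} :
    u ∈ coordLT ω D ↔ ∀ i, ω.repr u i ∈ degreeLT k D := by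
  simp [coordLT, Submodule.mem_pi]

lemma coordLT_mono (ω : Module.Basis ι k[X] B) {D E : ℕ} (h : D ≤ E) :
    coordLT ω D ≤ coordLT ω E := fun _ hu =>
  mem_coordLT.2 fun i => degreeLT_mono h (mem_coordLT.1 hu i)

noncomputable def coordLTEquiv (ω : Module.Basis ι k[X] B) (D : ℕ) :
    coordLT ω D ≃ₗ[k] (ι → Fin D → k) where
  toFun u i := degreeLTEquiv k D ⟨ω.repr u.1 i, mem_coordLT.1 u.2 i⟩
  map_add' u v := by
    funext i; rw [Pi.add_apply, ← map_add]; congr 1; ext1; simp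
  map_smul' c u := by
    funext i; rw [RingHom.id_apply, Pi.smul_apply, ← map_smul]; congr 1; ext1
    have h : c • u.1 = (C c : k[X]) • u.1 := by
      rw [← algebraMap_eq, algebraMap_smul]
    simp [h, smul_eq_C_mul]
  invFun v := ⟨ω.equivFun.symm fun i => ((degreeLTEquiv k D).symm (v i)).1, by
    rw [mem_coordLT]; intro i
    rw [← ω.equivFun_apply, LinearEquiv.apply_symm_apply]
    exact ((degreeLTEquiv k D).symm (v i)).2⟩
  left_inv u := by
    ext1
    apply ω.equivFun.injective
    simp
  right_inv v := by
    funext i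
    rw [← LinearEquiv.eq_symm_apply]
    ext1
    exact congrFun (ω.equivFun.apply_symm_apply _) i

lemma finrank_coordLT (ω : Module.Basis ι k[X] B) (D : ℕ) :
    Module.finrank k (coordLT ω D) = Fintype.card ι * D := by
  rw [(coordLTEquiv ω D).finrank_eq, Module.finrank_pi_fintype]; simp

instance (ω : Module.Basis ι k[X] B) (D : ℕ) : FiniteDimensional k (coordLT ω D) :=
  (coordLTEquiv ω D).symm.finiteDimensional

lemma exists_mem_coordLT (ω : Module.Basis ι k[X] B) (u : B) : ∃ D, u ∈ coordLT ω D := by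
  refine ⟨(Finset.univ.sup fun i => (ω.repr u i).natDegree) + 1, mem_coordLT.2 fun i => ?_⟩
  rw [mem_degreeLT]
  refine lt_of_le_of_lt degree_le_natDegree ?_
  have := Finset.le_sup (f := fun i => (ω.repr u i).natDegree) (Finset.mem_univ i)
  exact_mod_cast Nat.lt_succ_of_le this

lemma exists_forall_mem_coordLT (ω : Module.Basis ι k[X] B) {α : Type*} [Finite α] (u : α → B) :
    ∃ D, ∀ a, u a ∈ coordLT ω D := by
  cases nonempty_fintype α
  choose D hD using fun a => exists_mem_coordLT ω (u a)
  exact ⟨Finset.univ.sup D, fun a =>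
    coordLT_mono ω (Finset.le_sup (f := D) (Finset.mem_univ a)) (hD a)⟩

lemma smul_mem_coordLT {ω : Module.Basis ι k[X] B} {p : k[X]} {D E : ℕ} {v : B}
    (hp : p ∈ degreeLT k D) (hv : v ∈ coordLT ω E) : p • v ∈ coordLT ω (D + E) := by
  rw [mem_coordLT] at *
  intro i
  simpa using mul_mem_degreeLT hp (hv i)

lemma exists_map_mem_coordLT (ω : Module.Basis ι k[X] B) (σ : B →ₗ[k[X]] B) :
    ∃ κ, ∀ D, ∀ u ∈ coordLT ω D, σ u ∈ coordLT ω (D + κ) := by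
  obtain ⟨κ, hκ⟩ := exists_forall_mem_coordLT ω (fun i => σ (ω i))
  refine ⟨κ, fun D u hu => ?_⟩
  rw [← ω.sum_repr u, map_sum]
  refine Submodule.sum_mem _ fun i _ => ?_
  rw [map_smul]
  exact smul_mem_coordLT (mem_coordLT.1 hu i) (hκ i)

lemma exists_mul_mem_coordLT (ω : Module.Basis ι k[X] B) :
    ∃ κ, 1 ∈ coordLT ω κ ∧
      ∀ D E, ∀ u ∈ coordLT ω D, ∀ v ∈ coordLT ω E, u * v ∈ coordLT ω (D + E + κ) := by
  obtain ⟨κ₁, h₁⟩ := exists_forall_mem_coordLT ω (fun ij : ι × ι => ω ij.1 * ω ij.2)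
  obtain ⟨κ₂, h₂⟩ := exists_mem_coordLT ω 1
  refine ⟨κ₁ + κ₂, coordLT_mono ω (by omega) h₂, fun D E u hu v hv => ?_⟩
  rw [← ω.sum_repr u, ← ω.sum_repr v, Finset.sum_mul_sum]
  refine Submodule.sum_mem _ fun i _ => Submodule.sum_mem _ fun j _ => ?_
  rw [smul_mul_smul_comm]
  exact coordLT_mono ω (by omega) (smul_mem_coordLT
    (mul_mem_degreeLT (mem_coordLT.1 hu i) (mem_coordLT.1 hv j)) (h₁ (i, j)))

lemma pow_mem_coordLT {ω : Module.Basis ι k[X] B} {κ : ℕ} (h1 : 1 ∈ coordLT ω κ)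
    (hκ : ∀ D E, ∀ u ∈ coordLT ω D, ∀ v ∈ coordLT ω E, u * v ∈ coordLT ω (D + E + κ))
    {D : ℕ} {u : B} (hu : u ∈ coordLT ω D) (r : ℕ) : u ^ r ∈ coordLT ω (r * (D + κ) + κ) := by
  induction r with
  | zero => simpa using h1
  | succ r ih =>
    rw [pow_succ]
    exact coordLT_mono ω (by ring_nf; omega) (hκ _ _ _ ih _ hu)

lemma natDegree_norm_le [DecidableEq ι] {ω : Module.Basis ι k[X] B} {κ : ℕ}
    (hκ : ∀ D, ∀ u ∈ coordLT ω D, ∀ i, u * ω i ∈ coordLT ω (D + κ))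
    {D : ℕ} {u : B} (hu : u ∈ coordLT ω D) :
    (Algebra.norm k[X] u).natDegree ≤ Fintype.card ι * (D + κ) := by
  rw [Algebra.norm_eq_matrix_det ω, Matrix.det_apply]
  refine natDegree_sum_le_of_forall_le _ _ fun τ _ => ?_
  refine (natDegree_smul_le _ _).trans ((natDegree_prod_le _ _).trans ?_)
  refine (Finset.sum_le_card_nsmul _ _ (D + κ) fun i _ => ?_).trans (by simp)
  rw [Algebra.leftMulMatrix_eq_repr_mul]
  have := mem_coordLT.1 (hκ D u hu i) (τ i)
  rw [mem_degreeLT] at this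
  exact natDegree_le_of_degree_le this.le

lemma card_algHom_le_of_forall_eq_zero [IsDomain B] [DecidableEq ι] (ω : Module.Basis ι k[X] B)
    {Ω : Type*} [Field Ω] [Algebra k Ω] {g : B} (hg : g ≠ 0) (T : Finset (B →ₐ[k] Ω))
    (hT : ∀ P ∈ T, P g = 0) : T.card ≤ (Algebra.norm k[X] g).natDegree := by
  have hfr := finrank_quotient_span_eq_natDegree_norm (F := k) ω hg
  have hfin : FiniteDimensional k (B ⧸ Ideal.span {g}) := by
    have hI := Ideal.span_singleton_eq_bot.not.2 hg
    have : Module.Finite k (⨁ i, k[X] ⧸ Ideal.span ({Ideal.smithCoeffs ω _ hI i} : Set k[X])) := by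
      infer_instance
    exact Module.Finite.equiv (Ideal.quotientEquivDirectSum k ω hI).symm
  rw [← hfr]
  let φ : T → ((B ⧸ Ideal.span {g}) →ₐ[k] Ω) := fun P =>
    Ideal.Quotient.liftₐ _ P.1 (by
      intro a ha
      obtain ⟨c, rfl⟩ := Ideal.mem_span_singleton.1 ha
      simp [hT P.1 P.2])
  have hφ : Function.Injective φ := by
    intro P P' h
    ext b
    exact DFunLike.congr_fun h (Ideal.Quotient.mk _ b)
  have hli : LinearIndependent Ω
      (fun i : T => ((φ i).toLinearMap : (B ⧸ Ideal.span {g}) →ₗ[k] Ω)) :=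
    (linearIndependent_toLinearMap k _ Ω).comp _ hφ
  have := hli.fintype_card_le_finrank
  rw [Fintype.card_coe] at this
  refine this.trans (le_of_eq ?_)
  exact Module.finrank_linearMap_self k Ω _

end Stepanov

section Frobenius

/-- The `n`-th power of the `q`-Frobenius as an algebra endomorphism. -/
noncomputable def frobPow (k A : Type*) [Field k] [Fintype k] [CommRing A] [Algebra k A] (n : ℕ) :
    A →ₐ[k] A := FiniteField.frobeniusAlgHom k A ^ n

lemma frobPow_apply (k : Type*) {A : Type*} [Field k] [Fintype k] [CommRing A] [Algebra k A]
    (n : ℕ) (x : A) : frobPow k A n x = x ^ Fintype.card k ^ n := by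
  rw [frobPow, AlgHom.coe_pow, FiniteField.coe_frobeniusAlgHom, pow_iterate]

end Frobenius

section Stepanov

lemma dvd_algebraMap_norm_of_basis {A B ι : Type*} [CommRing A] [CommRing B] [Algebra A B]
    [Fintype ι] (ω : Module.Basis ι A B) (u : B) : u ∣ algebraMap A B (Algebra.norm A u) := by
  classical
  set M := Algebra.leftMulMatrix ω u
  refine ⟨ω.equivFun.symm (M.adjugate.mulVec (ω.equivFun 1)), ω.equivFun.injective ?_⟩
  have h : ∀ v, ω.equivFun (u * v) = M.mulVec (ω.equivFun v) := fun v =>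
    (Algebra.leftMulMatrix_mulVec_repr ω u v).symm
  rw [h, LinearEquiv.apply_symm_apply, Matrix.mulVec_mulVec, Matrix.mul_adjugate,
    Matrix.smul_mulVec, Matrix.one_mulVec, Algebra.algebraMap_eq_smul_one, map_smul,
    Algebra.norm_eq_matrix_det ω]

variable {k B ι : Type*} [Field k] [CommRing B] [IsDomain B] [Algebra k[X] B]
  [Algebra k B] [IsScalarTower k k[X] B] [Fintype ι]

lemma le_natDegree_norm_of_X_pow_dvd {k B ι : Type*} [Field k] [CommRing B] [IsDomain B]
    [Algebra k[X] B] [Fintype ι]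
    (ω : Module.Basis ι k[X] B) (θ : B →ₐ[k[X]] PowerSeries k)
    {u : B} (hu : u ≠ 0) {N : ℕ} (h : (PowerSeries.X : PowerSeries k) ^ N ∣ θ u) :
    N ≤ (Algebra.norm k[X] u).natDegree := by
  have : Module.Finite k[X] B := Module.Finite.of_basis ω
  have : Module.Free k[X] B := Module.Free.of_basis ω
  have hn : Algebra.norm k[X] u ≠ 0 := by
    rwa [Ne, Algebra.norm_eq_zero_iff_of_basis ω]
  have h2 := h.trans (map_dvd θ (dvd_algebraMap_norm_of_basis ω u))
  rw [AlgHom.commutes, PowerSeries.X_pow_dvd_iff] at h2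
  by_contra! hlt
  have h3 := h2 _ hlt
  rw [show algebraMap k[X] (PowerSeries k) (Algebra.norm k[X] u) =
    ((Algebra.norm k[X] u : k[X]) : PowerSeries k) from rfl, Polynomial.coeff_coe] at h3
  exact hn (leadingCoeff_eq_zero.1 h3)

omit [IsDomain B] in
lemma map_smul_of_algHom_powerSeries (θ : B →ₐ[k[X]] PowerSeries k) (a : k) (u : B) :
    θ (a • u) = PowerSeries.C a * θ u := by
  have h : a • u = (C a : k[X]) • u := by rw [← algebraMap_eq, algebraMap_smul]
  rw [h, map_smul, Algebra.smul_def]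
  congr 1
  exact Polynomial.coe_C a

/-- If `∑ e_j T_j ^ r = 0` for a Frobenius power `r` and linearly independent `e_j` of small degree,
then all `T_j` vanish. -/
lemma eq_zero_of_sum_mul_pow_eq_zero [Fintype k] [DecidableEq ι] {ω : Module.Basis ι k[X] B}
    (θ : B →ₐ[k[X]] PowerSeries k) (hθ : Function.Injective θ) {κ : ℕ}
    (hκ : ∀ D, ∀ u ∈ coordLT ω D, ∀ i, u * ω i ∈ coordLT ω (D + κ)) {U n : ℕ}
    (hU : Fintype.card ι * (U + κ) < Fintype.card k ^ n)
    {J : Type*} [Fintype J] {e : J → B} (he : LinearIndependent k e)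
    (heU : ∀ j, e j ∈ coordLT ω U) {T : J → B}
    (h0 : ∑ j, e j * T j ^ Fintype.card k ^ n = 0) : ∀ j, T j = 0 := by
  set r := Fintype.card k ^ n with hr
  have hr0 : r ≠ 0 := pow_ne_zero _ Fintype.card_ne_zero
  by_contra! hT
  obtain ⟨j₁, hj₁⟩ := hT
  obtain ⟨j₀, -, hj₀⟩ := Finset.exists_min_image Finset.univ (fun j => (θ (T j)).order)
    ⟨j₁, Finset.mem_univ _⟩
  have hne : θ (T j₀) ≠ 0 := by
    intro h
    have := hj₀ j₁ (Finset.mem_univ _)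
    rw [h, PowerSeries.order_zero, top_le_iff, PowerSeries.order_eq_top] at this
    exact hj₁ (hθ (by rw [this, map_zero]))
  obtain ⟨o, ho⟩ : ∃ o : ℕ, (θ (T j₀)).order = o :=
    ⟨_, (ENat.natCast_toNat (by rwa [Ne, PowerSeries.order_eq_top])).symm⟩
  have hdiv : ∀ j, ∃ t, θ (T j) = PowerSeries.X ^ o * t := fun j => by
    have : (PowerSeries.X : PowerSeries k) ^ o ∣ θ (T j) := by
      rw [PowerSeries.X_pow_dvd_iff]
      intro m hm
      refine PowerSeries.coeff_of_lt_order _ (lt_of_lt_of_le ?_ (hj₀ j (Finset.mem_univ _)))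
      rw [ho]; exact_mod_cast hm
    exact this
  choose t ht using hdiv
  have ht0 : PowerSeries.constantCoeff (t j₀) ≠ 0 := by
    intro h
    have h2 := PowerSeries.coeff_order hne
    simp only [ho] at h2
    have : (θ (T j₀)).order.toNat = o := by rw [ho]; rfl
    rw [ht j₀] at h2
    have h3 := PowerSeries.coeff_X_pow_mul (t j₀) o 0
    rw [zero_add, PowerSeries.coeff_zero_eq_constantCoeff_apply, h] at h3
    rw [ENat.toNat_natCast] at h2
    exact h2 h3
  have hpow : ∀ j, ∃ s, t j ^ r =
      PowerSeries.C (PowerSeries.constantCoeff (t j)) + PowerSeries.X ^ r * s := fun j => by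
    obtain ⟨s, hs⟩ := (PowerSeries.X_dvd_iff (φ := t j - PowerSeries.C
      (PowerSeries.constantCoeff (t j)))).2 (by simp)
    refine ⟨s ^ r, ?_⟩
    have h1 : t j = algebraMap k (PowerSeries k) (PowerSeries.constantCoeff (t j)) +
        PowerSeries.X * s := by
      rw [← hs]; exact (add_sub_cancel _ _).symm
    conv_lhs => rw [h1]
    rw [hr, ← frobPow_apply, map_add, AlgHom.commutes, frobPow_apply, mul_pow]
    rfl
  choose s hs using hpow
  have hsum : ∑ j, θ (e j) * t j ^ r = 0 := by
    have h1 := congrArg θ h0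
    rw [map_zero, map_sum] at h1
    have h2 : (PowerSeries.X : PowerSeries k) ^ (o * r) * ∑ j, θ (e j) * t j ^ r = 0 := by
      rw [← h1, Finset.mul_sum]
      refine Finset.sum_congr rfl fun j _ => ?_
      rw [map_mul, map_pow, ht j, mul_pow, pow_mul]; ring
    exact (mul_eq_zero.1 h2).resolve_left (pow_ne_zero _ PowerSeries.X_ne_zero)
  set v : B := ∑ j, PowerSeries.constantCoeff (t j) • e j with hv
  have hvne : v ≠ 0 := fun h =>
    ht0 (Fintype.linearIndependent_iff.1 he _ h j₀)
  have hvU : v ∈ coordLT ω U :=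
    Submodule.sum_mem _ fun j _ => Submodule.smul_mem _ _ (heU j)
  have hvX : (PowerSeries.X : PowerSeries k) ^ r ∣ θ v := by
    refine ⟨-∑ j, θ (e j) * s j, ?_⟩
    have : θ v + PowerSeries.X ^ r * ∑ j, θ (e j) * s j = 0 := by
      rw [← hsum, hv, map_sum, Finset.mul_sum, ← Finset.sum_add_distrib]
      refine Finset.sum_congr rfl fun j _ => ?_
      rw [map_smul_of_algHom_powerSeries, hs j]; ring
    rw [mul_neg]; exact eq_neg_of_add_eq_zero_left this
  have := le_natDegree_norm_of_X_pow_dvd ω θ hvne hvX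
  have := natDegree_norm_le hκ hvU
  omega

lemma exists_ne_zero_sum_smul_eq_zero {k V J : Type*} [Field k] [AddCommGroup V] [Module k V]
    [Fintype J] (W : Submodule k V) [FiniteDimensional k W] (v : J → V) (hv : ∀ j, v j ∈ W)
    (h : Module.finrank k W < Fintype.card J) : ∃ c : J → k, c ≠ 0 ∧ ∑ j, c j • v j = 0 := by
  have hdep : ¬ LinearIndependent k (fun j => (⟨v j, hv j⟩ : W)) := fun hl =>
    absurd hl.fintype_card_le_finrank (by omega)
  obtain ⟨c, hc, j, hj⟩ := Fintype.not_linearIndependent_iff.1 hdep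
  refine ⟨c, fun h => hj (by rw [h]; rfl), ?_⟩
  simpa using congrArg Subtype.val hc

/-- Stepanov's bound on the number of points on which the `q ^ (2 n)`-Frobenius agrees with `σ`,
with explicit auxiliary degrees. -/
lemma card_algHom_le_of_pow_eq [Fintype k] [DecidableEq ι] {ω : Module.Basis ι k[X] B}
    (θ : B →ₐ[k[X]] PowerSeries k) (hθ : Function.Injective θ) (σ : B →ₐ[k[X]] B)
    {κ κ₂ κσ U S n : ℕ}
    (h1 : 1 ∈ coordLT ω κ)
    (hκ : ∀ D E, ∀ u ∈ coordLT ω D, ∀ v ∈ coordLT ω E, u * v ∈ coordLT ω (D + E + κ))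
    (hκ₂ : ∀ D, ∀ u ∈ coordLT ω D, ∀ i, u * ω i ∈ coordLT ω (D + κ₂))
    (hσ : ∀ D, ∀ u ∈ coordLT ω D, σ u ∈ coordLT ω (D + κσ))
    (hU : Fintype.card ι * (U + κ₂) < Fintype.card k ^ n)
    (hW : Fintype.card ι * (Fintype.card k ^ n * (U + κ) + κ + (S + κσ) + κ) <
      Fintype.card ι * U * (Fintype.card ι * S))
    {Ω : Type*} [Field Ω] [Algebra k Ω] (T : Finset (B →ₐ[k] Ω))
    (hT : ∀ P ∈ T, ∀ f, P f ^ Fintype.card k ^ (2 * n) = P (σ f)) :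
    T.card ≤ Fintype.card ι *
      (U + (Fintype.card k ^ n * (S + κ) + κ) + κ + κ₂) := by
  set r := Fintype.card k ^ n with hr
  have hr0 : r ≠ 0 := pow_ne_zero _ Fintype.card_ne_zero
  set e := Module.finBasis k (coordLT ω U)
  set s := Module.finBasis k (coordLT ω S)
  have heli : LinearIndependent k fun j => (e j : B) :=
    e.linearIndependent.map' (coordLT ω U).subtype (Submodule.ker_subtype _)
  have hsli : LinearIndependent k fun j => (s j : B) :=
    s.linearIndependent.map' (coordLT ω S).subtype (Submodule.ker_subtype _)
  obtain ⟨c, hc, hc0⟩ := exists_ne_zero_sum_smul_eq_zero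
    (coordLT ω (r * (U + κ) + κ + (S + κσ) + κ))
    (fun ji : Fin _ × Fin _ => (e ji.1 : B) ^ r * σ (s ji.2))
    (fun ji => hκ _ _ _ (pow_mem_coordLT h1 hκ (e ji.1).2 r) _ (hσ _ _ (s ji.2).2))
    (by rw [finrank_coordLT, Fintype.card_prod, Fintype.card_fin, Fintype.card_fin,
      finrank_coordLT, finrank_coordLT]; exact hW)
  have hcr : ∀ a : k, a ^ r = a := fun a => FiniteField.pow_card_pow n a
  set g : B := ∑ j, (e j : B) * (∑ i, c (j, i) • (s i : B)) ^ r with hg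
  have hgne : g ≠ 0 := by
    intro h
    have h2 := eq_zero_of_sum_mul_pow_eq_zero θ hθ hκ₂ hU heli (fun j => (e j).2) h
    refine hc (funext fun ji => ?_)
    exact Fintype.linearIndependent_iff.1 hsli _ (h2 ji.1) ji.2
  have hgP : ∀ P ∈ T, P g = 0 := by
    intro P hP
    have h2 : P g ^ r = P (∑ ji : Fin _ × Fin _, c ji • ((e ji.1 : B) ^ r * σ (s ji.2))) := by
      rw [hg, Fintype.sum_prod_type, hr, ← frobPow_apply]
      simp only [map_sum, map_mul, map_smul, frobPow_apply, map_pow]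
      refine Finset.sum_congr rfl fun j _ => ?_
      have h4 : (∑ i, c (j, i) • P (s i : B) ^ Fintype.card k ^ n) ^ Fintype.card k ^ n =
          ∑ i, c (j, i) • (P (s i : B) ^ Fintype.card k ^ n) ^ Fintype.card k ^ n := by
        simp only [← frobPow_apply k n, map_sum, map_smul]
      rw [h4, Finset.mul_sum]
      refine Finset.sum_congr rfl fun i _ => ?_
      rw [mul_smul_comm, ← hT P hP, ← pow_mul, ← pow_add, two_mul]
    rw [hc0, map_zero] at h2
    exact pow_eq_zero_iff hr0 |>.1 h2
  refine (card_algHom_le_of_forall_eq_zero ω hgne T hgP).trans ?_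
  refine natDegree_norm_le hκ₂ ?_
  refine Submodule.sum_mem _ fun j _ => hκ _ _ _ (e j).2 _ (pow_mem_coordLT h1 hκ ?_ r)
  exact Submodule.sum_mem _ fun i _ => Submodule.smul_mem _ _ (s i).2

/-- Stepanov's bound. -/
theorem exists_card_algHom_le [Fintype k] [Nonempty ι] (ω : Module.Basis ι k[X] B)
    (θ : B →ₐ[k[X]] PowerSeries k) (hθ : Function.Injective θ) (σ : B →ₐ[k[X]] B)
    (Ω : Type*) [Field Ω] [Algebra k Ω] :
    ∃ C n₀ : ℕ, ∀ n, n₀ ≤ n → ∀ T : Finset (B →ₐ[k] Ω),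
      (∀ P ∈ T, ∀ f, P f ^ Fintype.card k ^ (2 * n) = P (σ f)) →
      T.card ≤ Fintype.card k ^ (2 * n) + C * Fintype.card k ^ n := by
  classical
  obtain ⟨κ, h1, hκ⟩ := exists_mul_mem_coordLT ω
  obtain ⟨κ₀, hκ₀⟩ := exists_forall_mem_coordLT ω (fun i => ω i)
  obtain ⟨κσ, hσ⟩ := exists_map_mem_coordLT ω σ.toLinearMap
  set h := Fintype.card ι with hh
  have hpos : 0 < h := Fintype.card_pos
  have hκ₂ : ∀ D, ∀ u ∈ coordLT ω D, ∀ i, u * ω i ∈ coordLT ω (D + (κ₀ + κ)) :=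
    fun D u hu i => by rw [← add_assoc]; exact hκ _ _ _ hu _ (hκ₀ i)
  set κ₂ := κ₀ + κ with hκ₂def
  -- the additive constant in the degree of the second factor
  set c := 2 * κ + 2 * κ₂ + 7 + κσ with hc
  refine ⟨1 + h * c + 3 * h * κ + h * κ₂, h * (2 * c + 2) * (c + 1), fun n hn T hT => ?_⟩
  have hq1 : 1 < Fintype.card k := Fintype.one_lt_card
  have hrn : n < Fintype.card k ^ n := Nat.lt_pow_self hq1
  set r := Fintype.card k ^ n with hr
  set m := r / h with hm
  have hmr : h * m ≤ r := Nat.mul_div_le r h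
  have hmr2 : r < h * (m + 1) := by
    rw [hm, mul_comm]; exact Nat.lt_mul_of_div_lt (Nat.lt_succ_self _) hpos
  have hmbig : (2 * c + 2) * (c + 1) ≤ m := by
    rw [hm, Nat.le_div_iff_mul_le hpos]
    calc _ = h * (2 * c + 2) * (c + 1) := by ring
      _ ≤ r := by omega
  obtain ⟨U, hUm⟩ : ∃ U, m = U + (κ₂ + 1) :=
    ⟨m - (κ₂ + 1), by
      have : κ₂ + 1 ≤ (2 * c + 2) * (c + 1) := by nlinarith
      omega⟩
  have key := card_algHom_le_of_pow_eq (n := n) (U := U) (S := m + c) θ hθ σ h1 hκ hκ₂ hσ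
    (by
      calc h * (U + κ₂) < h * m := by
            apply Nat.mul_lt_mul_of_pos_left _ hpos; omega
        _ ≤ r := hmr)
    (by
      rw [← hh, ← hr, mul_assoc]
      apply Nat.mul_lt_mul_of_pos_left _ hpos
      have hUc : 2 * c ≤ U := by
        have : 3 * c + 1 ≤ (2 * c + 2) * (c + 1) := by nlinarith
        omega
      obtain ⟨c', hc'⟩ : ∃ c', c = c' + 1 := ⟨c - 1, by omega⟩
      have f1 : (r + 1 + h * c') * U ≤ U * (h * (m + c)) := by
        rw [hc', mul_comm U]
        exact Nat.mul_le_mul_right _ (by nlinarith)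
      have f2 : r * κ ≤ h * U * (2 * κ) := by
        calc r * κ ≤ h * (m + 1) * κ := Nat.mul_le_mul_right _ hmr2.le
          _ ≤ h * (2 * U) * κ := by
            refine Nat.mul_le_mul_right _ (Nat.mul_le_mul_left _ (by omega))
          _ = _ := by ring
      have f3 : h * U * (2 * κ) + h * U * 6 ≤ h * c' * U := by
        have : 2 * κ + 6 ≤ c' := by omega
        calc _ = h * U * (2 * κ + 6) := by ring
          _ ≤ h * U * c' := Nat.mul_le_mul_left _ this
          _ = _ := by ring
      have f4 : U ≤ h * U := Nat.le_mul_of_pos_left _ hpos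
      have f5 : κ + (m + c + κσ) + κ < 6 * U := by omega
      nlinarith) T hT
  refine key.trans ?_
  rw [← hh, ← hr]
  have hr2 : Fintype.card k ^ (2 * n) = r * r := by rw [two_mul, pow_add]
  rw [hr2]
  have hr1 : 1 ≤ r := Nat.one_le_iff_ne_zero.2 (pow_ne_zero _ (by omega))
  have hUm2 : U + κ₂ ≤ m := by omega
  have e1 : h * (U + κ₂) ≤ r := (Nat.mul_le_mul_left _ hUm2).trans hmr
  have e2 : h * m * r ≤ r * r := Nat.mul_le_mul_right _ hmr
  have e3 : h * (κ + κ) ≤ h * (κ + κ) * r := Nat.le_mul_of_pos_right _ hr1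
  nlinarith [Nat.zero_le (h * κ₂ * r)]

end Stepanov

section TorsionSeries

lemma coeff_pow_card {k : Type*} [Field k] [Fintype k] (f : PowerSeries k) (n : ℕ) :
    PowerSeries.coeff n (f ^ Fintype.card k) =
      if Fintype.card k ∣ n then PowerSeries.coeff (n / Fintype.card k) f else 0 := by
  obtain ⟨p, hp⟩ := CharP.exists k
  obtain ⟨m, hpm⟩ := FiniteField.card k p
  have : Fact p.Prime := ⟨hpm.1⟩
  have h := MvPowerSeries.map_iterateFrobenius_expand p hpm.1.ne_zero (R := k) f m
  have hid : iterateFrobenius k p m = RingHom.id k := by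
    ext a
    rw [iterateFrobenius_def, ← hpm.2, FiniteField.pow_card]; rfl
  rw [hid, MvPowerSeries.map_id, RingHom.id_apply] at h
  simp only [hpm.2]
  rw [← h]
  exact PowerSeries.coeff_expand _ (pow_ne_zero _ hpm.1.ne_zero) f

/-- The coefficients of the power series `Y` over `R` with `Y(x ^ q) = (1 - τ x) Y(x)` and
constant term one. -/
def torsionSeq {R : Type*} [CommRing R] (q : ℕ) (τ : R) : ℕ → R
  | 0 => 1
  | n + 1 => τ * torsionSeq q τ n +
      if _h : 1 < q ∧ q ∣ n + 1 then torsionSeq q τ ((n + 1) / q) else 0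
  decreasing_by
  · exact Nat.lt_succ_self n
  · exact Nat.div_lt_self n.succ_pos _h.1

variable (k : Type*) [Field k] {R : Type*} [CommRing R] [Algebra k R]

/-- Multiplication by `ρ` on the dual of `R`. -/
def dualMul (ρ : R) : Module.Dual k R →ₗ[k] Module.Dual k R :=
  (LinearMap.mulLeft k ρ).dualMap

@[simp] lemma dualMul_apply (ρ x : R) (φ : Module.Dual k R) : dualMul k ρ φ x = φ (ρ * x) := rfl

lemma dualMul_mul (ρ ρ' : R) (φ : Module.Dual k R) :
    dualMul k (ρ * ρ') φ = dualMul k ρ (dualMul k ρ' φ) := by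
  ext x; simp [mul_left_comm, mul_assoc]

variable [Fintype k]

/-- The power series `φ(Y)`. -/
noncomputable def torsionSeries (τ : R) : Module.Dual k R →ₗ[k] PowerSeries k where
  toFun φ := PowerSeries.mk fun n => φ (torsionSeq (Fintype.card k) τ n)
  map_add' φ ψ := by ext n; simp
  map_smul' c φ := by ext n; simp

lemma constantCoeff_torsionSeries (τ : R) (φ : Module.Dual k R) :
    PowerSeries.constantCoeff (torsionSeries k τ φ) = φ 1 := by
  rw [← PowerSeries.coeff_zero_eq_constantCoeff_apply, torsionSeries]
  simp [torsionSeq]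

lemma torsionSeries_pow_card (τ : R) (φ : Module.Dual k R) :
    torsionSeries k τ φ ^ Fintype.card k =
      torsionSeries k τ φ - PowerSeries.X * torsionSeries k τ (dualMul k τ φ) := by
  ext n
  rw [coeff_pow_card, map_sub]
  cases n with
  | zero => simp [torsionSeries]
  | succ n =>
    rw [PowerSeries.coeff_succ_X_mul]
    simp only [torsionSeries, LinearMap.coe_mk, AddHom.coe_mk, PowerSeries.coeff_mk,
      dualMul_apply]
    conv_rhs => rw [torsionSeq]
    rw [map_add, add_sub_cancel_left]
    have h1 : 1 < Fintype.card k := Fintype.one_lt_card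
    split_ifs <;> simp_all

/-- Scalar extension of `torsionSeries` to polynomials in the series. -/
noncomputable def torsionEval (τ : R) :
    MvPolynomial (Module.Dual k R) k[X] →ₐ[k[X]] PowerSeries k :=
  MvPolynomial.aeval (torsionSeries k τ)

/-- The `k[X]`-algebra generated by the series `φ(Y)`. -/
noncomputable def torsionRing (τ : R) : Subalgebra k[X] (PowerSeries k) := (torsionEval k τ).range

/-- `torsionSeries` as an element of `torsionRing`. -/
noncomputable def torsionElem (τ : R) : Module.Dual k R →ₗ[k] torsionRing k τ where
  toFun φ := ⟨torsionSeries k τ φ, MvPolynomial.X φ, by simp [torsionEval]⟩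
  map_add' φ ψ := by ext1; simp
  map_smul' c φ := by ext1; simp

lemma torsionElem_pow_card (τ : R) (φ : Module.Dual k R) :
    torsionElem k τ φ ^ Fintype.card k =
      torsionElem k τ φ - (X : k[X]) • torsionElem k τ (dualMul k τ φ) := by
  ext1
  have h := torsionSeries_pow_card k τ φ
  rw [← Polynomial.coe_X] at h
  exact h

/-- The presentation of `torsionRing`. -/
noncomputable def torsionPres (τ : R) :
    MvPolynomial (Module.Dual k R) k[X] →ₐ[k[X]] torsionRing k τ := (torsionEval k τ).rangeRestrict

lemma torsionPres_surjective (τ : R) : Function.Surjective (torsionPres k τ) :=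
  AlgHom.rangeRestrict_surjective _

@[simp] lemma torsionPres_X (τ : R) (φ : Module.Dual k R) :
    torsionPres k τ (MvPolynomial.X φ) = torsionElem k τ φ := by
  ext1
  exact MvPolynomial.aeval_X _ φ

lemma torsionPres_eq_aeval (τ : R) :
    torsionPres k τ = MvPolynomial.aeval (torsionElem k τ) := by
  ext φ; simp

lemma isIntegral_torsionElem [Finite R] (τ : R) (φ : Module.Dual k R) :
    IsIntegral k[X] (torsionElem k τ φ) := by
  have : Finite (Module.Dual k R) := DFunLike.finite _
  set N := Submodule.span k[X] (Set.range (torsionElem k τ)) with hN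
  have hNfg : N.FG := Submodule.fg_span (Set.finite_range _)
  have : IsNoetherian k[X] N := isNoetherian_of_fg_of_noetherian N hNfg
  have hmem : ∀ x ∈ N, x ^ Fintype.card k ∈ N := by
    intro x hx
    induction hx using Submodule.span_induction with
    | mem x hx =>
      obtain ⟨ψ, rfl⟩ := hx
      rw [torsionElem_pow_card]
      exact N.sub_mem (Submodule.subset_span ⟨_, rfl⟩)
        (N.smul_mem _ (Submodule.subset_span ⟨_, rfl⟩))
    | zero => rw [zero_pow Fintype.card_ne_zero]; exact N.zero_mem
    | add x y _ _ hx hy =>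
      have h := map_add (frobPow k (torsionRing k τ) 1) x y
      rw [frobPow_apply, frobPow_apply, frobPow_apply, pow_one] at h
      rw [h]; exact N.add_mem hx hy
    | smul a x _ hx => rw [_root_.smul_pow]; exact N.smul_mem _ hx
  have hpow : ∀ i, torsionElem k τ φ ^ Fintype.card k ^ i ∈ N := by
    intro i
    induction i with
    | zero => rw [pow_zero, pow_one]; exact Submodule.subset_span ⟨φ, rfl⟩
    | succ i ih => rw [pow_succ, pow_mul]; exact hmem _ ih
  let v : ℕ → N := fun i => ⟨_, hpow i⟩
  obtain ⟨n, hn⟩ : ∃ n, v n ∈ Submodule.span k[X] (v '' Set.Iio n) := by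
    by_contra! h
    let S : ℕ →o Submodule k[X] N :=
      ⟨fun n => Submodule.span k[X] (v '' Set.Iio n), fun a b hab =>
        Submodule.span_mono (Set.image_mono (Set.Iio_subset_Iio hab))⟩
    obtain ⟨n, hn⟩ := monotone_stabilizes_iff_noetherian.2 this S
    refine h n ?_
    have : v n ∈ S (n + 1) := Submodule.subset_span ⟨n, Nat.lt_succ_self n, rfl⟩
    rwa [← hn (n + 1) (Nat.le_succ n)] at this
  obtain ⟨c, hc, hcn⟩ := (Finsupp.mem_span_image_iff_linearCombination k[X]).1 hn
  have hq1 : 1 < Fintype.card k := Fintype.one_lt_card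
  set p : k[X][X] := ∑ i ∈ c.support, C (c i) * X ^ Fintype.card k ^ i with hp
  have hdeg : p.degree < (Fintype.card k ^ n : ℕ) := by
    refine (degree_sum_le _ _).trans_lt ((Finset.sup_lt_iff (WithBot.bot_lt_coe _)).2 ?_)
    intro i hi
    refine (degree_C_mul_X_pow_le _ _).trans_lt ?_
    have : i < n := (Finsupp.mem_supported _ _).1 hc hi
    exact_mod_cast Nat.pow_lt_pow_right hq1 this
  refine ⟨X ^ (Fintype.card k ^ n) - p, monic_X_pow_sub hdeg, ?_⟩
  have h2 := congrArg Subtype.val hcn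
  rw [Finsupp.linearCombination_apply, Finsupp.sum] at h2
  simp only [AddSubmonoidClass.coe_finsetSum] at h2
  rw [← aeval_def, map_sub, hp, map_sum, map_pow, aeval_X, sub_eq_zero]
  simp only [map_mul, aeval_C, map_pow, aeval_X]
  refine h2.symm.trans (Finset.sum_congr rfl fun i _ => ?_)
  exact Algebra.smul_def _ _

instance [Finite R] (τ : R) : Module.Finite k[X] (torsionRing k τ) := by
  have : Finite (Module.Dual k R) := DFunLike.finite _
  have h1 : Algebra.adjoin k[X] (Set.range (torsionElem k τ)) = ⊤ := by
    rw [Algebra.adjoin_range_eq_range_aeval, ← torsionPres_eq_aeval]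
    exact (AlgHom.range_eq_top _).2 (torsionPres_surjective k τ)
  have h2 := Algebra.finite_adjoin_of_finite_of_isIntegral (R := k[X])
    (Set.finite_range (torsionElem k τ))
    (by rintro _ ⟨φ, rfl⟩; exact isIntegral_torsionElem k τ φ)
  rw [h1] at h2
  exact Module.Finite.equiv (Subalgebra.topEquiv (R := k[X])).toLinearEquiv

instance (τ : R) : Module.IsTorsionFree k[X] (torsionRing k τ) := by
  rw [Module.isTorsionFree_iff_algebraMap_injective]
  intro a b hab
  exact Polynomial.coe_injective k (congrArg Subtype.val hab)

instance [Finite R] (τ : R) : Module.Free k[X] (torsionRing k τ) :=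
  Module.free_of_finite_type_torsion_free'

end TorsionSeries

section TorsionPoints

variable (k : Type*) [Field k] [Fintype k] {R : Type*} [CommRing R] [Algebra k R]

/-- The units `b` of `R` for which `φ(Y) ↦ φ(bY)` extends to an endomorphism of `torsionRing`. -/
def torsionShift (τ : R) : Submonoid R where
  carrier := {b | IsUnit b ∧ ∃ σ : torsionRing k τ →ₐ[k[X]] torsionRing k τ,
    ∀ φ, σ (torsionElem k τ φ) = torsionElem k τ (dualMul k b φ)}
  one_mem' := ⟨isUnit_one, AlgHom.id _ _, fun φ => by
    have : dualMul k (1 : R) φ = φ := by ext x; simp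
    rw [this]; rfl⟩
  mul_mem' := by
    rintro b b' ⟨hb, σ, hσ⟩ ⟨hb', σ', hσ'⟩
    exact ⟨hb.mul hb', σ'.comp σ, fun φ => by
      rw [AlgHom.comp_apply, hσ, hσ', mul_comm, dualMul_mul]⟩

lemma mem_torsionShift_of_forall {τ b : R} (hb : IsUnit b)
    (h : ∀ f, torsionPres k τ f = 0 →
      MvPolynomial.aeval (fun φ => torsionElem k τ (dualMul k b φ)) f = 0) :
    b ∈ torsionShift k τ := by
  refine ⟨hb, AlgHom.liftOfSurjective _ (torsionPres_surjective k τ)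
    (MvPolynomial.aeval (fun φ => torsionElem k τ (dualMul k b φ))) (fun f hf => h f hf),
    fun φ => ?_⟩
  have := AlgHom.liftOfSurjective_apply _ (torsionPres_surjective k τ)
    (MvPolynomial.aeval (fun φ => torsionElem k τ (dualMul k b φ))) (fun f hf => h f hf)
    (MvPolynomial.X φ)
  rwa [torsionPres_X, MvPolynomial.aeval_X] at this

lemma torsionRing_hom_ext {τ : R} {A : Type*} [Semiring A] {f g : torsionRing k τ →+* A}
    (h : ∀ p : k[X], f (algebraMap _ _ p) = g (algebraMap _ _ p))
    (h' : ∀ φ, f (torsionElem k τ φ) = g (torsionElem k τ φ)) : f = g := by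
  have : f.comp (torsionPres k τ).toRingHom = g.comp (torsionPres k τ).toRingHom := by
    refine MvPolynomial.ringHom_ext (fun p => ?_) (fun φ => ?_)
    · have : torsionPres k τ (MvPolynomial.C p) = algebraMap _ _ p := (torsionPres k τ).commutes p
      simpa [this] using h p
    · simpa using h' φ
  exact RingHom.cancel_right (torsionPres_surjective k τ) |>.1 this

variable {k} {Ω : Type*} [Field Ω] [Algebra k Ω]

/-- The `x`-coordinate of a point of `torsionRing`. -/
noncomputable def pointX {τ : R} (P : torsionRing k τ →ₐ[k] Ω) : Ω :=
  P (algebraMap k[X] _ X)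

lemma apply_algebraMap_eq_aeval {τ : R} (P : torsionRing k τ →ₐ[k] Ω) (p : k[X]) :
    P (algebraMap k[X] _ p) = aeval (pointX P) p := by
  have : (P.comp (IsScalarTower.toAlgHom k k[X] (torsionRing k τ))) = aeval (pointX P) := by
    ext; simp [pointX]
  exact DFunLike.congr_fun this p

lemma point_pow_card {τ : R} (P : torsionRing k τ →ₐ[k] Ω) (φ : Module.Dual k R) :
    P (torsionElem k τ φ) ^ Fintype.card k =
      P (torsionElem k τ φ) - pointX P * P (torsionElem k τ (dualMul k τ φ)) := by
  rw [← map_pow, torsionElem_pow_card, map_sub, Algebra.smul_def, map_mul, pointX]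

/-- The `q ^ n`-Frobenius acts on a point over `a` as the polynomial
`∏ (1 - a ^ (q ^ i) X)` evaluated at `τ`. -/
lemma point_pow_card_pow {τ : R} (P : torsionRing k τ →ₐ[k] Ω) (n : ℕ) {c : k[X]}
    (hc : c.map (algebraMap k Ω) =
      ∏ i ∈ Finset.range n, (1 - C (pointX P ^ Fintype.card k ^ i) * X)) (φ : Module.Dual k R) :
    P (torsionElem k τ φ) ^ Fintype.card k ^ n =
      P (torsionElem k τ (dualMul k (aeval τ c) φ)) := by
  let η : Module.Dual k R →ₗ[k] Ω := P.toLinearMap ∘ₗ torsionElem k τ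
  let S : Module.End Ω (Module.Dual k R → Ω) := LinearMap.funLeft Ω Ω (dualMul k τ)
  have hS : ∀ (v : Module.Dual k R → Ω) ψ, S v ψ = v (dualMul k τ ψ) := fun _ _ => rfl
  have h1 : ∀ n φ, η φ ^ Fintype.card k ^ n = aeval S
      (∏ i ∈ Finset.range n, (1 - C (pointX P ^ Fintype.card k ^ i) * X)) η φ := by
    intro n
    induction n with
    | zero => intro φ; simp
    | succ n ih =>
      intro φ
      have hcomm : ∀ D : Polynomial Ω, aeval S (D * X) η φ = aeval S D η (dualMul k τ φ) := fun D => by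
        rw [mul_comm, map_mul, aeval_X, Module.End.mul_apply, hS]
      rw [Finset.prod_range_succ, mul_sub, mul_one, map_sub, mul_left_comm, map_mul, aeval_C,
        LinearMap.sub_apply, Pi.sub_apply, Module.End.mul_apply, Module.algebraMap_end_apply,
        Pi.smul_apply, hcomm, ← ih, ← ih, pow_succ', pow_mul]
      have := point_pow_card P φ
      change (P (torsionElem k τ φ) ^ _) ^ _ = P (torsionElem k τ φ) ^ _ -
        _ • P (torsionElem k τ (dualMul k τ φ)) ^ _
      rw [this, ← frobPow_apply, map_sub, map_mul]
      simp only [frobPow_apply, smul_eq_mul]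
  have h2 : ∀ (c : k[X]) φ, aeval S (c.map (algebraMap k Ω)) η φ = η (dualMul k (aeval τ c) φ) := by
    intro c
    have hpow : ∀ n φ, (S ^ n) η φ = η (dualMul k (τ ^ n) φ) := by
      intro n
      induction n with
      | zero =>
        intro φ
        have : dualMul k (1 : R) φ = φ := by ext x; simp
        simp [this]
      | succ n ih => intro φ; rw [pow_succ', Module.End.mul_apply, hS, ih, pow_succ, dualMul_mul]
    induction c using Polynomial.induction_on' with
    | add p q hp hq =>
      intro φ
      have : dualMul k (aeval τ (p + q)) φ = dualMul k (aeval τ p) φ + dualMul k (aeval τ q) φ := by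
        ext x; simp [add_mul]
      rw [Polynomial.map_add, map_add, LinearMap.add_apply, Pi.add_apply, hp, hq, this, map_add]
    | monomial n a =>
      intro φ
      have : dualMul k (aeval τ (monomial n a)) φ = a • dualMul k (τ ^ n) φ := by
        ext x; simp [aeval_monomial, ← Algebra.smul_def]
      rw [map_monomial, aeval_monomial, Module.End.mul_apply, Module.algebraMap_end_apply,
        Pi.smul_apply, hpow, this, map_smul, algebraMap_smul]
  have := h1 n φ
  rw [← hc, h2] at this
  exact this

variable (k Ω) in
/-- Outside the zeros of a suitable nonzero element, points separate the dual of `R` and the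
Frobenius acts through `torsionShift`. -/
lemma exists_ne_zero_of_point [Finite R] (τ : R) : ∃ z : torsionRing k τ, z ≠ 0 ∧
    ∀ P : torsionRing k τ →ₐ[k] Ω, P z ≠ 0 →
      (∀ ρ : R, ρ ≠ 0 → ∃ φ, P (torsionElem k τ (dualMul k ρ φ)) ≠ 0) ∧
      ∀ n b, pointX P ^ Fintype.card k ^ n = pointX P →
        (∀ φ, P (torsionElem k τ φ) ^ Fintype.card k ^ n = P (torsionElem k τ (dualMul k b φ))) →
        b ∈ torsionShift k τ := by
  classical
  cases nonempty_fintype R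
  have h1 : ∀ ρ : R, ∃ z : torsionRing k τ, z ≠ 0 ∧
      ∀ P : torsionRing k τ →ₐ[k] Ω, P z ≠ 0 → ρ ≠ 0 →
        ∃ φ, P (torsionElem k τ (dualMul k ρ φ)) ≠ 0 := by
    intro ρ
    by_cases hρ : ρ = 0
    · exact ⟨1, one_ne_zero, fun P _ h => absurd hρ h⟩
    · obtain ⟨φ, hφ⟩ : ∃ φ : Module.Dual k R, φ ρ ≠ 0 := by
        by_contra! h
        exact hρ ((Module.forall_dual_apply_eq_zero_iff k ρ).1 h)
      refine ⟨torsionElem k τ (dualMul k ρ φ), fun h => ?_, fun P hP _ => ⟨φ, hP⟩⟩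
      have h2 := constantCoeff_torsionSeries k τ (dualMul k ρ φ)
      have h3 : torsionSeries k τ (dualMul k ρ φ) = 0 := congrArg Subtype.val h
      rw [h3, map_zero, dualMul_apply, mul_one] at h2
      exact hφ h2.symm
  have h2 : ∀ b : R, ∃ z : torsionRing k τ, z ≠ 0 ∧
      ∀ P : torsionRing k τ →ₐ[k] Ω, P z ≠ 0 → IsUnit b →
        ∀ n, pointX P ^ Fintype.card k ^ n = pointX P →
        (∀ φ, P (torsionElem k τ φ) ^ Fintype.card k ^ n = P (torsionElem k τ (dualMul k b φ))) →
        b ∈ torsionShift k τ := by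
    intro b
    by_cases hb : b ∈ torsionShift k τ
    · exact ⟨1, one_ne_zero, fun _ _ _ _ _ _ => hb⟩
    by_cases hu : IsUnit b
    swap
    · exact ⟨1, one_ne_zero, fun _ _ h => absurd h hu⟩
    obtain ⟨f, hf, hf2⟩ : ∃ f, torsionPres k τ f = 0 ∧
        MvPolynomial.aeval (fun φ => torsionElem k τ (dualMul k b φ)) f ≠ 0 := by
      by_contra! h
      exact hb (mem_torsionShift_of_forall k hu h)
    refine ⟨_, hf2, fun P hP _ n hn hφ => absurd ?_ hP⟩
    have hhom : (P : torsionRing k τ →+* Ω).comp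
          (MvPolynomial.aeval (fun φ => torsionElem k τ (dualMul k b φ))).toRingHom =
        ((frobPow k Ω n : Ω →ₐ[k] Ω) : Ω →+* Ω).comp
          ((P : torsionRing k τ →+* Ω).comp (torsionPres k τ).toRingHom) := by
      refine MvPolynomial.ringHom_ext (fun p => ?_) (fun φ => ?_)
      · have : torsionPres k τ (MvPolynomial.C p) = algebraMap _ _ p := (torsionPres k τ).commutes p
        have h3 : frobPow k Ω n (aeval (pointX P) p) = aeval (pointX P) p := by
          rw [← aeval_algHom_apply, frobPow_apply, hn]
        simp [this, apply_algebraMap_eq_aeval, h3]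
      · simp [frobPow_apply, hφ]
    have h4 := RingHom.congr_fun hhom f
    have h5 : P (torsionPres k τ f) = 0 := by rw [hf, map_zero]
    simpa [h5] using h4
  choose z₁ hz₁ hz₁' using h1
  choose z₂ hz₂ hz₂' using h2
  refine ⟨(∏ ρ, z₁ ρ) * ∏ b, z₂ b, mul_ne_zero (Finset.prod_ne_zero_iff.2 fun ρ _ => hz₁ ρ)
    (Finset.prod_ne_zero_iff.2 fun ρ _ => hz₂ ρ), fun P hP => ?_⟩
  rw [map_mul, map_prod, map_prod] at hP
  have hP1 := fun ρ => Finset.prod_ne_zero_iff.1 (left_ne_zero_of_mul hP) ρ (Finset.mem_univ _)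
  have hP2 := fun b => Finset.prod_ne_zero_iff.1 (right_ne_zero_of_mul hP) b (Finset.mem_univ _)
  have hsep := fun ρ => hz₁' ρ P (hP1 ρ)
  refine ⟨hsep, fun n b hn hφ => hz₂' b P (hP2 b) ?_ n hn hφ⟩
  by_contra hb
  obtain ⟨ρ, hρ, hρ0⟩ : ∃ ρ, ρ * b = 0 ∧ ρ ≠ 0 := by
    by_contra! h
    have hinj : Function.Injective fun x : R => x * b := fun x y hxy => by
      refine sub_eq_zero.1 (h _ ?_)
      rw [sub_mul]; exact sub_eq_zero.2 hxy
    obtain ⟨c, hc⟩ := (Finite.injective_iff_surjective.1 hinj) 1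
    exact hb (IsUnit.of_mul_eq_one_right c hc)
  obtain ⟨φ, h⟩ := hsep ρ hρ0
  have h3 := hφ (dualMul k ρ φ)
  rw [← dualMul_mul, mul_comm b, hρ] at h3
  have h4 : dualMul k (0 : R) φ = 0 := by ext x; simp
  rw [h4, map_zero, map_zero] at h3
  exact h (pow_eq_zero_iff (pow_ne_zero _ Fintype.card_ne_zero) |>.1 h3)

/-- Every algebraic `a` is the `x`-coordinate of a point. -/
lemma exists_point [Finite R] [IsAlgClosed Ω] [Algebra.IsAlgebraic k Ω] (τ : R) (a : Ω) :
    ∃ P : torsionRing k τ →ₐ[k] Ω, pointX P = a := by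
  set p := RingHom.ker (aeval (R := k) a) with hp
  have hintegral : IsIntegral k a := Algebra.IsIntegral.isIntegral a
  have hpne : p ≠ ⊥ := fun h => minpoly.ne_zero hintegral (by
    have : minpoly k a ∈ p := (RingHom.mem_ker).2 (minpoly.aeval k a)
    rwa [h] at this)
  have hpprime : p.IsPrime := RingHom.ker_isPrime _
  have hpmax : p.IsMaximal := hpprime.isMaximal hpne
  obtain ⟨Q, hQ, hQp⟩ := Ideal.exists_maximal_ideal_liesOver_of_isIntegral
    (S := torsionRing k τ) p
  let := Ideal.Quotient.field Q
  let := Ideal.Quotient.field p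
  have h1 : Algebra.IsIntegral k (k[X] ⧸ p) :=
    Algebra.IsIntegral.of_injective (Ideal.kerLiftAlg (aeval (R := k) a))
      (Ideal.kerLiftAlg_injective _)
  have h2 : Algebra.IsIntegral (k[X] ⧸ p) (torsionRing k τ ⧸ Q) := inferInstance
  have h3 : IsScalarTower k (k[X] ⧸ p) (torsionRing k τ ⧸ Q) := inferInstance
  have h4 : Algebra.IsIntegral k (torsionRing k τ ⧸ Q) := Algebra.IsIntegral.trans (k[X] ⧸ p)
  set x : torsionRing k τ ⧸ Q := Ideal.Quotient.mk Q (algebraMap k[X] _ X) with hx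
  have h5 : aeval x (minpoly k a) = 0 := by
    have h6 : minpoly k a ∈ Q.comap (algebraMap k[X] (torsionRing k τ)) := by
      rw [← Ideal.under_def, ← hQp.over]; exact (RingHom.mem_ker).2 (minpoly.aeval k a)
    have h7 : aeval x (minpoly k a) =
        Ideal.Quotient.mk Q (algebraMap k[X] _ (minpoly k a)) := by
      have : aeval x = (Ideal.Quotient.mkₐ k Q).comp
          (IsScalarTower.toAlgHom k k[X] (torsionRing k τ)) := by
        ext; simp [hx]
      rw [this]; rfl
    rw [h7]; exact Ideal.Quotient.eq_zero_iff_mem.2 h6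
  have h8 : minpoly k x = minpoly k a := (minpoly.eq_of_irreducible_of_monic
    (minpoly.irreducible hintegral) h5 (minpoly.monic hintegral)).symm
  obtain ⟨ψ, hψ⟩ := IntermediateField.exists_algHom_of_splits_of_aeval (F := k) (K := Ω)
    (x := x) (y := a)
    (fun s => ⟨Algebra.IsIntegral.isIntegral s, IsAlgClosed.splits _⟩)
    (by rw [h8]; exact minpoly.aeval k a)
  exact ⟨ψ.comp (Ideal.Quotient.mkₐ k Q), hψ⟩

end TorsionPoints

section Orbit

variable {k Ω : Type*} [Field k] [Fintype k] [Field Ω] [Algebra k Ω]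

lemma mem_range_algebraMap_of_pow_card {x : Ω} (h : x ^ Fintype.card k = x) :
    x ∈ Set.range (algebraMap k Ω) := by
  classical
  have hq1 : 1 < Fintype.card k := Fintype.one_lt_card
  have hne : (X ^ Fintype.card k - X : Polynomial Ω) ≠ 0 := FiniteField.X_pow_card_sub_X_ne_zero Ω hq1
  set S : Finset Ω := Finset.univ.image (algebraMap k Ω) with hS
  have hsub : S ⊆ (X ^ Fintype.card k - X : Polynomial Ω).roots.toFinset := by
    intro y hy
    obtain ⟨c, -, rfl⟩ := Finset.mem_image.1 hy
    rw [Multiset.mem_toFinset, mem_roots hne]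
    simp [IsRoot, ← map_pow, FiniteField.pow_card]
  have hcard : (X ^ Fintype.card k - X : Polynomial Ω).roots.toFinset.card ≤ S.card := by
    rw [hS, Finset.card_image_of_injective _ (algebraMap k Ω).injective, Finset.card_univ]
    exact (Multiset.toFinset_card_le _).trans ((card_roots' _).trans
      (FiniteField.X_pow_card_sub_X_natDegree_eq Ω hq1).le)
  have heq := Finset.eq_of_subset_of_card_le hsub hcard
  have hx : x ∈ S := by
    rw [heq, Multiset.mem_toFinset, mem_roots hne]
    simp [IsRoot, h]
  obtain ⟨c, -, rfl⟩ := Finset.mem_image.1 hx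
  exact ⟨c, rfl⟩

lemma exists_map_eq_of_map_frobenius_eq {p : Polynomial Ω}
    (h : p.map ((frobPow k Ω 1 : Ω →ₐ[k] Ω) : Ω →+* Ω) = p) :
    ∃ g : k[X], g.map (algebraMap k Ω) = p := by
  have : p ∈ lifts (algebraMap k Ω) := by
    rw [lifts_iff_coeff_lifts]
    intro i
    refine mem_range_algebraMap_of_pow_card ?_
    have := congrArg (fun p => p.coeff i) h
    simpa [frobPow_apply] using this
  exact (mem_lifts p).1 this

lemma exists_map_eq_prod {a : Ω} {n : ℕ} (h : a ^ Fintype.card k ^ n = a) :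
    ∃ g : k[X], g.map (algebraMap k Ω) =
      ∏ i ∈ Finset.range n, (X - C (a ^ Fintype.card k ^ i)) := by
  refine exists_map_eq_of_map_frobenius_eq ?_
  have h1 : ∀ i, (X - C (a ^ Fintype.card k ^ i)).map ((frobPow k Ω 1 : Ω →ₐ[k] Ω) : Ω →+* Ω) =
      X - C (a ^ Fintype.card k ^ (i + 1)) := fun i => by
    simp [frobPow_apply, pow_succ, pow_mul, pow_right_comm]
  rw [Polynomial.map_prod, Finset.prod_congr rfl fun i _ => h1 i]
  cases n with
  | zero => simp
  | succ n =>
    rw [Finset.prod_range_succ, Finset.prod_range_succ' _ n, h, pow_zero, pow_one]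

open scoped Classical in
/-- The polynomial over `k` with roots `a, a ^ q, …, a ^ (q ^ (n - 1))`, provided
`a ^ (q ^ n) = a`. -/
noncomputable def orbitPoly (k : Type*) {Ω : Type*} [Field k] [Fintype k] [Field Ω] [Algebra k Ω]
    (n : ℕ) (a : Ω) : k[X] :=
  if h : a ^ Fintype.card k ^ n = a then (exists_map_eq_prod h).choose else 1

lemma map_orbitPoly {a : Ω} {n : ℕ} (h : a ^ Fintype.card k ^ n = a) :
    (orbitPoly k n a).map (algebraMap k Ω) =
      ∏ i ∈ Finset.range n, (X - C (a ^ Fintype.card k ^ i)) := by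
  rw [orbitPoly, dif_pos h]
  exact (exists_map_eq_prod h).choose_spec

lemma reverse_prod_X_sub_C {n : ℕ} (s : ℕ → Ω) :
    (∏ i ∈ Finset.range n, (X - C (s i))).reverse = ∏ i ∈ Finset.range n, (1 - C (s i) * X) := by
  have hone : reverse (1 : Polynomial Ω) = 1 := by rw [← C_1, reverse_C]
  induction n with
  | zero => simp [hone]
  | succ n ih =>
    rw [Finset.prod_range_succ, reverse_mul_of_domain, ih, Finset.prod_range_succ]
    congr 1
    have h : (X - C (s n) : Polynomial Ω) = 1 * X + C (-s n) := by simp [sub_eq_add_neg]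
    have h2 : (1 - C (s n) * X : Polynomial Ω) = 1 + C (-s n) * X := by simp [sub_eq_add_neg]
    rw [h, h2, reverse_add_C, reverse_mul_X]
    simp [hone]

lemma reverse_map_of_injective {A B : Type*} [Semiring A] [Semiring B] {f : A →+* B}
    (hf : Function.Injective f) (p : A[X]) : (p.map f).reverse = p.reverse.map f := by
  ext i
  rw [coeff_reverse, coeff_map, natDegree_map_eq_of_injective hf, coeff_map, coeff_reverse]

lemma map_reverse_orbitPoly {a : Ω} {n : ℕ} (h : a ^ Fintype.card k ^ n = a) :
    (orbitPoly k n a).reverse.map (algebraMap k Ω) =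
      ∏ i ∈ Finset.range n, (1 - C (a ^ Fintype.card k ^ i) * X) := by
  rw [← reverse_map_of_injective (algebraMap k Ω).injective, map_orbitPoly h,
    reverse_prod_X_sub_C]

lemma monic_orbitPoly (k : Type*) {Ω : Type*} [Field k] [Fintype k] [Field Ω] [Algebra k Ω]
    (n : ℕ) (a : Ω) : (orbitPoly k n a).Monic := by
  by_cases h : a ^ Fintype.card k ^ n = a
  · refine monic_of_injective (algebraMap k Ω).injective ?_
    rw [map_orbitPoly h]
    exact monic_prod_of_monic _ _ fun i _ => monic_X_sub_C _
  · rw [orbitPoly, dif_neg h]; exact monic_one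

lemma natDegree_orbitPoly {a : Ω} {n : ℕ} (h : a ^ Fintype.card k ^ n = a) :
    (orbitPoly k n a).natDegree = n := by
  rw [← natDegree_map (algebraMap k Ω), map_orbitPoly h,
    natDegree_prod_of_monic _ _ fun i _ => monic_X_sub_C _]
  simp only [natDegree_X_sub_C, Finset.sum_const, Finset.card_range, smul_eq_mul, mul_one]

open scoped Classical in
/-- The elements of `Ω` fixed by the `q ^ n`-Frobenius. -/
noncomputable def frobFixed (k Ω : Type*) [Field k] [Fintype k] [Field Ω] (n : ℕ) : Finset Ω :=
  (X ^ Fintype.card k ^ n - X : Polynomial Ω).roots.toFinset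

omit [Algebra k Ω] in
lemma mem_frobFixed {n : ℕ} (hn : n ≠ 0) {a : Ω} :
    a ∈ frobFixed k Ω n ↔ a ^ Fintype.card k ^ n = a := by
  classical
  have hq1 : 1 < Fintype.card k ^ n := Nat.one_lt_pow hn Fintype.one_lt_card
  rw [frobFixed, Multiset.mem_toFinset, mem_roots (FiniteField.X_pow_card_sub_X_ne_zero Ω hq1)]
  simp [IsRoot, sub_eq_zero]

lemma card_frobFixed [IsAlgClosed Ω] {n : ℕ} (hn : n ≠ 0) :
    (frobFixed k Ω n).card = Fintype.card k ^ n := by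
  classical
  obtain ⟨p, hp⟩ := CharP.exists k
  obtain ⟨m, hpm⟩ := FiniteField.card k p
  have : Fact p.Prime := ⟨hpm.1⟩
  have : CharP Ω p := charP_of_injective_algebraMap (algebraMap k Ω).injective p
  have hq1 : 1 < Fintype.card k ^ n := Nat.one_lt_pow hn Fintype.one_lt_card
  have hdvd : p ∣ Fintype.card k ^ n := by
    rw [hpm.2, ← pow_mul]
    exact dvd_pow_self p (mul_ne_zero m.ne_zero hn)
  have hsep := galois_poly_separable (K := Ω) p _ hdvd
  rw [frobFixed, Multiset.toFinset_card_of_nodup (nodup_roots hsep),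
    ← (IsAlgClosed.splits _).natDegree_eq_card_roots, FiniteField.X_pow_card_sub_X_natDegree_eq Ω hq1]

end Orbit

section Equidistribution

variable (k : Type*) [Field k] [Fintype k] {R : Type*} [CommRing R] [Algebra k R] [Finite R]
  (Ω : Type*) [Field Ω] [Algebra k Ω] [IsAlgClosed Ω] [Algebra.IsAlgebraic k Ω]

lemma exists_card_orbit_notMem_le (τ : R) : ∃ C : ℕ, ∀ n ≠ 0, ∀ S ⊆ frobFixed k Ω n,
    (∀ a ∈ S, aeval τ (orbitPoly k n a).reverse ∉ torsionShift k τ) → S.card ≤ C := by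
  classical
  obtain ⟨z, hz, hzP⟩ := exists_ne_zero_of_point k Ω τ
  choose P hP using exists_point (k := k) (Ω := Ω) τ
  set ω := Module.Free.chooseBasis k[X] (torsionRing k τ)
  refine ⟨(Algebra.norm k[X] z).natDegree, fun n hn S hS h => ?_⟩
  have hinj : Function.Injective P := fun a b hab => by rw [← hP a, ← hP b, hab]
  rw [← Finset.card_image_of_injective S hinj]
  refine card_algHom_le_of_forall_eq_zero ω hz _ ?_
  rintro _ hQ
  obtain ⟨a, ha, rfl⟩ := Finset.mem_image.1 hQ
  by_contra hne
  have hfix := (mem_frobFixed hn).1 (hS ha)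
  refine h a ha ((hzP _ hne).2 n _ (by rw [hP, hfix]) fun φ => ?_)
  refine point_pow_card_pow (P a) n ?_ φ
  rw [map_reverse_orbitPoly hfix, hP]

lemma exists_card_orbit_eq_le (τ : R) : ∃ C n₀ : ℕ, ∀ n, n₀ ≤ n → ∀ b ∈ torsionShift k τ,
    ∀ S ⊆ frobFixed k Ω (2 * n),
    (∀ a ∈ S, aeval τ (orbitPoly k (2 * n) a).reverse = b) →
      Nat.card (torsionShift k τ) * S.card ≤
        Fintype.card k ^ (2 * n) + C * Fintype.card k ^ n := by
  classical
  obtain ⟨z, hz, hzP⟩ := exists_ne_zero_of_point k Ω τ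
  choose P hP using exists_point (k := k) (Ω := Ω) τ
  set ω := Module.Free.chooseBasis k[X] (torsionRing k τ)
  have : Nonempty (Module.Free.ChooseBasisIndex k[X] (torsionRing k τ)) := ω.index_nonempty
  cases nonempty_fintype (torsionShift k τ)
  choose σ hσ using fun h : torsionShift k τ => h.2.2
  have hθ : Function.Injective (torsionRing k τ).val := Subtype.val_injective
  choose C n₀ hC using fun b : torsionShift k τ => exists_card_algHom_le ω _ hθ (σ b) Ω
  set C₀ := (Algebra.norm k[X] z).natDegree with hC₀
  have hinj : Function.Injective P := fun a b hab => by rw [← hP a, ← hP b, hab]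
  refine ⟨(Finset.univ.sup C) + Fintype.card (torsionShift k τ) * C₀, Finset.univ.sup n₀ + 1,
    fun n hn b hb S hS hSb => ?_⟩
  have hn0 : 2 * n ≠ 0 := by omega
  set S' := S.filter fun a => P a z ≠ 0 with hS'
  have hbad : (S.filter fun a => ¬ P a z ≠ 0).card ≤ C₀ := by
    rw [← Finset.card_image_of_injective _ hinj]
    refine card_algHom_le_of_forall_eq_zero ω hz _ ?_
    rintro _ hQ
    obtain ⟨a, ha, rfl⟩ := Finset.mem_image.1 hQ
    simpa using (Finset.mem_filter.1 ha).2
  let Pσ : Ω × torsionShift k τ → (torsionRing k τ →ₐ[k] Ω) := fun x =>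
    (P x.1).comp ((σ x.2).restrictScalars k)
  have hPσX : ∀ x, pointX (Pσ x) = x.1 := fun x => by
    rw [← hP x.1, pointX, pointX]
    simp [Pσ]
  set T := (S' ×ˢ (Finset.univ : Finset (torsionShift k τ))).image Pσ with hT
  have hTcard : T.card = S'.card * Fintype.card (torsionShift k τ) := by
    rw [hT, Finset.card_image_of_injOn, Finset.card_product, Finset.card_univ]
    rintro ⟨a, h⟩ ha ⟨a', h'⟩ - hEq
    have h1 : a = a' := by
      have := congrArg pointX hEq
      rwa [hPσX, hPσX] at this
    subst h1
    have haz : P a z ≠ 0 := (Finset.mem_filter.1 (Finset.mem_product.1 ha).1).2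
    refine Prod.ext rfl (Subtype.ext ?_)
    by_contra hne
    obtain ⟨φ, hφ⟩ := (hzP _ haz).1 (h - h') (sub_ne_zero.2 hne)
    have h2 := DFunLike.congr_fun hEq (torsionElem k τ φ)
    have h3 : P a (σ h (torsionElem k τ φ)) = P a (σ h' (torsionElem k τ φ)) := h2
    rw [hσ, hσ] at h3
    refine hφ ?_
    have : dualMul k ((h : R) - h') φ = dualMul k (h : R) φ - dualMul k (h' : R) φ := by
      ext x; simp [sub_mul]
    rw [this, map_sub, map_sub, h3, sub_self]
  have hTP : ∀ Q ∈ T, ∀ f, Q f ^ Fintype.card k ^ (2 * n) = Q (σ ⟨b, hb⟩ f) := by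
    intro Q hQ
    obtain ⟨⟨a, h⟩, ha, rfl⟩ := Finset.mem_image.1 hQ
    have haS : a ∈ S := (Finset.mem_filter.1 (Finset.mem_product.1 ha).1).1
    have hfix := (mem_frobFixed hn0).1 (hS haS)
    have hhom : ((frobPow k Ω (2 * n) : Ω →ₐ[k] Ω) : Ω →+* Ω).comp
        ((Pσ (a, h) : torsionRing k τ →ₐ[k] Ω) : torsionRing k τ →+* Ω) =
        ((Pσ (a, h) : torsionRing k τ →ₐ[k] Ω) : torsionRing k τ →+* Ω).comp
          ((σ ⟨b, hb⟩ : torsionRing k τ →ₐ[k[X]] torsionRing k τ) :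
            torsionRing k τ →+* torsionRing k τ) := by
      refine torsionRing_hom_ext k (fun p => ?_) (fun φ => ?_)
      · have h3 : frobPow k Ω (2 * n) (aeval a p) = aeval a p := by
          rw [← aeval_algHom_apply, frobPow_apply, hfix]
        simp [apply_algebraMap_eq_aeval, hPσX, h3]
      · have h4 := point_pow_card_pow (P a) (2 * n) (c := (orbitPoly k (2 * n) a).reverse)
          (by rw [map_reverse_orbitPoly hfix, hP]) (dualMul k (h : R) φ)
        rw [hSb a haS, ← dualMul_mul, mul_comm b] at h4
        have h5 : ∀ ψ, Pσ (a, h) (torsionElem k τ ψ) = P a (torsionElem k τ (dualMul k (h : R) ψ)) :=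
          fun ψ => by
            change P a (σ h _) = _
            rw [hσ]
        simp [hσ, frobPow_apply, h5, h4, ← dualMul_mul]
    intro f
    have := RingHom.congr_fun hhom f
    simpa [frobPow_apply] using this
  have hmain := hC ⟨b, hb⟩ n
    ((Finset.le_sup (f := n₀) (Finset.mem_univ _)).trans (by omega)) T hTP
  have hsplit := Finset.card_filter_add_card_filter_not (s := S) (fun a => P a z ≠ 0)
  rw [Nat.card_eq_fintype_card, ← hsplit]
  have hCle : C ⟨b, hb⟩ ≤ Finset.univ.sup C := Finset.le_sup (f := C) (Finset.mem_univ _)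
  have hq1 : 1 ≤ Fintype.card k ^ n := Nat.one_le_iff_ne_zero.2 (pow_ne_zero _ Fintype.card_ne_zero)
  rw [hTcard] at hmain
  have e1 : Fintype.card (torsionShift k τ) * (S.filter fun a => ¬ P a z ≠ 0).card ≤
      Fintype.card (torsionShift k τ) * C₀ * Fintype.card k ^ n :=
    (Nat.mul_le_mul_left _ hbad).trans (Nat.le_mul_of_pos_right _ hq1)
  have e2 := Nat.mul_le_mul_right (Fintype.card k ^ n) hCle
  rw [mul_add (Fintype.card _), add_mul]
  rw [hS', mul_comm (Finset.card _)] at hmain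
  omega

end Equidistribution

section CharacterSum

lemma sum_submonoid_eq_zero_or_card {R : Type*} [CommRing R] (H : Submonoid R) [Fintype H]
    (hH : ∀ b ∈ H, IsUnit b) (w : R → ℂ) (hw : ∀ a ∈ H, ∀ b ∈ H, w (a * b) = w a * w b) :
    ∑ b : H, w b = 0 ∨ ∑ b : H, w b = Fintype.card H := by
  by_cases h : ∀ b ∈ H, w b = 1
  · right
    rw [Finset.sum_congr rfl fun b _ => h b.1 b.2]
    simp
  · left
    push Not at h
    obtain ⟨b, hb, hb1⟩ := h
    have hinj : Function.Injective fun c : H => (⟨b, hb⟩ * c : H) := fun c d hcd =>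
      Subtype.ext ((hH b hb).mul_left_cancel (congrArg Subtype.val hcd))
    have hsum := (Finite.injective_iff_bijective.1 hinj).sum_comp (fun c : H => w c)
    simp only [Submonoid.coe_mul, hw b hb _ (Subtype.prop _)] at hsum
    rw [← Finset.mul_sum] at hsum
    have : (w b - 1) * ∑ c : H, w c = 0 := by rw [sub_mul, hsum]; ring
    exact (mul_eq_zero.1 this).resolve_left (sub_ne_zero.2 hb1)

variable (k : Type*) [Field k] [Fintype k] {R : Type*} [CommRing R] [Algebra k R] [Finite R]
  (Ω : Type*) [Field Ω] [Algebra k Ω] [IsAlgClosed Ω] [Algebra.IsAlgebraic k Ω]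

open scoped Classical in
lemma exists_abs_card_orbit_sub_le (τ : R) : ∃ (C : ℝ) (n₀ : ℕ), ∀ n, n₀ ≤ n →
    ∀ b ∈ torsionShift k τ,
      |(((frobFixed k Ω (2 * n)).filter fun a =>
        aeval τ (orbitPoly k (2 * n) a).reverse = b).card : ℝ) -
          (Fintype.card k : ℝ) ^ (2 * n) / Nat.card (torsionShift k τ)| ≤
        C * (Fintype.card k : ℝ) ^ n := by
  obtain ⟨C₁, h1⟩ := exists_card_orbit_notMem_le k Ω τ
  obtain ⟨C₂, n₀, h2⟩ := exists_card_orbit_eq_le k Ω τ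
  cases nonempty_fintype (torsionShift k τ)
  set H := torsionShift k τ with hH
  refine ⟨C₂ + C₁ + Nat.card H * C₂, n₀ + 1, fun n hn b hb => ?_⟩
  set v : Ω → R := fun a => aeval τ (orbitPoly k (2 * n) a).reverse with hv
  set A := frobFixed k Ω (2 * n) with hA
  set N : R → ℕ := fun b => (A.filter fun a => v a = b).card with hN
  set q : ℝ := (Fintype.card k : ℝ) with hq
  set h : ℝ := (Nat.card H : ℝ) with hh
  have hn0 : 2 * n ≠ 0 := by omega
  have hh1 : 1 ≤ h := by
    rw [hh]; exact_mod_cast Nat.one_le_iff_ne_zero.2 Nat.card_pos.ne'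
  have hq1 : 1 ≤ q ^ n := one_le_pow₀ (by rw [hq]; exact_mod_cast Fintype.card_pos)
  have hup : ∀ c ∈ H, h * (N c : ℝ) ≤ q ^ (2 * n) + C₂ * q ^ n := fun c hc => by
    have := h2 n (by omega) c hc (A.filter fun a => v a = c) (Finset.filter_subset _ _)
      fun a ha => (Finset.mem_filter.1 ha).2
    rw [hh, hq, hN]
    exact_mod_cast this
  have hbad : ((A.filter fun a => v a ∉ H).card : ℝ) ≤ C₁ := by
    have := h1 (2 * n) hn0 (A.filter fun a => v a ∉ H) (Finset.filter_subset _ _)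
      fun a ha => (Finset.mem_filter.1 ha).2
    exact_mod_cast this
  have htot : (∑ c : H, (N c : ℝ)) + ((A.filter fun a => v a ∉ H).card : ℝ) = q ^ (2 * n) := by
    have e1 := Finset.card_filter_add_card_filter_not (s := A) (fun a => v a ∈ H)
    rw [hA, card_frobFixed hn0] at e1
    have e2 : (A.filter fun a => v a ∈ H).card = ∑ c : H, N c := by
      have : (A.filter fun a => v a ∈ H) =
          Finset.univ.biUnion fun c : H => A.filter fun a => v a = c := by
        ext a
        simp only [Finset.mem_filter, Finset.mem_biUnion, Finset.mem_univ, true_and]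
        constructor
        · rintro ⟨ha, hv⟩; exact ⟨⟨v a, hv⟩, ha, rfl⟩
        · rintro ⟨c, ha, hv⟩; exact ⟨ha, hv ▸ c.2⟩
      rw [this, Finset.card_biUnion]
      intro c _ d _ hcd
      refine Finset.disjoint_left.2 fun a ha ha' => hcd (Subtype.ext ?_)
      rw [← (Finset.mem_filter.1 ha).2, (Finset.mem_filter.1 ha').2]
    rw [← hA, e2] at e1
    rw [hq]
    exact_mod_cast e1
  have hsum : h * ∑ c : H, (N c : ℝ) ≤ h * N b + (h - 1) * (q ^ (2 * n) + C₂ * q ^ n) := by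
    rw [← Finset.add_sum_erase _ _ (Finset.mem_univ (⟨b, hb⟩ : H)), mul_add, Finset.mul_sum]
    gcongr
    refine (Finset.sum_le_card_nsmul _ _ _ fun (c : H) _ => hup c c.2).trans (le_of_eq ?_)
    rw [Finset.card_erase_of_mem (Finset.mem_univ _), Finset.card_univ, nsmul_eq_mul,
      Nat.cast_sub Fintype.card_pos, hh, Nat.card_eq_fintype_card, Nat.cast_one]
  have hb' := hup b hb
  change |(N b : ℝ) - _| ≤ _
  have hC1 : (0 : ℝ) ≤ C₁ := Nat.cast_nonneg _
  have hC2 : (0 : ℝ) ≤ C₂ := Nat.cast_nonneg _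
  have hhpos : 0 < h := by linarith
  have key : |h * N b - q ^ (2 * n)| ≤ h * ((C₂ + C₁ + h * C₂) * q ^ n) := by
    have p1 : C₁ ≤ C₁ * q ^ n := le_mul_of_one_le_right hC1 hq1
    have p2 : 0 ≤ C₂ * q ^ n := by positivity
    have p3 : 0 ≤ C₁ * q ^ n := by positivity
    have hbad' := mul_le_mul_of_nonneg_left (hbad.trans p1) hhpos.le
    have htot' := congrArg (h * ·) htot
    simp only [mul_add] at htot'
    have p4 := mul_le_mul_of_nonneg_right hh1 p2
    have p5 : 0 ≤ h * (h * (C₂ * q ^ n)) := by positivity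
    have p6 : 0 ≤ h * (C₁ * q ^ n) := by positivity
    rw [abs_le]
    constructor <;> nlinarith
  rw [show (N b : ℝ) - q ^ (2 * n) / h = (h * N b - q ^ (2 * n)) / h by field_simp, abs_div,
    abs_of_pos hhpos, div_le_iff₀ hhpos]
  linarith

theorem exists_norm_sum_orbit_sub_le (τ : R) (ν : k[X] → ℂ)
    (hmul : ∀ f g : k[X], f.Monic → g.Monic → ν (f * g) = ν f * ν g)
    (hν : ∀ f : k[X], f.Monic → ‖ν f‖ ≤ 1) (ζ : ℂ) (hζ : ‖ζ‖ = 1)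
    (h : ∀ f g : k[X], f.Monic → g.Monic → aeval τ f.reverse = aeval τ g.reverse →
      ζ ^ g.natDegree * ν f = ζ ^ f.natDegree * ν g) :
    ∃ δ : ℂ, (δ = 0 ∨ δ = 1) ∧ ∃ (C : ℝ) (n₀ : ℕ), ∀ n, n₀ ≤ n →
      ‖∑ a ∈ frobFixed k Ω (2 * n), ν (orbitPoly k (2 * n) a) -
        δ * ζ ^ (2 * n) * (Fintype.card k : ℂ) ^ (2 * n)‖ ≤ C * (Fintype.card k : ℝ) ^ n := by
  classical
  have hζ0 : ζ ≠ 0 := fun h0 => by simp [h0] at hζ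
  obtain ⟨C₁, h1⟩ := exists_card_orbit_notMem_le k Ω τ
  obtain ⟨C₂, n₀, h2⟩ := exists_abs_card_orbit_sub_le k Ω τ
  cases nonempty_fintype (torsionShift k τ)
  set H := torsionShift k τ with hH
  set q : ℝ := (Fintype.card k : ℝ) with hq
  let w : R → ℂ := fun b => if hb : ∃ f : k[X], f.Monic ∧ aeval τ f.reverse = b then
    ν hb.choose / ζ ^ hb.choose.natDegree else 0
  have hw : ∀ f : k[X], f.Monic → w (aeval τ f.reverse) = ν f / ζ ^ f.natDegree := by
    intro f hf
    have hex : ∃ g : k[X], g.Monic ∧ aeval τ g.reverse = aeval τ f.reverse := ⟨f, hf, rfl⟩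
    simp only [w, dif_pos hex]
    rw [div_eq_div_iff (pow_ne_zero _ hζ0) (pow_ne_zero _ hζ0), mul_comm, mul_comm (ν f)]
    exact h _ _ hex.choose_spec.1 hf hex.choose_spec.2
  have hwle : ∀ b, ‖w b‖ ≤ 1 := by
    intro b
    by_cases hb : ∃ f : k[X], f.Monic ∧ aeval τ f.reverse = b
    · simp only [w, dif_pos hb]
      rw [norm_div, norm_pow, hζ, one_pow, div_one]
      exact hν _ hb.choose_spec.1
    · simp [w, dif_neg hb]
  have hq1 : 1 < q := by rw [hq]; exact_mod_cast Fintype.one_lt_card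
  have hHpos : (0 : ℝ) < Nat.card H := by exact_mod_cast Nat.card_pos
  have hreal : ∀ b ∈ H, ∃ f : k[X], f.Monic ∧ aeval τ f.reverse = b := by
    intro b hb
    obtain ⟨N, hN⟩ := pow_unbounded_of_one_lt (C₂ * Nat.card H) hq1
    set n := max N n₀
    have hn := h2 n (le_max_right _ _) b hb
    have hqn : C₂ * Nat.card H < q ^ n :=
      hN.trans_le (pow_le_pow_right₀ hq1.le (le_max_left _ _))
    have hpos : 0 < q ^ n := by positivity
    by_contra hcon
    rw [Finset.filter_false_of_mem fun a _ ha => hcon ⟨_, monic_orbitPoly k _ a, ha⟩] at hn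
    rw [Finset.card_empty, Nat.cast_zero, zero_sub, abs_neg, abs_of_pos (by positivity),
      div_le_iff₀ hHpos] at hn
    rw [two_mul, pow_add] at hn
    nlinarith
  have hwmul : ∀ a ∈ H, ∀ b ∈ H, w (a * b) = w a * w b := by
    intro a ha b hb
    obtain ⟨f, hf, rfl⟩ := hreal a ha
    obtain ⟨g, hg, rfl⟩ := hreal b hb
    rw [hw f hf, hw g hg, ← map_mul, ← reverse_mul_of_domain, hw _ (hf.mul hg), hmul f g hf hg,
      hf.natDegree_mul hg, pow_add]
    field_simp
  have hsum := sum_submonoid_eq_zero_or_card H (fun b hb => hb.1) w hwmul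
  refine ⟨(∑ b : H, w b) / Nat.card H, ?_, Nat.card H * C₂ + C₁, n₀ + 1, fun n hn => ?_⟩
  · rcases hsum with h0 | h0
    · left; rw [h0, zero_div]
    · right
      rw [h0, Nat.card_eq_fintype_card, div_self]
      exact_mod_cast Fintype.card_ne_zero
  have hn0 : 2 * n ≠ 0 := by omega
  set A := frobFixed k Ω (2 * n) with hA
  set v : Ω → R := fun a => aeval τ (orbitPoly k (2 * n) a).reverse with hv
  have hνw : ∀ a ∈ A, ν (orbitPoly k (2 * n) a) = ζ ^ (2 * n) * w (v a) := by
    intro a ha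
    rw [hv, hw _ (monic_orbitPoly k _ a), natDegree_orbitPoly ((mem_frobFixed hn0).1 ha)]
    field_simp
  rw [Finset.sum_congr rfl hνw, ← Finset.mul_sum, mul_comm _ (ζ ^ (2 * n)), mul_assoc, ← mul_sub,
    norm_mul, norm_pow, hζ, one_pow, one_mul]
  have hsplit : ∑ a ∈ A, w (v a) = (∑ b : H, ((A.filter fun a => v a = b).card : ℂ) * w b) +
      ∑ a ∈ A.filter (fun a => v a ∉ H), w (v a) := by
    rw [← Finset.sum_filter_add_sum_filter_not A (fun a => v a ∈ H)]
    congr 1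
    have : (A.filter fun a => v a ∈ H) =
        Finset.univ.biUnion fun c : H => A.filter fun a => v a = c := by
      ext a
      simp only [Finset.mem_filter, Finset.mem_biUnion, Finset.mem_univ, true_and]
      constructor
      · rintro ⟨ha, hv⟩; exact ⟨⟨v a, hv⟩, ha, rfl⟩
      · rintro ⟨c, ha, hv⟩; exact ⟨ha, hv ▸ c.2⟩
    rw [this, Finset.sum_biUnion]
    · refine Finset.sum_congr rfl fun c _ => ?_
      rw [Finset.sum_congr rfl fun a ha => by rw [(Finset.mem_filter.1 ha).2], Finset.sum_const,
        nsmul_eq_mul]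
    · intro c _ d _ hcd
      refine Finset.disjoint_left.2 fun a ha ha' => hcd (Subtype.ext ?_)
      rw [← (Finset.mem_filter.1 ha).2, (Finset.mem_filter.1 ha').2]
  have hdiff : ∑ a ∈ A, w (v a) - (∑ b : H, w b) / Nat.card H * (Fintype.card k : ℂ) ^ (2 * n) =
      (∑ b : H, (((A.filter fun a => v a = b).card - q ^ (2 * n) / Nat.card H : ℝ) : ℂ) * w b) +
      ∑ a ∈ A.filter (fun a => v a ∉ H), w (v a) := by
    rw [hsplit, add_sub_right_comm, div_mul_eq_mul_div, mul_comm (∑ b : H, w b), mul_div_right_comm,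
      Finset.mul_sum, ← Finset.sum_sub_distrib]
    congr 1
    refine Finset.sum_congr rfl fun b _ => ?_
    push_cast
    rw [hq]
    push_cast
    ring
  rw [hdiff, add_mul]
  refine (norm_add_le _ _).trans (add_le_add ?_ ?_)
  · refine (norm_sum_le _ _).trans ?_
    rw [mul_assoc, Nat.card_eq_fintype_card, ← nsmul_eq_mul, ← Finset.card_univ]
    refine Finset.sum_le_card_nsmul _ _ _ fun b _ => ?_
    rw [norm_mul, Complex.norm_real, Real.norm_eq_abs]
    rw [Finset.card_univ, ← Nat.card_eq_fintype_card]
    have := h2 n (by omega) b b.2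
    exact (mul_le_of_le_one_right (abs_nonneg _) (hwle _)).trans this
  · refine (norm_sum_le_of_le _ fun a _ => hwle _).trans ?_
    rw [Finset.sum_const, nsmul_eq_mul, mul_one]
    have := h1 (2 * n) hn0 (A.filter fun a => v a ∉ H) (Finset.filter_subset _ _)
      fun a ha => (Finset.mem_filter.1 ha).2
    have h3 : ((A.filter fun a => v a ∉ H).card : ℝ) ≤ C₁ := by exact_mod_cast this
    exact h3.trans (le_mul_of_one_le_right (Nat.cast_nonneg _) (one_le_pow₀ hq1.le))

end CharacterSum

section MonicSums

variable {F : Type*} [Field F]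

lemma monicPoly_coeff {d : ℕ} (x : Fin d → F) (i : Fin d) : (monicPoly F d x).coeff i = x i := by
  rw [monicPoly, coeff_add, coeff_X_pow, if_neg i.2.ne, zero_add, finsetSum_coeff,
    Finset.sum_eq_single i]
  · simp
  · intro j _ hj
    rw [coeff_C_mul, coeff_X_pow, if_neg fun h => hj (Fin.ext h.symm), mul_zero]
  · simp

lemma monic_monicPoly {d : ℕ} (x : Fin d → F) : (monicPoly F d x).Monic :=
  monic_X_pow_add (degree_sum_fin_lt x)

lemma natDegree_monicPoly {d : ℕ} (x : Fin d → F) : (monicPoly F d x).natDegree = d := by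
  have h : (monicPoly F d x).degree = d := by
    rw [monicPoly, degree_add_eq_left_of_degree_lt, degree_X_pow]
    rw [degree_X_pow]
    exact degree_sum_fin_lt x
  exact natDegree_eq_of_degree_eq_some h

lemma monicPoly_injective (d : ℕ) : Function.Injective (monicPoly F d) := fun x y h => by
  ext i
  rw [← monicPoly_coeff x i, h, monicPoly_coeff]

variable [Fintype F]

open scoped Classical in
/-- The finite set of monic polynomials of degree `d`. -/
noncomputable def monicSet (F : Type*) [Field F] [Fintype F] (d : ℕ) : Finset F[X] :=
  Finset.univ.image (monicPoly F d)

lemma mem_monicSet {d : ℕ} {f : F[X]} : f ∈ monicSet F d ↔ f.Monic ∧ f.natDegree = d := by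
  classical
  rw [monicSet, Finset.mem_image]
  constructor
  · rintro ⟨x, -, rfl⟩
    exact ⟨monic_monicPoly x, natDegree_monicPoly x⟩
  · rintro ⟨hf, rfl⟩
    refine ⟨fun i => f.coeff i, Finset.mem_univ _, ?_⟩
    conv_rhs => rw [hf.as_sum]
    rw [monicPoly, Finset.sum_range]

lemma sum_monicSet {d : ℕ} {M : Type*} [AddCommMonoid M] (φ : F[X] → M) :
    ∑ f ∈ monicSet F d, φ f = ∑ x : Fin d → F, φ (monicPoly F d x) := by
  classical
  rw [monicSet, Finset.sum_image fun x _ y _ h => monicPoly_injective d h]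

omit [Fintype F] in
lemma polyMu_one : polyMu (1 : F[X]) = 1 := by
  rw [polyMu, if_pos squarefree_one]
  simp

omit [Fintype F] in
lemma polyMu_mul_of_dvd {P g : F[X]} (hP : Irreducible P) (h : P ∣ g) : polyMu (P * g) = 0 := by
  rw [polyMu, if_neg]
  intro hs
  exact hP.not_isUnit (hs P (mul_dvd_mul_left P h))

omit [Fintype F] in
lemma polyMu_mul_of_not_dvd {P g : F[X]} (hP : Irreducible P) (h : ¬ P ∣ g) :
    polyMu (P * g) = - polyMu g := by
  classical
  have hrel : IsRelPrime P g := (hP.isRelPrime_iff_not_dvd).2 h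
  have hsq : Squarefree (P * g) ↔ Squarefree g := by
    rw [squarefree_mul_iff]
    exact ⟨fun h => h.2.2, fun h => ⟨hrel, hP.squarefree, h⟩⟩
  have hg : g ≠ 0 := fun h0 => h (h0 ▸ dvd_zero P)
  rw [polyMu, polyMu]
  simp only [hsq]
  split_ifs
  · rw [UniqueFactorizationMonoid.normalizedFactors_mul hP.ne_zero hg,
      UniqueFactorizationMonoid.normalizedFactors_irreducible hP, Multiset.card_add,
      Multiset.card_singleton, pow_add, pow_one, neg_one_mul]
  · rfl

/-- Monic polynomials of degree `d` without factor in `T`. -/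
noncomputable def freeSet (T : Set F[X]) (d : ℕ) : Finset F[X] :=
  open scoped Classical in (monicSet F d).filter fun f => ∀ P ∈ T, ¬ P ∣ f

lemma mem_freeSet {T : Set F[X]} {d : ℕ} {f : F[X]} :
    f ∈ freeSet T d ↔ (f.Monic ∧ f.natDegree = d) ∧ ∀ P ∈ T, ¬ P ∣ f := by
  classical
  rw [freeSet, Finset.mem_filter, mem_monicSet]

/-- The generating series of `φ` over monic polynomials without factor in `T`. -/
noncomputable def freeSeries (T : Set F[X]) (φ : F[X] → ℂ) : PowerSeries ℂ :=
  PowerSeries.mk fun d => ∑ f ∈ freeSet T d, φ f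

lemma coeff_freeSeries (T : Set F[X]) (φ : F[X] → ℂ) (d : ℕ) :
    PowerSeries.coeff d (freeSeries T φ) = ∑ f ∈ freeSet T d, φ f := by
  rw [freeSeries, PowerSeries.coeff_mk]

lemma freeSeries_eq_insert {T : Set F[X]} (hT : ∀ P ∈ T, P.Monic ∧ Irreducible P) {P : F[X]}
    (hPm : P.Monic) (hP : Irreducible P) (hPT : P ∉ T) (φ : F[X] → ℂ) :
    freeSeries T φ = freeSeries (insert P T) φ +
      PowerSeries.X ^ P.natDegree * freeSeries T fun g => φ (P * g) := by
  classical
  ext d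
  rw [map_add, PowerSeries.coeff_X_pow_mul', coeff_freeSeries, coeff_freeSeries, coeff_freeSeries,
    ← Finset.sum_filter_not_add_sum_filter (freeSet T d) (fun f => P ∣ f)]
  congr 1
  · refine Finset.sum_congr ?_ fun _ _ => rfl
    ext f
    simp only [Finset.mem_filter, mem_freeSet, Set.mem_insert_iff, forall_eq_or_imp]
    tauto
  · have hdiv : ∀ g, (∀ Q ∈ T, ¬ Q ∣ P * g) ↔ ∀ Q ∈ T, ¬ Q ∣ g := by
      intro g
      refine forall₂_congr fun Q hQ => not_congr ⟨fun h => ?_, fun h => h.mul_left P⟩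
      refine ((hT Q hQ).2.prime.dvd_or_dvd h).resolve_left fun h' => hPT ?_
      have := eq_of_monic_of_associated (hT Q hQ).1 hPm ((hT Q hQ).2.associated_of_dvd hP h')
      exact this ▸ hQ
    split_ifs with hd
    · rw [← Finset.sum_image (s := freeSet T (d - P.natDegree)) (g := fun g => P * g)
        (f := φ) fun x _ y _ h => mul_left_cancel₀ hP.ne_zero h]
      refine Finset.sum_congr ?_ fun _ _ => rfl
      ext f
      simp only [Finset.mem_filter, mem_freeSet, Finset.mem_image]
      constructor
      · rintro ⟨⟨⟨hf, hfd⟩, hfT⟩, g, rfl⟩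
        have hg : g.Monic := hPm.of_mul_monic_left hf
        rw [hPm.natDegree_mul hg] at hfd
        exact ⟨g, ⟨⟨hg, by omega⟩, (hdiv g).1 hfT⟩, rfl⟩
      · rintro ⟨g, ⟨⟨hg, hgd⟩, hgT⟩, rfl⟩
        refine ⟨⟨⟨hPm.mul hg, ?_⟩, (hdiv g).2 hgT⟩, dvd_mul_right _ _⟩
        rw [hPm.natDegree_mul hg]; omega
    · refine Finset.sum_eq_zero fun f hf => (hd ?_).elim
      rw [Finset.mem_filter, mem_freeSet] at hf
      rw [← hf.1.1.2]
      exact natDegree_le_of_dvd hf.2 hf.1.1.1.ne_zero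

lemma freeSeries_congr {T : Set F[X]} {φ ψ : F[X] → ℂ}
    (h : ∀ f : F[X], f.Monic → φ f = ψ f) : freeSeries T φ = freeSeries T ψ := by
  ext d
  rw [coeff_freeSeries, coeff_freeSeries]
  exact Finset.sum_congr rfl fun f hf => h f (mem_freeSet.1 hf).1.1

lemma freeSeries_const_mul {T : Set F[X]} (c : ℂ) (φ : F[X] → ℂ) :
    freeSeries T (fun f => c * φ f) = PowerSeries.C c * freeSeries T φ := by
  ext d
  rw [PowerSeries.coeff_C_mul, coeff_freeSeries, coeff_freeSeries, Finset.mul_sum]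

/-- The Euler factor at `P` of the reciprocal of the `L`-series. -/
noncomputable def eulerFactor (lam : F[X] → ℂ) (P : F[X]) : PowerSeries ℂ :=
  1 - PowerSeries.C (lam P) * PowerSeries.X ^ P.natDegree

variable {lam : F[X] → ℂ} (hmul : ∀ f g : F[X], f.Monic → g.Monic → lam (f * g) = lam f * lam g)

include hmul

lemma freeSeries_mul_eulerFactor {T : Set F[X]} (hT : ∀ P ∈ T, P.Monic ∧ Irreducible P) {P : F[X]}
    (hPm : P.Monic) (hP : Irreducible P) (hPT : P ∉ T) :
    freeSeries T lam * eulerFactor lam P = freeSeries (insert P T) lam := by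
  have h := freeSeries_eq_insert hT hPm hP hPT lam
  rw [freeSeries_congr (ψ := fun g => lam P * lam g) fun g hg => hmul P g hPm hg,
    freeSeries_const_mul] at h
  rw [eulerFactor]
  linear_combination h

lemma freeSeries_moebius {T : Set F[X]} (hT : ∀ P ∈ T, P.Monic ∧ Irreducible P) {P : F[X]}
    (hPm : P.Monic) (hP : Irreducible P) (hPT : P ∉ T) :
    freeSeries T (fun f => (polyMu f : ℂ) * lam f) =
      eulerFactor lam P * freeSeries (insert P T) (fun f => (polyMu f : ℂ) * lam f) := by
  classical
  have h := freeSeries_eq_insert hT hPm hP hPT fun f => (polyMu f : ℂ) * lam f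
  have h2 : freeSeries T (fun g => (polyMu (P * g) : ℂ) * lam (P * g)) =
      PowerSeries.C (- lam P) * freeSeries (insert P T) (fun f => (polyMu f : ℂ) * lam f) := by
    rw [← freeSeries_const_mul]
    ext d
    rw [coeff_freeSeries, coeff_freeSeries]
    have hsub : freeSet (insert P T) d ⊆ freeSet T d := by
      intro f hf
      rw [mem_freeSet] at hf ⊢
      exact ⟨hf.1, fun Q hQ => hf.2 Q (Set.mem_insert_of_mem _ hQ)⟩
    rw [← Finset.sum_subset hsub]
    · refine Finset.sum_congr rfl fun f hf => ?_
      rw [mem_freeSet] at hf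
      rw [polyMu_mul_of_not_dvd hP (hf.2 P (Set.mem_insert _ _)), hmul P f hPm hf.1.1]
      push_cast
      ring
    · intro f hf hf'
      rw [mem_freeSet] at hf hf'
      have hPf : P ∣ f := by
        by_contra hcon
        refine hf' ⟨hf.1, fun Q hQ => ?_⟩
        rcases Set.mem_insert_iff.1 hQ with rfl | hQ
        · exact hcon
        · exact hf.2 Q hQ
      rw [polyMu_mul_of_dvd hP hPf]
      simp
  rw [h2, map_neg] at h
  rw [eulerFactor]
  linear_combination h

lemma freeSeries_mul_prod_eulerFactor (T : Finset F[X]) (hT : ∀ P ∈ T, P.Monic ∧ Irreducible P) :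
    freeSeries ∅ lam * ∏ P ∈ T, eulerFactor lam P = freeSeries T lam := by
  classical
  induction T using Finset.induction_on with
  | empty => simp
  | insert P T hPT ih =>
    have hT' : ∀ Q ∈ T, Q.Monic ∧ Irreducible Q := fun Q hQ => hT Q (Finset.mem_insert_of_mem hQ)
    have hP := hT P (Finset.mem_insert_self _ _)
    rw [Finset.prod_insert hPT, mul_left_comm, ih hT', Finset.coe_insert, mul_comm,
      freeSeries_mul_eulerFactor hmul hT' hP.1 hP.2 (by simpa using hPT)]

lemma freeSeries_moebius_eq_prod (T : Finset F[X]) (hT : ∀ P ∈ T, P.Monic ∧ Irreducible P) :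
    freeSeries ∅ (fun f => (polyMu f : ℂ) * lam f) =
      (∏ P ∈ T, eulerFactor lam P) * freeSeries T (fun f => (polyMu f : ℂ) * lam f) := by
  classical
  induction T using Finset.induction_on with
  | empty => simp
  | insert P T hPT ih =>
    have hT' : ∀ Q ∈ T, Q.Monic ∧ Irreducible Q := fun Q hQ => hT Q (Finset.mem_insert_of_mem hQ)
    have hP := hT P (Finset.mem_insert_self _ _)
    rw [Finset.prod_insert hPT, ih hT', Finset.coe_insert,
      freeSeries_moebius hmul hT' hP.1 hP.2 (by simpa using hPT)]
    ring

end MonicSums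

section EulerProduct

variable {F : Type*} [Field F] [Fintype F]

lemma PowerSeries.coeff_mul_congr {A A' B B' : PowerSeries ℂ} {n : ℕ}
    (hA : ∀ i ≤ n, PowerSeries.coeff i A = PowerSeries.coeff i A')
    (hB : ∀ i ≤ n, PowerSeries.coeff i B = PowerSeries.coeff i B') :
    PowerSeries.coeff n (A * B) = PowerSeries.coeff n (A' * B') := by
  rw [PowerSeries.coeff_mul, PowerSeries.coeff_mul]
  refine Finset.sum_congr rfl fun p hp => ?_
  have := Finset.HasAntidiagonal.mem_antidiagonal.1 hp
  rw [hA _ (by omega), hB _ (by omega)]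

open scoped Classical in
/-- The monic irreducible polynomials of degree at most `N`. -/
noncomputable def primesLE (F : Type*) [Field F] [Fintype F] (N : ℕ) : Finset F[X] :=
  ((Finset.range (N + 1)).biUnion (monicSet F)).filter Irreducible

lemma mem_primesLE {N : ℕ} {P : F[X]} :
    P ∈ primesLE F N ↔ (P.Monic ∧ Irreducible P) ∧ P.natDegree ≤ N := by
  classical
  rw [primesLE, Finset.mem_filter, Finset.mem_biUnion]
  simp only [Finset.mem_range, mem_monicSet]
  constructor
  · rintro ⟨⟨d, hd, hP, rfl⟩, hirr⟩
    exact ⟨⟨hP, hirr⟩, by omega⟩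
  · rintro ⟨⟨hP, hirr⟩, hd⟩
    exact ⟨⟨_, by omega, hP, rfl⟩, hirr⟩

lemma freeSet_empty (d : ℕ) : freeSet (∅ : Set F[X]) d = monicSet F d := by
  ext f
  rw [mem_freeSet, mem_monicSet]
  simp

lemma coeff_freeSeries_primesLE {N n : ℕ} (hn : n ≤ N) (φ : F[X] → ℂ) :
    PowerSeries.coeff n (freeSeries (primesLE F N : Set F[X]) φ) = if n = 0 then φ 1 else 0 := by
  rw [coeff_freeSeries]
  split_ifs with h0
  · have : freeSet (primesLE F N : Set F[X]) n = {1} := by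
      ext f
      rw [mem_freeSet, Finset.mem_singleton, h0]
      constructor
      · rintro ⟨⟨hf, hd⟩, -⟩
        exact hf.natDegree_eq_zero.1 hd
      · rintro rfl
        refine ⟨⟨monic_one, natDegree_one⟩, fun P hP h => ?_⟩
        exact (mem_primesLE.1 (Finset.mem_coe.1 hP)).1.2.not_isUnit (isUnit_of_dvd_one h)
    rw [this, Finset.sum_singleton]
  · have : freeSet (primesLE F N : Set F[X]) n = ∅ := by
      refine Finset.eq_empty_of_forall_notMem fun f hf => ?_
      rw [mem_freeSet] at hf
      obtain ⟨⟨hfm, hfd⟩, hfree⟩ := hf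
      have hnu : ¬ IsUnit f := fun hu => h0 (by rw [← hfd]; exact natDegree_eq_zero_of_isUnit hu)
      obtain ⟨P, hPm, hPirr, hPf⟩ := exists_monic_irreducible_factor f hnu
      refine hfree P (Finset.mem_coe.2 (mem_primesLE.2 ⟨⟨hPm, hPirr⟩, ?_⟩)) hPf
      exact (natDegree_le_of_dvd hPf hfm.ne_zero).trans (by omega)
    rw [this, Finset.sum_empty]

/-- The logarithmic derivative of an Euler factor, up to sign. -/
noncomputable def localSeries (lam : F[X] → ℂ) (P : F[X]) : PowerSeries ℂ :=
  PowerSeries.mk fun n => if P.natDegree ∣ n ∧ n ≠ 0 then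
    (P.natDegree : ℂ) * lam P ^ (n / P.natDegree) else 0

omit [Fintype F] in
lemma eulerFactor_mul_localSeries (lam : F[X] → ℂ) {P : F[X]} (hd : 0 < P.natDegree) :
    eulerFactor lam P * localSeries lam P =
      PowerSeries.C ((P.natDegree : ℂ) * lam P) * PowerSeries.X ^ P.natDegree := by
  ext n
  set d := P.natDegree with hd'
  rw [eulerFactor, sub_mul, one_mul, mul_assoc, map_sub, PowerSeries.coeff_C_mul,
    PowerSeries.coeff_X_pow_mul', PowerSeries.coeff_C_mul, PowerSeries.coeff_X_pow, localSeries,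
    PowerSeries.coeff_mk, PowerSeries.coeff_mk, ← hd']
  by_cases hdn : d ∣ n
  · obtain ⟨j, rfl⟩ := hdn
    rcases j with _ | _ | j
    · simp [hd.ne]
    · simp [hd.ne', Nat.div_self hd]
    · have h1 : d ≤ d * (j + 1 + 1) := by nlinarith
      have h2 : d * (j + 1 + 1) - d = d * (j + 1) := by
        rw [Nat.sub_eq_iff_eq_add h1]; ring
      have h3 : d * (j + 1 + 1) ≠ d := by nlinarith
      rw [if_pos h1, h2, if_neg h3, if_pos ⟨dvd_mul_right _ _, by positivity⟩,
        if_pos ⟨dvd_mul_right _ _, by positivity⟩, Nat.mul_div_cancel_left _ hd,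
        Nat.mul_div_cancel_left _ hd]
      ring
  · have h3 : n ≠ d := fun h => hdn (h ▸ dvd_rfl)
    rw [if_neg (by tauto), if_neg h3]
    split_ifs with h1 h2
    · exact (hdn ((Nat.dvd_sub_iff_left h1 dvd_rfl).1 h2.1)).elim
    · simp
    · simp

omit [Fintype F] in
lemma X_mul_derivative_eulerFactor (lam : F[X] → ℂ) {P : F[X]} (hd : 0 < P.natDegree) :
    PowerSeries.X * PowerSeries.derivative ℂ (eulerFactor lam P) =
      - (eulerFactor lam P * localSeries lam P) := by
  rw [eulerFactor_mul_localSeries lam hd, eulerFactor, map_sub, Derivation.map_one_eq_zero, zero_sub,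
    Derivation.leibniz, Derivation.leibniz_pow]
  simp only [PowerSeries.derivative_C, smul_zero, add_zero]
  obtain ⟨e, he⟩ : ∃ e, P.natDegree = e + 1 := ⟨P.natDegree - 1, by omega⟩
  rw [he]
  simp [PowerSeries.derivative_X]
  ring

omit [Fintype F] in
lemma X_mul_derivative_prod_eulerFactor (lam : F[X] → ℂ) (T : Finset F[X])
    (hT : ∀ P ∈ T, 0 < P.natDegree) :
    PowerSeries.X * PowerSeries.derivative ℂ (∏ P ∈ T, eulerFactor lam P) =
      - ((∏ P ∈ T, eulerFactor lam P) * ∑ P ∈ T, localSeries lam P) := by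
  classical
  induction T using Finset.induction_on with
  | empty => simp
  | insert P T hPT ih =>
    have ih' := ih fun Q hQ => hT Q (Finset.mem_insert_of_mem hQ)
    have h1 := X_mul_derivative_eulerFactor lam (hT P (Finset.mem_insert_self _ _))
    rw [Finset.prod_insert hPT, Finset.sum_insert hPT, Derivation.leibniz, smul_eq_mul, smul_eq_mul]
    linear_combination eulerFactor lam P * ih' + (∏ P ∈ T, eulerFactor lam P) * h1

/-- The sum of `lam` over prime powers, weighted by degrees of primes. -/
noncomputable def primePowSum (lam : F[X] → ℂ) (n : ℕ) : ℂ :=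
  ∑ P ∈ primesLE F n, if P.natDegree ∣ n then (P.natDegree : ℂ) * lam P ^ (n / P.natDegree) else 0

lemma coeff_sum_localSeries (lam : F[X] → ℂ) {N n : ℕ} (hn : n ≤ N) :
    PowerSeries.coeff n (∑ P ∈ primesLE F N, localSeries lam P) = primePowSum lam n := by
  rw [map_sum, primePowSum]
  simp only [localSeries, PowerSeries.coeff_mk]
  have hsub : primesLE F n ⊆ primesLE F N := fun P hP => by
    rw [mem_primesLE] at hP ⊢; exact ⟨hP.1, hP.2.trans hn⟩
  rw [← Finset.sum_subset hsub]
  · refine Finset.sum_congr rfl fun P hP => ?_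
    rw [mem_primesLE] at hP
    have := hP.1.2.natDegree_pos
    simp [show n ≠ 0 by omega]
  · intro P _ hP'
    rw [if_neg]
    rintro ⟨h1, h2⟩
    refine hP' (mem_primesLE.2 ⟨(mem_primesLE.1 ‹_›).1, Nat.le_of_dvd (by omega) h1⟩)

variable {lam : F[X] → ℂ} (hmul : ∀ f g : F[X], f.Monic → g.Monic → lam (f * g) = lam f * lam g)
  (hone : lam 1 = 1)

include hmul hone

theorem freeSeries_mul_moebius :
    freeSeries ∅ lam * freeSeries ∅ (fun f => (polyMu f : ℂ) * lam f) = 1 := by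
  ext n
  have hT : ∀ P ∈ primesLE F n, P.Monic ∧ Irreducible P := fun P hP => (mem_primesLE.1 hP).1
  rw [freeSeries_moebius_eq_prod hmul _ hT, ← mul_assoc, freeSeries_mul_prod_eulerFactor hmul _ hT,
    ← mul_one (1 : PowerSeries ℂ)]
  refine PowerSeries.coeff_mul_congr (fun i hi => ?_) fun i hi => ?_
  · rw [coeff_freeSeries_primesLE hi, hone, PowerSeries.coeff_one]
  · rw [coeff_freeSeries_primesLE hi, hone, PowerSeries.coeff_one, polyMu_one]
    simp

omit hone in
theorem X_mul_derivative_moebius :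
    PowerSeries.X * PowerSeries.derivative ℂ (freeSeries ∅ fun f => (polyMu f : ℂ) * lam f) =
      - (PowerSeries.mk (primePowSum lam) * freeSeries ∅ fun f => (polyMu f : ℂ) * lam f) := by
  ext n
  have hT : ∀ P ∈ primesLE F n, P.Monic ∧ Irreducible P := fun P hP => (mem_primesLE.1 hP).1
  set M := freeSeries ∅ fun f : F[X] => (polyMu f : ℂ) * lam f with hM
  set E := ∏ P ∈ primesLE F n, eulerFactor lam P with hE
  set S := freeSeries (primesLE F n : Set F[X]) fun f => (polyMu f : ℂ) * lam f with hS
  have hMES : M = E * S := freeSeries_moebius_eq_prod hmul _ hT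
  have hD := X_mul_derivative_prod_eulerFactor lam (primesLE F n) fun P hP =>
    (hT P hP).2.natDegree_pos
  have h1 : PowerSeries.X * PowerSeries.derivative ℂ M =
      E * (PowerSeries.X * PowerSeries.derivative ℂ S) -
        (∑ P ∈ primesLE F n, localSeries lam P) * M := by
    rw [hMES, Derivation.leibniz, smul_eq_mul, smul_eq_mul]
    linear_combination S * hD
  rw [h1, map_sub, map_neg, PowerSeries.coeff_mul_congr (A' := E) (B' := 0) (fun _ _ => rfl),
    mul_zero, map_zero, zero_sub]
  · congr 1
    refine PowerSeries.coeff_mul_congr (fun i hi => ?_) fun _ _ => rfl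
    rw [coeff_sum_localSeries lam hi, PowerSeries.coeff_mk]
  · intro i hi
    rcases i with _ | i
    · simp
    · rw [PowerSeries.coeff_succ_X_mul, PowerSeries.coeff_derivative, hS,
        coeff_freeSeries_primesLE hi]
      simp

theorem X_mul_derivative_freeSeries :
    PowerSeries.X * PowerSeries.derivative ℂ (freeSeries ∅ lam) =
      PowerSeries.mk (primePowSum lam) * freeSeries ∅ lam := by
  have h1 := freeSeries_mul_moebius hmul hone
  have h2 := X_mul_derivative_moebius hmul
  have h3 := congrArg (PowerSeries.derivative ℂ) h1
  rw [Derivation.leibniz, Derivation.map_one_eq_zero, smul_eq_mul, smul_eq_mul] at h3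
  set L := freeSeries ∅ lam
  set M := freeSeries ∅ fun f : F[X] => (polyMu f : ℂ) * lam f
  linear_combination (-PowerSeries.X * PowerSeries.derivative ℂ L) * h1 + L * PowerSeries.X * h3
    - L * L * h2 + L * PowerSeries.mk (primePowSum lam) * h1

end EulerProduct

section OrbitSum

variable {F : Type*} [Field F] [Fintype F] {Ω : Type*} [Field Ω] [Algebra F Ω]

lemma aeval_pow_card_pow (p : F[X]) (a : Ω) (i : ℕ) :
    aeval (a ^ Fintype.card F ^ i) p = aeval a p ^ Fintype.card F ^ i := by
  rw [← frobPow_apply F i, ← frobPow_apply F i, aeval_algHom_apply]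

omit [Fintype F] in
lemma eq_pow_of_forall_irreducible_dvd_eq {g P : F[X]} (hg : g.Monic) (hP : P.Monic)
    (h : ∀ p : F[X], p.Monic → Irreducible p → p ∣ g → p = P) : ∃ j, g = P ^ j := by
  classical
  have h1 : UniqueFactorizationMonoid.normalizedFactors g =
      Multiset.replicate (UniqueFactorizationMonoid.normalizedFactors g).card P := by
    refine Multiset.eq_replicate_card.2 fun p hp => ?_
    have hirr := UniqueFactorizationMonoid.irreducible_of_normalized_factor p hp
    refine h p ?_ hirr (UniqueFactorizationMonoid.dvd_of_mem_normalizedFactors hp)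
    rw [← UniqueFactorizationMonoid.normalize_normalized_factor p hp]
    exact monic_normalize hirr.ne_zero
  have h2 := UniqueFactorizationMonoid.prod_normalizedFactors hg.ne_zero
  rw [h1, Multiset.prod_replicate] at h2
  exact ⟨_, (eq_of_monic_of_associated (hP.pow _) hg h2).symm⟩

variable [IsAlgClosed Ω] [Algebra.IsAlgebraic F Ω]

lemma exists_orbitPoly_eq_minpoly_pow {n : ℕ} {a : Ω}
    (h : a ^ Fintype.card F ^ n = a) : ∃ j, orbitPoly F n a = minpoly F a ^ j := by
  have hintegral : IsIntegral F a := Algebra.IsIntegral.isIntegral a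
  refine eq_pow_of_forall_irreducible_dvd_eq (monic_orbitPoly F n a) (minpoly.monic hintegral)
    fun p hpm hp hdvd => ?_
  obtain ⟨b, hb⟩ := IsAlgClosed.exists_aeval_eq_zero Ω p hp.degree_pos.ne'
  have h1 : aeval b (orbitPoly F n a) = 0 := by
    obtain ⟨r, hr⟩ := hdvd
    rw [hr, map_mul, hb, zero_mul]
  rw [aeval_def, ← eval_map, map_orbitPoly h, eval_prod, Finset.prod_eq_zero_iff] at h1
  obtain ⟨i, -, hi⟩ := h1
  have hba : b = a ^ Fintype.card F ^ i := by
    rwa [eval_sub, eval_X, eval_C, sub_eq_zero] at hi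
  rw [hba, aeval_pow_card_pow] at hb
  have ha : aeval a p = 0 := eq_zero_of_pow_eq_zero hb
  exact minpoly.eq_of_irreducible_of_monic hp ha hpm

lemma natDegree_minpoly_dvd_and_orbitPoly_eq {n : ℕ} {a : Ω}
    (h : a ^ Fintype.card F ^ n = a) : (minpoly F a).natDegree ∣ n ∧
      orbitPoly F n a = minpoly F a ^ (n / (minpoly F a).natDegree) := by
  obtain ⟨j, hj⟩ := exists_orbitPoly_eq_minpoly_pow h
  have hintegral : IsIntegral F a := Algebra.IsIntegral.isIntegral a
  have hd := congrArg natDegree hj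
  rw [natDegree_orbitPoly h, natDegree_pow] at hd
  refine ⟨⟨j, by rw [hd, mul_comm]⟩, ?_⟩
  rw [hj]
  congr 1
  exact (Nat.div_eq_of_eq_mul_left (minpoly.natDegree_pos hintegral) hd).symm

open scoped Classical in
lemma card_filter_minpoly_eq {n : ℕ} (hn : n ≠ 0) {P : F[X]} (hPm : P.Monic) (hP : Irreducible P)
    (hd : P.natDegree ∣ n) :
    ((frobFixed F Ω n).filter fun a => minpoly F a = P).card = P.natDegree := by
  have hsep : P.Separable := PerfectField.separable_of_irreducible hP
  have heq : ((frobFixed F Ω n).filter fun a => minpoly F a = P) = (P.aroots Ω).toFinset := by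
    ext a
    rw [Finset.mem_filter, Multiset.mem_toFinset, mem_aroots, mem_frobFixed hn]
    constructor
    · rintro ⟨-, rfl⟩
      exact ⟨hPm.ne_zero, minpoly.aeval F a⟩
    · rintro ⟨-, ha⟩
      refine ⟨?_, (minpoly.eq_of_irreducible_of_monic hP ha hPm).symm⟩
      obtain ⟨r, hr⟩ := hP.natDegree_dvd_iff_dvd_X_pow_card_pow_sub_X.1 hd
      have := congrArg (aeval a) hr
      rwa [map_mul, ha, zero_mul, map_sub, map_pow, aeval_X, sub_eq_zero, Nat.card_eq_fintype_card]
        at this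
  rw [heq, aroots, Multiset.toFinset_card_of_nodup (nodup_roots hsep.map),
    ← (IsAlgClosed.splits _).natDegree_eq_card_roots, natDegree_map]

variable {lam : F[X] → ℂ}

omit [Fintype F] in
lemma apply_pow_of_monic (hmul : ∀ f g : F[X], f.Monic → g.Monic → lam (f * g) = lam f * lam g)
    (hone : lam 1 = 1) {P : F[X]} (hP : P.Monic) (j : ℕ) : lam (P ^ j) = lam P ^ j := by
  induction j with
  | zero => simp [hone]
  | succ j ih => rw [pow_succ, hmul _ _ (hP.pow j) hP, ih, pow_succ]

theorem sum_orbitPoly_eq_primePowSum (Ω : Type*) [Field Ω] [Algebra F Ω] [IsAlgClosed Ω]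
    [Algebra.IsAlgebraic F Ω]
    (hmul : ∀ f g : F[X], f.Monic → g.Monic → lam (f * g) = lam f * lam g)
    (hone : lam 1 = 1) {n : ℕ} (hn : n ≠ 0) :
    ∑ a ∈ frobFixed F Ω n, lam (orbitPoly F n a) = primePowSum lam n := by
  classical
  have hmaps : ∀ a ∈ frobFixed F Ω n, minpoly F a ∈ primesLE F n := by
    intro a ha
    have hintegral : IsIntegral F a := Algebra.IsIntegral.isIntegral a
    have h := natDegree_minpoly_dvd_and_orbitPoly_eq ((mem_frobFixed hn).1 ha)
    exact mem_primesLE.2 ⟨⟨minpoly.monic hintegral, minpoly.irreducible hintegral⟩,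
      Nat.le_of_dvd (Nat.pos_of_ne_zero hn) h.1⟩
  rw [← Finset.sum_fiberwise_of_maps_to hmaps, primePowSum]
  refine Finset.sum_congr rfl fun P hP => ?_
  obtain ⟨⟨hPm, hPi⟩, -⟩ := mem_primesLE.1 hP
  split_ifs with hd
  · rw [Finset.sum_congr rfl (g := fun _ => lam P ^ (n / P.natDegree)), Finset.sum_const,
      card_filter_minpoly_eq hn hPm hPi hd, nsmul_eq_mul]
    intro a ha
    obtain ⟨ha', rfl⟩ := Finset.mem_filter.1 ha
    have h := natDegree_minpoly_dvd_and_orbitPoly_eq ((mem_frobFixed hn).1 ha')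
    rw [h.2, apply_pow_of_monic hmul hone hPm]
  · refine Finset.sum_eq_zero fun a ha => (hd ?_).elim
    obtain ⟨ha', rfl⟩ := Finset.mem_filter.1 ha
    exact (natDegree_minpoly_dvd_and_orbitPoly_eq ((mem_frobFixed hn).1 ha')).1

end OrbitSum

section Congruence

lemma dvd_prod_sub_prod {A ι : Type*} [CommRing A] (s : Finset ι) {f g : ι → A} {D : A}
    (h : ∀ i ∈ s, D ∣ f i - g i) : D ∣ ∏ i ∈ s, f i - ∏ i ∈ s, g i := by
  rw [← Ideal.mem_span_singleton, ← Ideal.Quotient.eq, map_prod, map_prod]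
  refine Finset.prod_congr rfl fun i hi => ?_
  rw [Ideal.Quotient.eq, Ideal.mem_span_singleton]
  exact h i hi

lemma reverse_prod_of_domain {A ι : Type*} [CommRing A] [IsDomain A] (s : Finset ι)
    (f : ι → A[X]) : (∏ i ∈ s, f i).reverse = ∏ i ∈ s, (f i).reverse := by
  classical
  induction s using Finset.induction_on with
  | empty => rw [Finset.prod_empty, Finset.prod_empty, ← C_1, reverse_C]
  | insert a s ha ih => rw [Finset.prod_insert ha, reverse_mul_of_domain, ih, Finset.prod_insert ha]

lemma X_pow_dvd_reverse_sub_iff {k : Type*} [Field k] {f g : k[X]} {l n : ℕ}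
    (hf : f.natDegree = n) (hg : g.natDegree = n) :
    X ^ (l + 1) ∣ f.reverse - g.reverse ↔ (f - g).degree < (n - l : ℕ) := by
  have hlt : ∀ j, n < j → (f - g).coeff j = 0 := fun j hj => by
    rw [coeff_sub, coeff_eq_zero_of_natDegree_lt (by omega),
      coeff_eq_zero_of_natDegree_lt (by omega), sub_zero]
  have hrev : ∀ i, (f.reverse - g.reverse).coeff i = (f - g).coeff (revAt n i) := fun i => by
    rw [coeff_sub, coeff_reverse, coeff_reverse, hf, hg, coeff_sub]
  rw [X_pow_dvd_iff, degree_lt_iff_coeff_zero]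
  constructor
  · intro h j hj
    rcases lt_or_ge n j with hnj | hnj
    · exact hlt j hnj
    · have := h (n - j) (by omega)
      rwa [hrev, revAt_le (Nat.sub_le _ _), Nat.sub_sub_self hnj] at this
  · intro h i hi
    rw [hrev]
    rcases lt_or_ge n i with hni | hni
    · rw [revAt_eq_self_of_lt hni]
      exact hlt i hni
    · rw [revAt_le hni]
      exact h _ (by omega)

lemma monic_taylor {k : Type*} [Field k] {f : k[X]} (hf : f.Monic) (c : k) :
    (taylor c f).Monic := by
  rw [Monic, leadingCoeff, natDegree_taylor, coeff_taylor_natDegree, hf]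

lemma X_pow_dvd_reverse_taylor_sub {k : Type*} [Field k] {f g : k[X]} {l : ℕ}
    (hfg : f.natDegree = g.natDegree) (h : X ^ (l + 1) ∣ f.reverse - g.reverse) (c : k) :
    X ^ (l + 1) ∣ (taylor c f).reverse - (taylor c g).reverse := by
  rw [X_pow_dvd_reverse_sub_iff hfg rfl] at h
  rwa [X_pow_dvd_reverse_sub_iff ((natDegree_taylor f c).trans hfg) (natDegree_taylor g c),
    ← map_sub, degree_taylor]

lemma firstCoeff_eq_coeff_reverse {F : Type*} [Field F] (f : F[X]) (i : ℕ) :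
    firstCoeff f i = f.reverse.coeff i := by
  rw [firstCoeff, coeff_reverse]
  split_ifs with h
  · rw [revAt_le h]
  · rw [revAt_eq_self_of_lt (by omega), coeff_eq_zero_of_natDegree_lt (by omega)]

end Congruence

section PolyNorm

variable (F : Type*) [Field F] [Fintype F] {k : Type*} [Field k] [Fintype k] [Algebra F k]

lemma exists_map_eq_prod_frobPow (g : k[X]) : ∃ p : F[X], p.map (algebraMap F k) =
    ∏ i ∈ Finset.range (Module.finrank F k), g.map ((frobPow F k i : k →ₐ[F] k) : k →+* k) := by
  refine exists_map_eq_of_map_frobenius_eq ?_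
  have h1 : ∀ i, (g.map ((frobPow F k i : k →ₐ[F] k) : k →+* k)).map
      ((frobPow F k 1 : k →ₐ[F] k) : k →+* k) = g.map ((frobPow F k (i + 1) : k →ₐ[F] k) : k →+* k) :=
    fun i => by
      ext j
      simp [frobPow_apply, pow_succ, pow_mul]
  rw [Polynomial.map_prod, Finset.prod_congr rfl fun i _ => h1 i]
  obtain ⟨r, hr⟩ : ∃ r, Module.finrank F k = r + 1 :=
    ⟨Module.finrank F k - 1, (Nat.succ_pred_eq_of_pos Module.finrank_pos).symm⟩
  have h2 : g.map ((frobPow F k (r + 1) : k →ₐ[F] k) : k →+* k) =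
      g.map ((frobPow F k 0 : k →ₐ[F] k) : k →+* k) := by
    ext j
    have := FiniteField.pow_card (g.coeff j)
    rw [Module.card_eq_pow_finrank (K := F), hr] at this
    simp [frobPow_apply, this]
  rw [hr, Finset.prod_range_succ, Finset.prod_range_succ' _ r, h2]

/-- The norm of a polynomial along an extension of finite fields. -/
noncomputable def polyNorm (g : k[X]) : F[X] := (exists_map_eq_prod_frobPow F g).choose

lemma map_polyNorm (g : k[X]) : (polyNorm F g).map (algebraMap F k) =
    ∏ i ∈ Finset.range (Module.finrank F k), g.map ((frobPow F k i : k →ₐ[F] k) : k →+* k) :=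
  (exists_map_eq_prod_frobPow F g).choose_spec

lemma monic_polyNorm {g : k[X]} (hg : g.Monic) : (polyNorm F g).Monic := by
  refine monic_of_injective (algebraMap F k).injective ?_
  rw [map_polyNorm]
  exact monic_prod_of_monic _ _ fun i _ => hg.map _

lemma polyNorm_mul (f g : k[X]) : polyNorm F (f * g) = polyNorm F f * polyNorm F g := by
  refine map_injective _ (algebraMap F k).injective ?_
  rw [Polynomial.map_mul, map_polyNorm, map_polyNorm, map_polyNorm, ← Finset.prod_mul_distrib]
  simp only [Polynomial.map_mul]

omit [Fintype k] in
lemma map_map_frobPow (Q : F[X]) (i : ℕ) :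
    (Q.map (algebraMap F k)).map ((frobPow F k i : k →ₐ[F] k) : k →+* k) =
      Q.map (algebraMap F k) := by
  rw [Polynomial.map_map]
  congr 1
  ext x
  simp

lemma dvd_polyNorm_sub {Q : F[X]} {f g : k[X]} (h : Q.map (algebraMap F k) ∣ f - g) :
    Q ∣ polyNorm F f - polyNorm F g := by
  rw [← map_dvd_map' (algebraMap F k), Polynomial.map_sub, map_polyNorm, map_polyNorm]
  refine dvd_prod_sub_prod _ fun i _ => ?_
  rw [← Polynomial.map_sub, ← map_map_frobPow F Q i]
  exact map_dvd (mapRingHom _) h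

lemma X_pow_dvd_reverse_polyNorm_sub {l : ℕ} {f g : k[X]}
    (h : X ^ (l + 1) ∣ f.reverse - g.reverse) :
    X ^ (l + 1) ∣ (polyNorm F f).reverse - (polyNorm F g).reverse := by
  rw [← map_dvd_map' (algebraMap F k), Polynomial.map_sub,
    ← reverse_map_of_injective (algebraMap F k).injective,
    ← reverse_map_of_injective (algebraMap F k).injective, map_polyNorm, map_polyNorm,
    reverse_prod_of_domain, reverse_prod_of_domain]
  refine dvd_prod_sub_prod _ fun i _ => ?_
  rw [reverse_map_of_injective (RingHom.injective _), reverse_map_of_injective (RingHom.injective _),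
    ← Polynomial.map_sub, ← map_map_frobPow F _ i, Polynomial.map_pow, map_X]
  have := map_dvd (mapRingHom ((frobPow F k i : k →ₐ[F] k) : k →+* k)) h
  simpa using this

lemma isCoprime_polyNorm_X_sub_C {Q : F[X]} {a : k} (ha : aeval a Q ≠ 0) :
    IsCoprime (polyNorm F (X - C a)) Q := by
  rw [← isCoprime_map (algebraMap F k), map_polyNorm]
  refine IsCoprime.prod_left fun i _ => ?_
  rw [Polynomial.map_sub, map_X, map_C]
  rw [(irreducible_X_sub_C _).coprime_iff_not_dvd, dvd_iff_isRoot, IsRoot, eval_map, ← aeval_def]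
  have : aeval ((frobPow F k i) a) Q ≠ 0 := by
    rw [frobPow_apply, aeval_pow_card_pow]
    exact pow_ne_zero _ ha
  exact this

variable {Ω : Type*} [Field Ω] [Algebra F Ω] [Algebra k Ω] [IsScalarTower F k Ω]

lemma Finset.prod_range_mul_eq {M : Type*} [CommMonoid M] (f : ℕ → M) (r n : ℕ) :
    ∏ i ∈ Finset.range (r * n), f i =
      ∏ i ∈ Finset.range r, ∏ j ∈ Finset.range n, f (r * j + i) := by
  rw [Finset.prod_comm]
  induction n with
  | zero => simp
  | succ n ih => rw [mul_add, mul_one, Finset.prod_range_add, ih, Finset.prod_range_succ]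

lemma polyNorm_orbitPoly {n : ℕ} {a : Ω} (h : a ^ Fintype.card k ^ n = a) :
    polyNorm F (orbitPoly k n a) = orbitPoly F (Module.finrank F k * n) a := by
  have hcard : Fintype.card k = Fintype.card F ^ Module.finrank F k := Module.card_eq_pow_finrank
  have h' : a ^ Fintype.card F ^ (Module.finrank F k * n) = a := by rwa [pow_mul, ← hcard]
  refine map_injective _ (algebraMap F Ω).injective ?_
  rw [map_orbitPoly h', Finset.prod_range_mul_eq, IsScalarTower.algebraMap_eq F k Ω,
    ← Polynomial.map_map, map_polyNorm, Polynomial.map_prod]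
  refine Finset.prod_congr rfl fun i _ => ?_
  have hcomp : (algebraMap k Ω).comp ((frobPow F k i : k →ₐ[F] k) : k →+* k) =
      ((frobPow F Ω i : Ω →ₐ[F] Ω) : Ω →+* Ω).comp (algebraMap k Ω) := by
    ext x
    simp [frobPow_apply]
  rw [Polynomial.map_map, hcomp, ← Polynomial.map_map, map_orbitPoly h, Polynomial.map_prod]
  refine Finset.prod_congr rfl fun j _ => ?_
  rw [Polynomial.map_sub, map_X, map_C, hcard]
  simp [frobPow_apply, pow_add, pow_mul]

end PolyNorm

lemma taylor_orbitPoly {k Ω : Type*} [Field k] [Fintype k] [Field Ω] [Algebra k Ω] {n : ℕ} {a : Ω}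
    (h : a ^ Fintype.card k ^ n = a) (c : k) :
    taylor (-c) (orbitPoly k n a) = orbitPoly k n (a + algebraMap k Ω c) := by
  have hfrob : ∀ i, (a + algebraMap k Ω c) ^ Fintype.card k ^ i =
      a ^ Fintype.card k ^ i + algebraMap k Ω c := fun i => by
    rw [← frobPow_apply k i, map_add, AlgHom.commutes, frobPow_apply]
  refine map_injective _ (algebraMap k Ω).injective ?_
  rw [map_taylor, map_orbitPoly h, map_orbitPoly (by rw [hfrob, h])]
  change taylorAlgHom _ _ = _
  rw [map_prod]
  refine Finset.prod_congr rfl fun i _ => ?_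
  rw [hfrob]
  simp [taylorAlgHom]
  ring

section Descent

lemma X_pow_mul_dvd_sub_of_aeval_reverse_eq {k : Type*} [Field k] {D : k[X]} {u : AdjoinRoot D}
    (hu : u * AdjoinRoot.root D = 1) {f g : k[X]} (h : aeval u f.reverse = aeval u g.reverse) :
    D ∣ X ^ g.natDegree * f - X ^ f.natDegree * g := by
  let _ : Invertible (AdjoinRoot.root D) := ⟨u, hu, by rw [mul_comm, hu]⟩
  have hinv : ⅟(AdjoinRoot.root D) = u := rfl
  have key : ∀ p : k[X], aeval u p.reverse * AdjoinRoot.root D ^ p.natDegree = AdjoinRoot.mk D p := by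
    intro p
    have := eval₂_reverse_mul_pow (algebraMap k (AdjoinRoot D)) (AdjoinRoot.root D) p
    rw [hinv] at this
    rw [← AdjoinRoot.aeval_eq, aeval_def, aeval_def, this]
  rw [← AdjoinRoot.mk_eq_mk, map_mul, map_mul, map_pow, map_pow, AdjoinRoot.mk_X, ← key f, ← key g,
    h]
  ring

lemma finite_adjoinRoot {k : Type*} [Field k] [Finite k] {p : k[X]} (hp : p ≠ 0) :
    Finite (AdjoinRoot p) := by
  have : Module.Finite k (AdjoinRoot p) := (AdjoinRoot.powerBasis hp).finite
  exact Module.finite_of_finite k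

lemma taylor_dvd_taylor {k : Type*} [CommRing k] {f g : k[X]} (h : f ∣ g) (c : k) :
    taylor c f ∣ taylor c g := by
  obtain ⟨e, rfl⟩ := h
  exact ⟨taylor c e, taylor_mul _ _ _⟩

lemma aeval_prodMk_eq {k A B : Type*} [CommRing k] [CommRing A] [CommRing B] [Algebra k A]
    [Algebra k B] (a : A) (b : B) (p : k[X]) : aeval (a, b) p = (aeval a p, aeval b p) := by
  refine Prod.ext ?_ ?_
  · exact (aeval_algHom_apply (AlgHom.fst k A B) (a, b) p).symm
  · exact (aeval_algHom_apply (AlgHom.snd k A B) (a, b) p).symm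

lemma exists_finite_aeval_reverse.{v} {k : Type v} [Field k] [Finite k] {D : k[X]} (hD : eval 0 D ≠ 0)
    (N : ℕ) : ∃ (A : Type v) (_ : CommRing A) (_ : Algebra k A) (_ : Finite A) (τ : A),
      ∀ f g : k[X], aeval τ f.reverse = aeval τ g.reverse →
        D ∣ X ^ g.natDegree * f - X ^ f.natDegree * g ∧ X ^ N ∣ f.reverse - g.reverse := by
  have hDne : D ≠ 0 := fun h => hD (by rw [h, eval_zero])
  have hcop : IsCoprime (X : k[X]) D := by
    rw [irreducible_X.coprime_iff_not_dvd, X_dvd_iff, coeff_zero_eq_eval_zero]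
    exact hD
  obtain ⟨s, t, hst⟩ := hcop
  have hu1 : AdjoinRoot.mk D s * AdjoinRoot.root D = 1 := by
    have := congrArg (AdjoinRoot.mk D) hst
    rwa [map_add, map_mul, map_mul, AdjoinRoot.mk_self, mul_zero, add_zero, AdjoinRoot.mk_X,
      map_one] at this
  have : Finite (AdjoinRoot D) := finite_adjoinRoot hDne
  have : Finite (AdjoinRoot ((X : k[X]) ^ N)) := finite_adjoinRoot (pow_ne_zero _ X_ne_zero)
  refine ⟨AdjoinRoot D × AdjoinRoot ((X : k[X]) ^ N), inferInstance, inferInstance, inferInstance,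
    (AdjoinRoot.mk D s, AdjoinRoot.root _), fun f g h => ?_⟩
  rw [aeval_prodMk_eq, aeval_prodMk_eq, Prod.mk.injEq, AdjoinRoot.aeval_eq (f := X ^ N),
    AdjoinRoot.aeval_eq (f := X ^ N), AdjoinRoot.mk_eq_mk] at h
  exact ⟨X_pow_mul_dvd_sub_of_aeval_reverse_eq hu1 h.1, h.2⟩

variable {F : Type*} [Field F] [Fintype F] {Q : F[X]} {l : ℕ} {lam : F[X] → ℂ}
  (hmul : ∀ f g : F[X], f.Monic → g.Monic → lam (f * g) = lam f * lam g)
  (hone : lam 1 = 1) (hbd : ∀ f : F[X], f.Monic → ‖lam f‖ ≤ 1)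
  (hunit : ∀ f : F[X], f.Monic → IsCoprime f Q → ‖lam f‖ = 1)
  (hper : ∀ f g : F[X], f.Monic → g.Monic → Q ∣ f - g →
    X ^ (l + 1) ∣ f.reverse - g.reverse → lam f = lam g)

include hmul hone hbd hunit hper

lemma exists_norm_primePowSum_sub_le_of_tower {k Ω : Type*} [Field k] [Fintype k] [Algebra F k]
    [Field Ω] [Algebra F Ω] [Algebra k Ω] [IsScalarTower F k Ω] [IsAlgClosed Ω]
    [Algebra.IsAlgebraic F Ω] {c : k} (hc : aeval c Q ≠ 0) :
    ∃ (r : ℕ) (w : ℂ), r ≠ 0 ∧ ‖w‖ = (Fintype.card F : ℝ) ^ (2 * r) ∧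
      ∃ δ : ℂ, (δ = 0 ∨ δ = 1) ∧ ∃ (C : ℝ) (n₀ : ℕ), ∀ n, n₀ ≤ n →
        ‖primePowSum lam (2 * r * n) - δ * w ^ n‖ ≤ C * ((Fintype.card F : ℝ) ^ r) ^ n := by
  classical
  have : Algebra.IsAlgebraic k Ω := Algebra.IsAlgebraic.tower_top (K := F) k
  set r := Module.finrank F k with hr
  have hr0 : r ≠ 0 := Module.finrank_pos.ne'
  have hcard : Fintype.card k = Fintype.card F ^ r := Module.card_eq_pow_finrank
  set D : k[X] := taylor c (Q.map (algebraMap F k)) with hD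
  have hD0 : eval 0 D ≠ 0 := by
    rw [hD, taylor_eval, zero_add, eval_map, ← aeval_def]; exact hc
  obtain ⟨A, _, _, _, τ, hτ⟩ := exists_finite_aeval_reverse hD0 (l + 1)
  set ν : k[X] → ℂ := fun g => lam (polyNorm F (taylor (-c) g)) with hν
  have hνmul : ∀ f g : k[X], f.Monic → g.Monic → ν (f * g) = ν f * ν g := fun f g hf hg => by
    rw [hν]
    simp only [taylor_mul, polyNorm_mul]
    exact hmul _ _ (monic_polyNorm F (monic_taylor hf _)) (monic_polyNorm F (monic_taylor hg _))
  set ζ := ν X with hζ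
  have hζ1 : ‖ζ‖ = 1 := by
    rw [hζ, hν]
    simp only [taylor_X]
    rw [map_neg, ← sub_eq_add_neg]
    exact hunit _ (monic_polyNorm F (monic_X_sub_C c)) (isCoprime_polyNorm_X_sub_C F hc)
  have hone' : polyNorm F (1 : k[X]) = 1 := by
    refine map_injective _ (algebraMap F k).injective ?_
    rw [map_polyNorm]; simp
  have hνpow : ∀ (j : ℕ) (f : k[X]), f.Monic → ν (X ^ j * f) = ζ ^ j * ν f := by
    intro j f hf
    induction j with
    | zero => simp
    | succ j ih => rw [pow_succ', mul_assoc, hνmul _ _ monic_X ((monic_X_pow j).mul hf), ih]; ring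
  have hνper : ∀ f g : k[X], f.Monic → g.Monic → aeval τ f.reverse = aeval τ g.reverse →
      ζ ^ g.natDegree * ν f = ζ ^ f.natDegree * ν g := by
    intro f g hf hg h
    rw [← hνpow _ f hf, ← hνpow _ g hg]
    obtain ⟨h1, h2⟩ := hτ f g h
    have hf1 : (X ^ g.natDegree * f).Monic := (monic_X_pow _).mul hf
    have hg1 : (X ^ f.natDegree * g).Monic := (monic_X_pow _).mul hg
    refine hper _ _ (monic_polyNorm F (monic_taylor hf1 _))
      (monic_polyNorm F (monic_taylor hg1 _)) ?_ ?_
    · refine dvd_polyNorm_sub F ?_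
      have h3 : taylor (-c) D ∣ taylor (-c) (X ^ g.natDegree * f - X ^ f.natDegree * g) :=
        taylor_dvd_taylor h1 (-c)
      rwa [hD, taylor_taylor, neg_add_cancel, taylor_zero, map_sub] at h3
    · refine X_pow_dvd_reverse_polyNorm_sub F (X_pow_dvd_reverse_taylor_sub ?_ ?_ _)
      · rw [(monic_X_pow _).natDegree_mul hf, (monic_X_pow _).natDegree_mul hg, natDegree_X_pow,
          natDegree_X_pow, add_comm]
      · rwa [reverse_X_pow_mul, reverse_X_pow_mul]
  obtain ⟨δ, hδ, C, n₀, hC⟩ := exists_norm_sum_orbit_sub_le k Ω τ ν hνmul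
    (fun f hf => hbd _ (monic_polyNorm F (monic_taylor hf _))) ζ hζ1 hνper
  refine ⟨r, ζ ^ 2 * (Fintype.card F : ℂ) ^ (2 * r), hr0, ?_, δ, hδ, C, n₀ + 1, fun n hn => ?_⟩
  · rw [norm_mul, norm_pow, hζ1, one_pow, one_mul, norm_pow, Complex.norm_natCast]
  · have hn0 : 2 * n ≠ 0 := by omega
    have hn1 : 2 * r * n ≠ 0 := by
      refine mul_ne_zero (mul_ne_zero two_ne_zero hr0) (by omega)
    have h := hC n (by omega)
    have hpow : ∀ j, Fintype.card k ^ j = Fintype.card F ^ (r * j) := fun j => by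
      rw [hcard, pow_mul]
    have hmem : ∀ a : Ω, a ∈ frobFixed k Ω (2 * n) ↔ a ∈ frobFixed F Ω (2 * r * n) := fun a => by
      rw [mem_frobFixed hn0, mem_frobFixed hn1, hpow, mul_left_comm, mul_assoc]
    have hsum : ∑ a ∈ frobFixed k Ω (2 * n), ν (orbitPoly k (2 * n) a) =
        primePowSum lam (2 * r * n) := by
      rw [← sum_orbitPoly_eq_primePowSum Ω hmul hone hn1]
      have hfixc : ∀ j, algebraMap k Ω c ^ Fintype.card k ^ j = algebraMap k Ω c := fun j => by
        rw [← frobPow_apply k j, AlgHom.commutes]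
      have hfixadd : ∀ (a b : Ω) (j : ℕ), (a + b) ^ Fintype.card k ^ j =
          a ^ Fintype.card k ^ j + b ^ Fintype.card k ^ j := fun a b j => by
        rw [← frobPow_apply k j, map_add, frobPow_apply, frobPow_apply]
      refine Finset.sum_bij' (fun a _ => a + algebraMap k Ω c) (fun a _ => a - algebraMap k Ω c)
        (fun a ha => ?_) (fun a ha => ?_) (fun a _ => ?_) (fun a _ => ?_) (fun a ha => ?_)
      · rw [← hmem, mem_frobFixed hn0, hfixadd, hfixc, (mem_frobFixed hn0).1 ha]
      · rw [← hmem] at ha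
        rw [mem_frobFixed hn0, ← frobPow_apply k, map_sub, AlgHom.commutes, frobPow_apply,
          (mem_frobFixed hn0).1 ha]
      · ring
      · ring
      · have hfix := (mem_frobFixed hn0).1 ha
        rw [hν]
        simp only
        rw [taylor_orbitPoly hfix, polyNorm_orbitPoly F (by rw [hfixadd, hfixc, hfix]), ← hr,
          mul_left_comm, mul_assoc]
    rw [hsum] at h
    convert h using 2
    · congr 1
      rw [hcard]
      push_cast
      ring
    · rw [hcard]; push_cast; ring

theorem exists_norm_primePowSum_sub_le (hQ : Q ≠ 0) :
    ∃ (r : ℕ) (w : ℂ), r ≠ 0 ∧ ‖w‖ = (Fintype.card F : ℝ) ^ (2 * r) ∧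
      ∃ δ : ℂ, (δ = 0 ∨ δ = 1) ∧ ∃ (C : ℝ) (n₀ : ℕ), ∀ n, n₀ ≤ n →
        ‖primePowSum lam (2 * r * n) - δ * w ^ n‖ ≤ C * ((Fintype.card F : ℝ) ^ r) ^ n := by
  classical
  obtain ⟨a, ha⟩ := Infinite.exists_notMem_finset (Q.aroots (AlgebraicClosure F)).toFinset
  have ha' : aeval a Q ≠ 0 := fun h => ha (by rw [Multiset.mem_toFinset, mem_aroots]; exact ⟨hQ, h⟩)
  have hintegral : IsIntegral F a := Algebra.IsIntegral.isIntegral a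
  have : FiniteDimensional F (IntermediateField.adjoin F {a}) :=
    IntermediateField.adjoin.finiteDimensional hintegral
  have : Finite (IntermediateField.adjoin F {a}) := Module.finite_of_finite F
  cases nonempty_fintype (IntermediateField.adjoin F {a})
  refine exists_norm_primePowSum_sub_le_of_tower hmul hone hbd hunit hper
    (k := IntermediateField.adjoin F {a}) (Ω := AlgebraicClosure F)
    (c := IntermediateField.AdjoinSimple.gen F a) fun h => ha' ?_
  have := congrArg (algebraMap (IntermediateField.adjoin F {a}) (AlgebraicClosure F)) h
  rwa [← aeval_algebraMap_apply, map_zero, IntermediateField.AdjoinSimple.algebraMap_gen] at this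

end Descent

section PowerSums

lemma le_of_pow_le_mul_pow {b W D : ℝ} (hW : 0 < W) {n₀ : ℕ}
    (h : ∀ n, n₀ ≤ n → b ^ n ≤ D * W ^ n) : b ≤ W := by
  by_contra! hlt
  have h1 : 1 < b / W := (one_lt_div hW).2 hlt
  obtain ⟨n, hn⟩ := pow_unbounded_of_one_lt (max D 0) h1
  have h2 : (b / W) ^ n ≤ (b / W) ^ (n + n₀) := pow_le_pow_right₀ h1.le (Nat.le_add_right _ _)
  have h3 := h (n + n₀) (Nat.le_add_left _ _)
  rw [div_pow b W (n + n₀)] at h2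
  have h4 : b ^ (n + n₀) / W ^ (n + n₀) ≤ D := (div_le_iff₀ (pow_pos hW _)).2 h3
  have h5 := le_max_left D 0
  linarith

lemma norm_le_of_norm_sum_pow_le {β : Multiset ℂ} {W K : ℝ} (hW : 0 < W) {n₀ : ℕ}
    (h : ∀ n, n₀ ≤ n → ‖(β.map fun b => b ^ n).sum‖ ≤ K * W ^ n) {b : ℂ} (hb : b ∈ β) :
    ‖b‖ ≤ W := by
  classical
  set g : ℂ[X] := ∏ z ∈ β.toFinset.erase b, (X - C z) with hg
  have hgb : g.eval b ≠ 0 := by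
    rw [hg, eval_prod, Finset.prod_ne_zero_iff]
    intro z hz
    rw [eval_sub, eval_X, eval_C, sub_ne_zero]
    exact (Finset.ne_of_mem_erase hz).symm
  have hgz : ∀ z ∈ β, z ≠ b → g.eval z = 0 := fun z hz hzb => by
    rw [hg, eval_prod]
    refine Finset.prod_eq_zero (Finset.mem_erase.2 ⟨hzb, Multiset.mem_toFinset.2 hz⟩) ?_
    simp
  have hleft : ∀ n, (β.map fun z => z ^ n * g.eval z).sum =
      (β.count b : ℂ) * (b ^ n * g.eval b) := fun n => by
    rw [Finset.sum_multiset_map_count, Finset.sum_eq_single b]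
    · rw [nsmul_eq_mul]
    · intro z hz hzb
      rw [hgz z (Multiset.mem_toFinset.1 hz) hzb, mul_zero, smul_zero]
    · intro hb'
      exact absurd (Multiset.mem_toFinset.2 hb) hb'
  have hright : ∀ n, (β.map fun z => z ^ n * g.eval z).sum =
      ∑ j ∈ Finset.range (g.natDegree + 1), g.coeff j * (β.map fun z => z ^ (n + j)).sum := fun n => by
    simp_rw [eval_eq_sum_range, Finset.mul_sum, ← Multiset.sum_map_mul_left]
    rw [Multiset.sum_map_sum]
    refine Finset.sum_congr rfl fun j _ => ?_
    congr 1
    refine Multiset.map_congr rfl fun z _ => ?_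
    ring
  have hcount : (1 : ℝ) ≤ β.count b := by
    exact_mod_cast Multiset.one_le_count_iff_mem.2 hb
  have hgpos : 0 < ‖g.eval b‖ := norm_pos_iff.2 hgb
  set S := ∑ j ∈ Finset.range (g.natDegree + 1), ‖g.coeff j‖ * (K * W ^ j) with hS
  refine le_of_pow_le_mul_pow hW (D := S / ‖g.eval b‖) (n₀ := n₀) fun n hn => ?_
  have h1 : ‖(β.count b : ℂ) * (b ^ n * g.eval b)‖ ≤ S * W ^ n := by
    rw [← hleft, hright, hS, Finset.sum_mul]
    refine (norm_sum_le _ _).trans (Finset.sum_le_sum fun j _ => ?_)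
    rw [norm_mul, mul_assoc]
    refine mul_le_mul_of_nonneg_left ((h _ (hn.trans (Nat.le_add_right _ _))).trans_eq ?_)
      (norm_nonneg _)
    rw [pow_add]; ring
  rw [norm_mul, norm_mul, norm_pow, Complex.norm_natCast] at h1
  rw [div_mul_eq_mul_div, le_div_iff₀ hgpos]
  exact (le_mul_of_one_le_left (by positivity) hcount).trans h1

lemma eq_prod_one_sub_C_mul_X {K : Type*} [Field K] [IsAlgClosed K] {P : K[X]}
    (hP : P.coeff 0 = 1) : ∃ s : Multiset K, s.card ≤ P.natDegree ∧
      P = (s.map fun a => 1 - C a * X).prod := by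
  have hrev : ∀ s : Multiset K, (s.map fun a => X - C a).prod.reverse =
      (s.map fun a => 1 - C a * X).prod := by
    intro s
    induction s using Multiset.induction_on with
    | empty => simpa using reverse_C (1 : K)
    | cons a s ih =>
      rw [Multiset.map_cons, Multiset.prod_cons, reverse_mul_of_domain, ih, Multiset.map_cons,
        Multiset.prod_cons]
      congr 1
      rw [reverse, natDegree_X_sub_C, reflect_sub, reflect_C, pow_one, ← pow_one (X : K[X]),
        reflect_monomial]
      simp
  have h0 : P.natTrailingDegree = 0 := by
    rw [natTrailingDegree_eq_zero]; right; rw [hP]; exact one_ne_zero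
  have hmon : P.reverse.Monic := by
    rw [Monic, reverse_leadingCoeff, trailingCoeff, h0, hP]
  have hsplit := IsAlgClosed.splits P.reverse
  refine ⟨P.reverse.roots, (card_roots' _).trans (reverse_natDegree_le _), ?_⟩
  rw [← hrev]
  have h1 : (P.reverse.roots.map fun a => X - C a).prod = P.reverse := by
    have := hsplit.eq_prod_roots
    rw [hmon.leadingCoeff, C_1, one_mul] at this
    exact this.symm
  rw [h1]
  have hdeg : P.reverse.natDegree = P.natDegree := by
    rw [reverse_natDegree, h0, Nat.sub_zero]
  ext n
  rw [coeff_reverse, coeff_reverse, hdeg, revAt_invol]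

lemma one_sub_mul_mk_pow (a : ℂ) :
    (1 - PowerSeries.C a * PowerSeries.X) * PowerSeries.mk (fun n => if n = 0 then 0 else a ^ n) =
      PowerSeries.C a * PowerSeries.X := by
  ext n
  rw [sub_mul, one_mul, mul_assoc, map_sub, PowerSeries.coeff_mk, PowerSeries.coeff_C_mul,
    PowerSeries.coeff_C_mul]
  rcases n with _ | n
  · simp
  · rw [PowerSeries.coeff_succ_X_mul, PowerSeries.coeff_mk, PowerSeries.coeff_X]
    rcases n with _ | n
    · simp
    · simp [pow_succ']

lemma X_mul_derivative_prod_one_sub (s : Multiset ℂ) :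
    PowerSeries.X * PowerSeries.derivative ℂ
      ((s.map fun a => 1 - PowerSeries.C a * PowerSeries.X).prod) =
    - PowerSeries.mk (fun n => if n = 0 then 0 else (s.map fun a => a ^ n).sum) *
      (s.map fun a => 1 - PowerSeries.C a * PowerSeries.X).prod := by
  induction s using Multiset.induction_on with
  | empty =>
    have : (PowerSeries.mk fun n : ℕ => if n = 0 then (0 : ℂ) else
        ((0 : Multiset ℂ).map fun a => a ^ n).sum) = 0 := by
      ext n; simp
    rw [this]
    simp
  | cons a s ih =>
    have h1 : (PowerSeries.mk fun n : ℕ => if n = 0 then (0 : ℂ) else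
        ((a ::ₘ s).map fun a => a ^ n).sum) =
        PowerSeries.mk (fun n => if n = 0 then 0 else a ^ n) +
        PowerSeries.mk (fun n => if n = 0 then 0 else (s.map fun a => a ^ n).sum) := by
      ext n
      rw [map_add]
      simp only [PowerSeries.coeff_mk, Multiset.map_cons, Multiset.sum_cons]
      split_ifs <;> simp
    have h2 : PowerSeries.derivative ℂ (1 - PowerSeries.C a * PowerSeries.X) =
        - PowerSeries.C a := by
      rw [map_sub, Derivation.map_one_eq_zero, zero_sub, Derivation.leibniz]
      simp [PowerSeries.derivative_X]
    rw [h1, Multiset.map_cons, Multiset.prod_cons, Derivation.leibniz, h2, smul_eq_mul, smul_eq_mul]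
    linear_combination (1 - PowerSeries.C a * PowerSeries.X) * ih +
      (s.map fun a => 1 - PowerSeries.C a * PowerSeries.X).prod * one_sub_mul_mk_pow a

end PowerSums

section LFunction

variable {F : Type*} [Field F]

/-- A polynomial congruent to `h * f` modulo `Q`, with the degree and leading coefficients of `f`
when `h` is monic of degree `e` and `f` has large degree. -/
noncomputable def shiftMul (Q h f : F[X]) : F[X] :=
  h * f /ₘ X ^ h.natDegree + (h * f - h * f /ₘ X ^ h.natDegree) % Q

lemma dvd_shiftMul_sub (Q h f : F[X]) : Q ∣ shiftMul Q h f - h * f := by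
  rw [shiftMul, EuclideanDomain.mod_eq_sub_mul_div]
  exact ⟨-((h * f - h * f /ₘ X ^ h.natDegree) / Q), by ring⟩

lemma monic_natDegree_mul_divByMonic {h f : F[X]} (hh : h.Monic) (hf : f.Monic) :
    (h * f /ₘ X ^ h.natDegree).Monic ∧ (h * f /ₘ X ^ h.natDegree).natDegree = f.natDegree := by
  have hX := monic_X_pow (R := F) h.natDegree
  have hdeg : (h * f %ₘ X ^ h.natDegree).degree < h.natDegree := by
    simpa using degree_modByMonic_lt (h * f) hX
  have h2 : X ^ h.natDegree * (h * f /ₘ X ^ h.natDegree) =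
      h * f - h * f %ₘ X ^ h.natDegree := by
    rw [modByMonic_eq_sub_mul_div]; ring
  have hlt : (h * f %ₘ X ^ h.natDegree).degree < (h * f).degree := by
    refine hdeg.trans_le ?_
    rw [degree_eq_natDegree (hh.mul hf).ne_zero, hh.natDegree_mul hf]
    exact_mod_cast Nat.le_add_right _ _
  have h3 : (X ^ h.natDegree * (h * f /ₘ X ^ h.natDegree)).Monic := by
    rw [h2]; exact (hh.mul hf).sub_of_left hlt
  refine ⟨hX.of_mul_monic_left h3, ?_⟩
  rw [natDegree_divByMonic _ hX, hh.natDegree_mul hf, natDegree_X_pow, Nat.add_sub_cancel_left]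

lemma degree_shiftMul_sub_lt {Q : F[X]} (hQ : Q ≠ 0) (h f : F[X]) :
    (shiftMul Q h f - h * f /ₘ X ^ h.natDegree).degree < Q.degree := by
  rw [shiftMul, add_sub_cancel_left]
  exact degree_mod_lt _ hQ

lemma monic_natDegree_shiftMul {Q h f : F[X]} (hQ : Q ≠ 0) (hh : h.Monic) (hf : f.Monic)
    (hdeg : Q.natDegree ≤ f.natDegree) :
    (shiftMul Q h f).Monic ∧ (shiftMul Q h f).natDegree = f.natDegree := by
  obtain ⟨h1, h2⟩ := monic_natDegree_mul_divByMonic hh hf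
  have hlt : ((h * f - h * f /ₘ X ^ h.natDegree) % Q).degree <
      (h * f /ₘ X ^ h.natDegree).degree := by
    refine (degree_mod_lt _ hQ).trans_le ?_
    rw [degree_eq_natDegree hQ, degree_eq_natDegree h1.ne_zero, h2]
    exact_mod_cast hdeg
  refine ⟨h1.add_of_left hlt, ?_⟩
  rw [shiftMul, natDegree_add_eq_left_of_degree_lt hlt, h2]

lemma X_pow_dvd_reverse_shiftMul_sub {Q h f : F[X]} {l : ℕ} (hQ : Q ≠ 0) (hh : h.Monic)
    (hf : f.Monic) (hdeg : Q.natDegree + l ≤ f.natDegree) :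
    X ^ (l + 1) ∣ (shiftMul Q h f).reverse - (h * f).reverse := by
  obtain ⟨h1, h2⟩ := monic_natDegree_mul_divByMonic hh hf
  obtain ⟨h3, h4⟩ := monic_natDegree_shiftMul hQ hh hf (by omega)
  have hX := monic_X_pow (R := F) h.natDegree
  set T := h * f /ₘ X ^ h.natDegree with hT
  have h5 : X ^ (l + 1) ∣ (shiftMul Q h f).reverse - T.reverse := by
    rw [X_pow_dvd_reverse_sub_iff h4 h2]
    refine (degree_shiftMul_sub_lt hQ h f).trans_le ?_
    rw [degree_eq_natDegree hQ]
    exact_mod_cast (by omega)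
  have h6 : X ^ (l + 1) ∣ (X ^ h.natDegree * T).reverse - (h * f).reverse := by
    rw [X_pow_dvd_reverse_sub_iff (n := h.natDegree + f.natDegree)
      (by rw [hX.natDegree_mul h1, natDegree_X_pow, h2]) (hh.natDegree_mul hf)]
    have h7 : X ^ h.natDegree * T - h * f = -(h * f %ₘ X ^ h.natDegree) := by
      rw [modByMonic_eq_sub_mul_div]; ring
    rw [h7, degree_neg]
    refine (degree_modByMonic_lt (h * f) hX).trans_le ?_
    rw [degree_X_pow]
    exact_mod_cast (by omega)
  rw [reverse_X_pow_mul] at h6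
  have := dvd_add h5 h6
  rwa [sub_add_sub_cancel] at this

lemma shiftMul_injective {Q h : F[X]} (hQ : Q ≠ 0) (hh : h.Monic) (hcop : IsCoprime h Q) :
    Function.Injective (shiftMul Q h) := by
  intro f g hfg
  have hX := monic_X_pow (R := F) h.natDegree
  have h1 : Q ∣ f - g := by
    have := dvd_sub (dvd_shiftMul_sub Q h g) (dvd_shiftMul_sub Q h f)
    rw [hfg, sub_sub_sub_cancel_left, ← mul_sub] at this
    exact hcop.symm.dvd_of_dvd_mul_left this
  rw [← sub_eq_zero]
  refine eq_zero_of_dvd_of_degree_lt h1 ?_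
  by_contra! hle
  set T := fun f => h * f /ₘ X ^ h.natDegree with hT
  have h2 : (X ^ h.natDegree * (T f - T g)).degree < (h.natDegree : WithBot ℕ) + Q.degree := by
    rw [degree_mul, degree_X_pow]
    refine WithBot.add_lt_add_left WithBot.coe_ne_bot ?_
    have : T f - T g = (shiftMul Q h g - T g) - (shiftMul Q h f - T f) := by rw [hfg]; ring
    rw [this]
    exact (degree_sub_le _ _).trans_lt
      (max_lt (degree_shiftMul_sub_lt hQ h g) (degree_shiftMul_sub_lt hQ h f))
  have hr : ∀ f, (h * f %ₘ X ^ h.natDegree).degree < (h.natDegree : WithBot ℕ) + Q.degree := by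
    intro f
    have := degree_modByMonic_lt (h * f) hX
    rw [degree_X_pow] at this
    rw [degree_eq_natDegree hQ]
    exact this.trans_le (by exact_mod_cast Nat.le_add_right _ _)
  have h3 : h * (f - g) = X ^ h.natDegree * (T f - T g) +
      (h * f %ₘ X ^ h.natDegree - h * g %ₘ X ^ h.natDegree) := by
    rw [modByMonic_eq_sub_mul_div, modByMonic_eq_sub_mul_div]; ring
  have h4 : (h * (f - g)).degree < (h.natDegree : WithBot ℕ) + Q.degree := by
    rw [h3]
    exact (degree_add_le _ _).trans_lt
      (max_lt h2 ((degree_sub_le _ _).trans_lt (max_lt (hr f) (hr g))))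
  rw [degree_mul, degree_eq_natDegree hh.ne_zero] at h4
  exact absurd (add_le_add_right hle (h.natDegree : WithBot ℕ)) h4.not_ge

lemma monicSet_zero [Fintype F] : monicSet F 0 = {1} := by
  ext f
  rw [mem_monicSet, Finset.mem_singleton]
  constructor
  · rintro ⟨h1, h2⟩
    exact h1.natDegree_eq_zero.1 h2
  · rintro rfl
    exact ⟨monic_one, natDegree_one⟩

variable [Fintype F] {Q : F[X]} {l : ℕ} {lam : F[X] → ℂ}
  (hmul : ∀ f g : F[X], f.Monic → g.Monic → lam (f * g) = lam f * lam g)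
  (hper : ∀ f g : F[X], f.Monic → g.Monic → Q ∣ f - g →
    X ^ (l + 1) ∣ f.reverse - g.reverse → lam f = lam g)

include hmul hper

lemma sum_monicSet_eq_zero (hQ : Q ≠ 0) {h : F[X]} (hh : h.Monic) (hcop : IsCoprime h Q)
    (hne : lam h ≠ 1) {d : ℕ} (hd : Q.natDegree + l ≤ d) : ∑ f ∈ monicSet F d, lam f = 0 := by
  classical
  have hmaps : ∀ f ∈ monicSet F d, shiftMul Q h f ∈ monicSet F d := fun f hf => by
    obtain ⟨hfm, rfl⟩ := mem_monicSet.1 hf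
    exact mem_monicSet.2 (monic_natDegree_shiftMul hQ hh hfm (by omega))
  have hinj : Set.InjOn (shiftMul Q h) (monicSet F d) := (shiftMul_injective hQ hh hcop).injOn
  have himg : (monicSet F d).image (shiftMul Q h) = monicSet F d :=
    Finset.eq_of_subset_of_card_le (Finset.image_subset_iff.2 hmaps)
      (Finset.card_image_of_injOn hinj).ge
  have key : ∑ f ∈ monicSet F d, lam f = lam h * ∑ f ∈ monicSet F d, lam f := by
    conv_lhs => rw [← himg]
    rw [Finset.sum_image hinj, Finset.mul_sum]
    refine Finset.sum_congr rfl fun f hf => ?_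
    have hf' := (mem_monicSet.1 (hmaps f hf)).1
    obtain ⟨hfm, rfl⟩ := mem_monicSet.1 hf
    rw [← hmul h f hh hfm]
    exact hper _ _ hf' (hh.mul hfm) (dvd_shiftMul_sub Q h f)
      (X_pow_dvd_reverse_shiftMul_sub hQ hh hfm hd)
  have : (1 - lam h) * ∑ f ∈ monicSet F d, lam f = 0 := by rw [sub_mul, one_mul, ← key, sub_self]
  exact (mul_eq_zero.1 this).resolve_left (sub_ne_zero.2 hne.symm)

lemma exists_primePowSum_eq_neg_sum_pow (hone : lam 1 = 1) (hQ : Q ≠ 0) {h : F[X]}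
    (hh : h.Monic) (hcop : IsCoprime h Q) (hne : lam h ≠ 1) :
    ∃ s : Multiset ℂ, s.card ≤ Q.natDegree + l ∧
      ∀ n, n ≠ 0 → primePowSum lam n = -(s.map fun a => a ^ n).sum := by
  set N := Q.natDegree + l with hN
  set A : ℕ → ℂ := fun d => ∑ f ∈ monicSet F d, lam f with hA
  set P : ℂ[X] := ∑ d ∈ Finset.range N, C (A d) * X ^ d with hP
  have hcoeff : ∀ d, P.coeff d = A d := fun d => by
    rw [hP, finsetSum_coeff]
    simp only [coeff_C_mul_X_pow]
    rw [Finset.sum_ite_eq, ite_eq_left_iff, Finset.mem_range, not_lt]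
    exact fun hd => (sum_monicSet_eq_zero hmul hper hQ hh hcop hne hd).symm
  have hser : (P : PowerSeries ℂ) = freeSeries ∅ lam := by
    ext d
    rw [coeff_coe, hcoeff, coeff_freeSeries, freeSet_empty]
  have hA0 : A 0 = 1 := by
    rw [hA]
    simp only
    rw [monicSet_zero, Finset.sum_singleton, hone]
  obtain ⟨s, hs, hPs⟩ := eq_prod_one_sub_C_mul_X ((hcoeff 0).trans hA0)
  have hPdeg : P.natDegree ≤ N := natDegree_sum_le_of_forall_le _ _ fun d hd =>
    (natDegree_C_mul_X_pow_le _ _).trans (Finset.mem_range.1 hd).le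
  refine ⟨s, hs.trans hPdeg, fun n hn => ?_⟩
  have hprod : freeSeries ∅ lam = (s.map fun a => 1 - PowerSeries.C a * PowerSeries.X).prod := by
    rw [← hser]
    have := congrArg (coeToPowerSeries.ringHom (R := ℂ)) hPs
    rw [map_multiset_prod, Multiset.map_map] at this
    simpa [Function.comp_def] using this
  have h1 := X_mul_derivative_freeSeries hmul hone
  have hne0 : freeSeries ∅ lam ≠ 0 := fun h0 => by
    have := congrArg (PowerSeries.coeff 0) h0
    rw [coeff_freeSeries, freeSet_empty, map_zero] at this
    exact one_ne_zero (hA0.symm.trans this)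
  rw [hprod, X_mul_derivative_prod_one_sub, ← hprod] at h1
  have h2 := congrArg (PowerSeries.coeff n) (mul_right_cancel₀ hne0 h1)
  rw [map_neg, PowerSeries.coeff_mk, PowerSeries.coeff_mk, if_neg hn] at h2
  exact h2.symm

end LFunction

section PrimePowSumBound

variable {F : Type*} [Field F] [Fintype F] {Q : F[X]} {l : ℕ} {lam : F[X] → ℂ}
  (hmul : ∀ f g : F[X], f.Monic → g.Monic → lam (f * g) = lam f * lam g)
  (hone : lam 1 = 1)

include hmul hone

lemma norm_primePowSum_le (hbd : ∀ f : F[X], f.Monic → ‖lam f‖ ≤ 1) {n : ℕ} (hn : n ≠ 0) :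
    ‖primePowSum lam n‖ ≤ (Fintype.card F : ℝ) ^ n := by
  rw [← sum_orbitPoly_eq_primePowSum (AlgebraicClosure F) hmul hone hn]
  refine (norm_sum_le_of_le _ fun a _ => hbd _ (monic_orbitPoly F n a)).trans_eq ?_
  rw [Finset.sum_const, card_frobFixed hn]
  simp

lemma primePowSum_sub_card_pow_of_trivial (hzero : ∀ f : F[X], f.Monic → ¬ IsCoprime f Q → lam f = 0)
    (htriv : ∀ f : F[X], f.Monic → IsCoprime f Q → lam f = 1) (hQ : Q ≠ 0) {n : ℕ} (hn : n ≠ 0) :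
    ‖primePowSum lam n - (Fintype.card F : ℂ) ^ n‖ ≤ (Fintype.card F : ℝ) ^ n ∧
      ‖primePowSum lam n - (Fintype.card F : ℂ) ^ n‖ ≤ Q.natDegree := by
  classical
  set Ω := AlgebraicClosure F
  have hval : ∀ a ∈ frobFixed F Ω n, lam (orbitPoly F n a) - 1 = if aeval a Q = 0 then -1 else 0 := by
    intro a ha
    have hintegral : IsIntegral F a := Algebra.IsIntegral.isIntegral a
    obtain ⟨hdvd, heq⟩ := natDegree_minpoly_dvd_and_orbitPoly_eq ((mem_frobFixed hn).1 ha)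
    have hj : 0 < n / (minpoly F a).natDegree :=
      Nat.div_pos (Nat.le_of_dvd (Nat.pos_of_ne_zero hn) hdvd) (minpoly.natDegree_pos hintegral)
    have hmon := monic_orbitPoly F n a
    have hiff : IsCoprime (orbitPoly F n a) Q ↔ aeval a Q ≠ 0 := by
      rw [heq, IsCoprime.pow_left_iff hj, (minpoly.irreducible hintegral).coprime_iff_not_dvd, Ne,
        minpoly.dvd_iff]
    split_ifs with h
    · rw [hzero _ hmon fun hc => hiff.1 hc h, zero_sub]
    · rw [htriv _ hmon (hiff.2 h), sub_self]
  have hsum : primePowSum lam n - (Fintype.card F : ℂ) ^ n =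
      -(((frobFixed F Ω n).filter fun a => aeval a Q = 0).card : ℂ) := by
    rw [← sum_orbitPoly_eq_primePowSum Ω hmul hone hn]
    have : (Fintype.card F : ℂ) ^ n = ∑ a ∈ frobFixed F Ω n, (1 : ℂ) := by
      rw [Finset.sum_const, card_frobFixed hn]
      simp
    rw [this, ← Finset.sum_sub_distrib, Finset.sum_congr rfl hval, Finset.sum_ite]
    simp
  rw [hsum, norm_neg, Complex.norm_natCast]
  constructor
  · have := Finset.card_filter_le (frobFixed F Ω n) fun a => aeval a Q = 0
    rw [card_frobFixed hn] at this
    exact_mod_cast this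
  · have h1 : ((frobFixed F Ω n).filter fun a => aeval a Q = 0) ⊆ (Q.aroots Ω).toFinset := by
      intro a ha
      rw [Multiset.mem_toFinset, mem_aroots]
      exact ⟨hQ, (Finset.mem_filter.1 ha).2⟩
    have h2 : (Q.aroots Ω).card ≤ Q.natDegree :=
      (card_roots' _).trans_eq (natDegree_map _)
    exact_mod_cast (Finset.card_le_card h1).trans ((Multiset.toFinset_card_le _).trans h2)

variable (hzero : ∀ f : F[X], f.Monic → ¬ IsCoprime f Q → lam f = 0)
  (hunit : ∀ f : F[X], f.Monic → IsCoprime f Q → ‖lam f‖ = 1)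
  (hper : ∀ f g : F[X], f.Monic → g.Monic → Q ∣ f - g →
    X ^ (l + 1) ∣ f.reverse - g.reverse → lam f = lam g)

include hzero hunit hper

lemma norm_primePowSum_le_sqrt_pow (hQ : Q ≠ 0) {h : F[X]} (hh : h.Monic) (hcop : IsCoprime h Q)
    (hne : lam h ≠ 1) {n : ℕ} (hn : n ≠ 0) :
    ‖primePowSum lam n‖ ≤ ((Q.natDegree : ℝ) + l) * √(Fintype.card F : ℝ) ^ n := by
  have hbd : ∀ f : F[X], f.Monic → ‖lam f‖ ≤ 1 := fun f hf => by
    by_cases hc : IsCoprime f Q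
    · exact (hunit f hf hc).le
    · rw [hzero f hf hc, norm_zero]; exact zero_le_one
  have hq1 : (1 : ℝ) < Fintype.card F := by exact_mod_cast Fintype.one_lt_card
  have hq0 : (0 : ℝ) < Fintype.card F := zero_lt_one.trans hq1
  obtain ⟨s, hs, hsum⟩ := exists_primePowSum_eq_neg_sum_pow hmul hper hone hQ hh hcop hne
  obtain ⟨r, w, hr, hw, δ, hδ, K, n₀, hK⟩ :=
    exists_norm_primePowSum_sub_le hmul hone hbd hunit hper hQ
  have hqr : 0 < (Fintype.card F : ℝ) ^ r := pow_pos hq0 _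
  have hsum' : ∀ n, 1 ≤ n → primePowSum lam (2 * r * n) =
      -((s.map fun a => a ^ (2 * r)).map fun b => b ^ n).sum := fun n hn => by
    rw [hsum _ (mul_ne_zero (mul_ne_zero two_ne_zero hr) (by omega)), Multiset.map_map]
    simp only [Function.comp_def, pow_mul]
  have hroot : ∀ a ∈ s, ‖a‖ ≤ √(Fintype.card F : ℝ) := by
    intro a ha
    have ha' : a ^ (2 * r) ∈ s.map fun a => a ^ (2 * r) := Multiset.mem_map_of_mem _ ha
    have h1 : ‖a ^ (2 * r)‖ ≤ (Fintype.card F : ℝ) ^ r := by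
      rcases hδ with rfl | rfl
      · refine norm_le_of_norm_sum_pow_le hqr (K := K) (n₀ := n₀ + 1) (fun n hn => ?_) ha'
        have h2 := hK n (by omega)
        rwa [zero_mul, sub_zero, hsum' n (by omega), norm_neg] at h2
      · exfalso
        have h3 : ‖w‖ ≤ (Fintype.card F : ℝ) ^ r := by
          refine norm_le_of_norm_sum_pow_le (β := w ::ₘ s.map fun a => a ^ (2 * r)) hqr (K := K)
            (n₀ := n₀ + 1) (fun n hn => ?_) (Multiset.mem_cons_self _ _)
          have h2 := hK n (by omega)
          rw [one_mul, hsum' n (by omega), ← norm_neg, neg_sub, sub_neg_eq_add] at h2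
          rwa [Multiset.map_cons, Multiset.sum_cons]
        rw [hw] at h3
        exact (pow_lt_pow_right₀ hq1 (by omega : r < 2 * r)).not_ge h3
    rw [norm_pow, pow_mul] at h1
    exact Real.le_sqrt_of_sq_le ((pow_le_pow_iff_left₀ (by positivity) hq0.le hr).1 h1)
  rw [hsum n hn, norm_neg]
  refine (Multiset.le_sum_of_subadditive norm norm_zero.le norm_add_le _).trans ?_
  rw [Multiset.map_map]
  refine (Multiset.sum_le_card_nsmul _ (√(Fintype.card F : ℝ) ^ n) fun x hx => ?_).trans ?_
  · obtain ⟨a, ha, rfl⟩ := Multiset.mem_map.1 hx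
    simp only [Function.comp, norm_pow]
    exact pow_le_pow_left₀ (norm_nonneg _) (hroot a ha) _
  · rw [Multiset.card_map, nsmul_eq_mul]
    exact mul_le_mul_of_nonneg_right (by exact_mod_cast hs) (by positivity)

/-- Up to the contribution of a possible pole, the prime power sums have square-root size. -/
theorem exists_norm_primePowSum_sub_le_sqrt_pow (hQ : Q ≠ 0) :
    ∃ δ : ℂ, (δ = 0 ∨ δ = 1) ∧ ∀ n ≠ 0,
      ‖primePowSum lam n - δ * (Fintype.card F : ℂ) ^ n‖ ≤ (Fintype.card F : ℝ) ^ n ∧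
      ‖primePowSum lam n - δ * (Fintype.card F : ℂ) ^ n‖ ≤
        ((Q.natDegree : ℝ) + l) * √(Fintype.card F : ℝ) ^ n := by
  by_cases htriv : ∀ f : F[X], f.Monic → IsCoprime f Q → lam f = 1
  · refine ⟨1, Or.inr rfl, fun n hn => ?_⟩
    rw [one_mul]
    obtain ⟨h1, h2⟩ := primePowSum_sub_card_pow_of_trivial hmul hone hzero htriv hQ hn
    refine ⟨h1, h2.trans ?_⟩
    have hq1 : (1 : ℝ) ≤ Fintype.card F := by exact_mod_cast Fintype.one_lt_card.le
    have h3 : (1 : ℝ) ≤ √(Fintype.card F : ℝ) ^ n := one_le_pow₀ (Real.one_le_sqrt.2 hq1)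
    have h4 : (Q.natDegree : ℝ) ≤ (Q.natDegree : ℝ) + l := le_add_of_nonneg_right (Nat.cast_nonneg _)
    exact h4.trans (le_mul_of_one_le_right (by positivity) h3)
  · push Not at htriv
    obtain ⟨h, hh, hcop, hne⟩ := htriv
    refine ⟨0, Or.inl rfl, fun n hn => ?_⟩
    rw [zero_mul, sub_zero]
    refine ⟨norm_primePowSum_le hmul hone (fun f hf => ?_) hn,
      norm_primePowSum_le_sqrt_pow hmul hone hzero hunit hper hQ hh hcop hne hn⟩
    by_cases hc : IsCoprime f Q
    · exact (hunit f hf hc).le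
    · rw [hzero f hf hc, norm_zero]; exact zero_le_one

end PrimePowSumBound

section Recursion

lemma le_exp_of_natCast_mul_le_sum {b γ : ℕ → ℝ} {Γ : ℝ} (hb : b 0 ≤ 1) (hγ : ∀ k, 0 ≤ γ k)
    (hγ0 : γ 0 = 0) (hΓ : ∀ n, ∑ k ∈ Finset.range n, γ k ≤ Γ)
    (hrec : ∀ d : ℕ, (d : ℝ) * b d ≤
      ∑ p ∈ Finset.HasAntidiagonal.antidiagonal d, γ p.1 * b p.2) (d : ℕ) :
    b d ≤ Real.exp Γ := by
  have hΓ0 : 0 ≤ Γ := by simpa using hΓ 0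
  set u : ℕ → ℝ := fun d => ∑ j ∈ Finset.range (d + 1), Γ ^ j / j.factorial with hu
  have hterm : ∀ j : ℕ, 0 ≤ Γ ^ j / j.factorial := fun j => by positivity
  have hmono : Monotone u := fun i j hij => Finset.sum_le_sum_of_subset_of_nonneg
    (Finset.range_subset_range.2 (by omega)) fun k _ _ => hterm k
  have hu0 : ∀ d, 0 ≤ u d := fun d => Finset.sum_nonneg fun j _ => hterm j
  suffices h : b d ≤ u d from h.trans (Real.sum_le_exp_of_nonneg hΓ0 _)
  induction d using Nat.strong_induction_on with
  | _ d ih =>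
    rcases d with _ | d
    · simpa [hu] using hb
    · have h1 : ((d + 1 : ℕ) : ℝ) * b (d + 1) ≤ Γ * u d := by
        refine (hrec (d + 1)).trans ?_
        rw [Finset.Nat.sum_antidiagonal_eq_sum_range_succ_mk]
        refine le_trans (Finset.sum_le_sum (g := fun k => γ k * u d) fun k hk => ?_) ?_
        · rcases k with _ | k
          · simp [hγ0]
          · exact mul_le_mul_of_nonneg_left
              ((ih _ (by omega)).trans (hmono (by omega))) (hγ _)
        · rw [← Finset.sum_mul]
          exact mul_le_mul_of_nonneg_right (hΓ _) (hu0 d)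
      have h2 : Γ * u d ≤ ((d + 1 : ℕ) : ℝ) * u (d + 1) := by
        rw [hu]
        simp only
        rw [Finset.sum_range_succ' _ (d + 1), mul_add, Finset.mul_sum, Finset.mul_sum]
        refine le_add_of_le_of_nonneg (Finset.sum_le_sum fun j hj => ?_)
          (mul_nonneg (Nat.cast_nonneg _) (hterm 0))
        have hj' : ((j + 1 : ℕ) : ℝ) ≤ ((d + 1 : ℕ) : ℝ) := by
          exact_mod_cast Finset.mem_range.1 hj
        have hj0 : ((j + 1 : ℕ) : ℝ) ≠ 0 := by positivity
        calc Γ * (Γ ^ j / j.factorial) =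
            ((j + 1 : ℕ) : ℝ) * (Γ ^ (j + 1) / (j + 1).factorial) := by
              rw [Nat.factorial_succ, Nat.cast_mul, pow_succ']
              field_simp
          _ ≤ _ := mul_le_mul_of_nonneg_right hj' (hterm _)
      have hd0 : (0 : ℝ) < ((d + 1 : ℕ) : ℝ) := by positivity
      exact le_of_mul_le_mul_left (h1.trans h2) hd0

lemma natCast_mul_coeff_of_X_mul_derivative {A E : PowerSeries ℂ}
    (h : PowerSeries.X * PowerSeries.derivative ℂ A = -(E * A)) (d : ℕ) :
    (d : ℂ) * PowerSeries.coeff d A = - ∑ p ∈ Finset.HasAntidiagonal.antidiagonal d,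
      PowerSeries.coeff p.1 E * PowerSeries.coeff p.2 A := by
  rw [← PowerSeries.coeff_mul, ← map_neg, ← h]
  rcases d with _ | d
  · rw [Nat.cast_zero, zero_mul, PowerSeries.coeff_zero_X_mul]
  · rw [PowerSeries.coeff_succ_X_mul, PowerSeries.coeff_derivative]
    push_cast
    ring

/-- A power series whose logarithmic derivative has small coefficients has small coefficients. -/
theorem exists_norm_coeff_le_rpow {q ε : ℝ} (hq : 1 < q) (hε : 0 < ε) :
    ∃ K : ℝ, 0 ≤ K ∧ ∀ (M : ℝ) (A E : PowerSeries ℂ), 0 ≤ M → PowerSeries.coeff 0 A = 1 →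
      PowerSeries.coeff 0 E = 0 →
      (∀ n ≠ 0, ‖PowerSeries.coeff n E‖ ≤ q ^ n ∧ ‖PowerSeries.coeff n E‖ ≤ M * √q ^ n) →
      PowerSeries.X * PowerSeries.derivative ℂ A = -(E * A) →
      ∀ d : ℕ, ‖PowerSeries.coeff d A‖ ≤ K * q ^ ((1 / 2 + ε) * d + ε * M) := by
  have hq0 : 0 < q := zero_lt_one.trans hq
  set θ : ℝ := q ^ (-ε) with hθ
  have hθ0 : 0 < θ := Real.rpow_pos_of_pos hq0 _
  have hθ1 : θ < 1 := Real.rpow_lt_one_of_one_lt_of_neg hq (neg_lt_zero.2 hε)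
  set ρ : ℝ := q ^ (-(1 / 2 + ε)) with hρ
  have hρ0 : 0 < ρ := Real.rpow_pos_of_pos hq0 _
  have hsq : √q * ρ = θ := by
    rw [Real.sqrt_eq_rpow, hρ, hθ, ← Real.rpow_add hq0]
    congr 1
    ring
  have hlog : 0 < ε * Real.log q := mul_pos hε (Real.log_pos hq)
  obtain ⟨N, hN⟩ := exists_pow_lt_of_lt_one (mul_pos hlog (sub_pos.2 hθ1)) hθ1
  set K₁ := ∑ k ∈ Finset.range N, (q * ρ) ^ k with hK₁
  refine ⟨Real.exp K₁, (Real.exp_pos _).le, fun M A E hM hA hE hEb hrec d => ?_⟩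
  set γ : ℕ → ℝ := fun k => ‖PowerSeries.coeff k E‖ * ρ ^ k with hγ
  have hγ0 : ∀ k, 0 ≤ γ k := fun k => by positivity
  have hγ1 : ∀ k, γ k ≤ (q * ρ) ^ k := fun k => by
    rcases eq_or_ne k 0 with rfl | hk
    · simp [hγ, hE]
    · rw [mul_pow]
      exact mul_le_mul_of_nonneg_right (hEb k hk).1 (by positivity)
  have hγ2 : ∀ k, γ k ≤ M * θ ^ k := fun k => by
    rcases eq_or_ne k 0 with rfl | hk
    · simpa [hγ, hE] using hM
    · rw [← hsq, mul_pow, ← mul_assoc]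
      exact mul_le_mul_of_nonneg_right (hEb k hk).2 (by positivity)
  have hsum : ∀ n, ∑ k ∈ Finset.range n, γ k ≤ K₁ + M * (ε * Real.log q) := fun n => by
    refine (Finset.sum_le_sum_of_subset_of_nonneg
      (Finset.range_subset_range.2 (Nat.le_add_left n N)) fun k _ _ => hγ0 k).trans ?_
    rw [Finset.sum_range_add]
    refine add_le_add (Finset.sum_le_sum fun k _ => hγ1 k) ?_
    calc ∑ j ∈ Finset.range n, γ (N + j) ≤ ∑ j ∈ Finset.range n, M * θ ^ N * θ ^ j :=
          Finset.sum_le_sum fun j _ => (hγ2 _).trans_eq (by rw [pow_add, mul_assoc])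
      _ ≤ M * θ ^ N * (1 - θ)⁻¹ := by
          rw [← Finset.mul_sum]
          exact mul_le_mul_of_nonneg_left (sum_le_hasSum _ (fun j _ => by positivity)
            (hasSum_geometric_of_lt_one hθ0.le hθ1)) (by positivity)
      _ ≤ M * (ε * Real.log q) := by
          rw [mul_assoc]
          refine mul_le_mul_of_nonneg_left ?_ hM
          rw [← div_eq_mul_inv, div_le_iff₀ (sub_pos.2 hθ1)]
          exact hN.le
  have key := le_exp_of_natCast_mul_le_sum (b := fun d => ‖PowerSeries.coeff d A‖ * ρ ^ d) (γ := γ)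
    (by simp [hA]) hγ0 (by simp [hγ, hE]) hsum (fun d => ?_) d
  · have h1 : q ^ ((1 / 2 + ε) * d + ε * M) * ρ ^ d = Real.exp (M * (ε * Real.log q)) := by
      rw [Real.rpow_add hq0, hρ, ← Real.rpow_natCast, ← Real.rpow_mul hq0.le, mul_right_comm,
        ← Real.rpow_add hq0, neg_mul, add_neg_cancel, Real.rpow_zero, one_mul, Real.rpow_def_of_pos hq0]
      congr 1
      ring
    rw [Real.exp_add, ← h1, ← mul_assoc] at key
    exact le_of_mul_le_mul_right key (pow_pos hρ0 d)
  · have h1 := congrArg norm (natCast_mul_coeff_of_X_mul_derivative hrec d)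
    rw [norm_mul, Complex.norm_natCast, norm_neg] at h1
    rw [← mul_assoc, h1]
    refine (mul_le_mul_of_nonneg_right (norm_sum_le _ _) (pow_pos hρ0 d).le).trans_eq ?_
    rw [Finset.sum_mul]
    refine Finset.sum_congr rfl fun p hp => ?_
    rw [norm_mul, ← Finset.HasAntidiagonal.mem_antidiagonal.1 hp, pow_add]
    simp only [hγ]
    ring

end Recursion

section Main

variable {F : Type*} [Field F] [Fintype F]

lemma primePowSum_zero (lam : F[X] → ℂ) : primePowSum lam 0 = 0 := by
  have : primesLE F 0 = ∅ := by
    refine Finset.eq_empty_of_forall_notMem fun P hP => ?_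
    obtain ⟨⟨-, hirr⟩, hd⟩ := mem_primesLE.1 hP
    exact hirr.natDegree_pos.not_ge hd
  rw [primePowSum, this, Finset.sum_empty]

theorem exists_norm_coeff_moebius_le {ε : ℝ} (hε : 0 < ε) :
    ∃ K : ℝ, ∀ (l : ℕ) (Q : F[X]), Q ≠ 0 → ∀ lam : F[X] → ℂ,
      (∀ f g : F[X], f.Monic → g.Monic → lam (f * g) = lam f * lam g) → lam 1 = 1 →
      (∀ f : F[X], f.Monic → ¬IsCoprime f Q → lam f = 0) →
      (∀ f : F[X], f.Monic → IsCoprime f Q → ‖lam f‖ = 1) →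
      (∀ f g : F[X], f.Monic → g.Monic → Q ∣ f - g →
        X ^ (l + 1) ∣ f.reverse - g.reverse → lam f = lam g) →
      ∀ d : ℕ, ‖∑ f ∈ monicSet F d, (polyMu f : ℂ) * lam f‖ ≤
        K * (Fintype.card F : ℝ) ^ ((1 / 2 + ε) * d + ε * ((Q.natDegree : ℝ) + l)) := by
  have hq : (1 : ℝ) < Fintype.card F := by exact_mod_cast Fintype.one_lt_card
  have hq0 : (0 : ℝ) < Fintype.card F := zero_lt_one.trans hq
  obtain ⟨K, hK0, hK⟩ := exists_norm_coeff_le_rpow hq hε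
  refine ⟨K * (1 + Fintype.card F), fun l Q hQ lam hmul hone hzero hunit hper d => ?_⟩
  obtain ⟨δ, hδ, hb⟩ := exists_norm_primePowSum_sub_le_sqrt_pow hmul hone hzero hunit hper hQ
  set M₀ : ℝ := (Q.natDegree : ℝ) + l with hM₀
  have hM₀0 : 0 ≤ M₀ := by positivity
  set A := freeSeries ∅ fun f : F[X] => (polyMu f : ℂ) * lam f with hA
  have hA0 : PowerSeries.coeff 0 A = 1 := by
    rw [hA, coeff_freeSeries, freeSet_empty, monicSet_zero, Finset.sum_singleton, polyMu_one, hone,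
      Int.cast_one, one_mul]
  have hcoeff : ∑ f ∈ monicSet F d, (polyMu f : ℂ) * lam f = PowerSeries.coeff d A := by
    rw [hA, coeff_freeSeries, freeSet_empty]
  have hD := X_mul_derivative_moebius hmul
  rw [← hA] at hD
  rw [hcoeff]
  have hpow : ∀ d : ℕ, 0 ≤ (Fintype.card F : ℝ) ^ ((1 / 2 + ε) * d + ε * M₀) := fun d =>
    Real.rpow_nonneg hq0.le _
  rcases hδ with rfl | rfl
  · have h := hK M₀ A (PowerSeries.mk (primePowSum lam)) hM₀0 hA0
      (by rw [PowerSeries.coeff_mk, primePowSum_zero])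
      (fun n hn => by simpa using hb n hn) hD d
    refine h.trans (mul_le_mul_of_nonneg_right ?_ (hpow d))
    exact le_mul_of_one_le_right hK0 (le_add_of_nonneg_right hq0.le)
  · set c : ℂ := (Fintype.card F : ℂ) with hc
    set G : PowerSeries ℂ := PowerSeries.mk fun n => if n = 0 then 0 else c ^ n with hG
    set E : PowerSeries ℂ := PowerSeries.mk (primePowSum lam) - G with hE
    have hG1 : (1 - PowerSeries.C c * PowerSeries.X) * G = PowerSeries.C c * PowerSeries.X :=
      one_sub_mul_mk_pow c
    have hinv : (1 - PowerSeries.C c * PowerSeries.X) * (1 + G) = 1 := by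
      linear_combination hG1
    have hD1 : PowerSeries.derivative ℂ (1 - PowerSeries.C c * PowerSeries.X) =
        - PowerSeries.C c := by
      rw [map_sub, Derivation.map_one_eq_zero, zero_sub, Derivation.leibniz]
      simp [PowerSeries.derivative_X]
    have hDG : PowerSeries.X * PowerSeries.derivative ℂ (1 + G) = G * (1 + G) := by
      have h3 := congrArg (PowerSeries.derivative ℂ) hinv
      rw [Derivation.leibniz, Derivation.map_one_eq_zero, smul_eq_mul, smul_eq_mul, hD1] at h3
      linear_combination PowerSeries.X * (1 + G) * h3 -
        (PowerSeries.X * PowerSeries.derivative ℂ (1 + G)) * hinv - (1 + G) * (1 + G) * hG1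
        + G * (1 + G) * hinv
    have hDA : PowerSeries.X * PowerSeries.derivative ℂ ((1 + G) * A) = -(E * ((1 + G) * A)) := by
      rw [Derivation.leibniz, smul_eq_mul, smul_eq_mul]
      linear_combination (1 + G) * hD + A * hDG
    have hG0 : PowerSeries.coeff 0 G = 0 := by rw [hG, PowerSeries.coeff_mk, if_pos rfl]
    have h := hK M₀ ((1 + G) * A) E hM₀0
      (by
        rw [PowerSeries.coeff_zero_eq_constantCoeff_apply] at hA0 hG0 ⊢
        rw [map_mul, hA0, map_add, hG0, map_one, add_zero, one_mul])
      (by rw [hE, map_sub, PowerSeries.coeff_mk, primePowSum_zero, hG0, sub_zero])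
      (fun n hn => by
        rw [hE, map_sub, PowerSeries.coeff_mk, hG, PowerSeries.coeff_mk, if_neg hn]
        simpa using hb n hn) hDA
    have hAeq : A = (1 - PowerSeries.C c * PowerSeries.X) * ((1 + G) * A) := by
      rw [← mul_assoc, hinv, one_mul]
    set B := (1 + G) * A with hB
    rw [hAeq, sub_mul, one_mul, mul_assoc, map_sub, PowerSeries.coeff_C_mul]
    refine (norm_sub_le _ _).trans ?_
    rw [mul_add, mul_one, add_mul, norm_mul]
    refine add_le_add (h d) ?_
    rw [hc, Complex.norm_natCast, mul_comm K, mul_assoc]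
    refine mul_le_mul_of_nonneg_left ?_ hq0.le
    rcases d with _ | d
    · rw [PowerSeries.coeff_zero_X_mul, norm_zero]
      exact mul_nonneg hK0 (hpow 0)
    · rw [PowerSeries.coeff_succ_X_mul]
      refine (h d).trans (mul_le_mul_of_nonneg_left ?_ hK0)
      refine Real.rpow_le_rpow_of_exponent_le hq.le ?_
      push_cast
      nlinarith

end Main

/-- Character sum estimate: for every `ε > 0` there is a constant `C = C(ε,q)` such that
for every `l ≥ 0`, nonzero `Q` of degree `m`, and every character `λ` of `G_{l,Q}`
(a completely multiplicative function on monic polynomials, vanishing exactly off the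
polynomials coprime to `Q`, of modulus one on them, and depending only on the residue
class mod `Q` and the first `l` coefficients), for every `d ≥ 1` one has
`|∑_{f monic, deg f = d} μ(f) λ(f)| ≤ C q^((1/2+ε)d + ε(m+l))`. -/
theorem char_sum_estimate {F : Type*} [Field F] [Fintype F] (q : ℕ)
    (hq : Fintype.card F = q) (ε : ℝ) (hε : 0 < ε) :
    ∃ C : ℝ, ∀ (l : ℕ) (Q : Polynomial F), Q ≠ 0 →
      ∀ lam : Polynomial F → ℂ,
        (∀ f g : Polynomial F, f.Monic → g.Monic → lam (f * g) = lam f * lam g) →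
        (∀ f : Polynomial F, f.Monic → ¬IsCoprime f Q → lam f = 0) →
        (∀ f : Polynomial F, f.Monic → IsCoprime f Q → ‖lam f‖ = 1) →
        (∀ f g : Polynomial F, f.Monic → g.Monic → Q ∣ f - g →
          (∀ i : ℕ, 1 ≤ i → i ≤ l → firstCoeff f i = firstCoeff g i) → lam f = lam g) →
        ∀ d : ℕ, 1 ≤ d →
          ‖∑ x : Fin d → F, (polyMu (monicPoly F d x) : ℂ) * lam (monicPoly F d x)‖ ≤
            C * (q : ℝ) ^ ((1 / 2 + ε) * d + ε * ((Q.natDegree : ℝ) + l)) := by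
  subst hq
  obtain ⟨K, hK⟩ := exists_norm_coeff_moebius_le (F := F) hε
  refine ⟨K, fun l Q hQ lam hmul hzero hunit hper d _ => ?_⟩
  have hone : lam 1 = 1 := by
    have h1 := hunit 1 monic_one isCoprime_one_left
    have h2 := hmul 1 1 monic_one monic_one
    rw [mul_one] at h2
    have h3 : lam 1 ≠ 0 := fun h0 => by rw [h0, norm_zero] at h1; exact zero_ne_one h1
    exact (mul_eq_left₀ h3).1 h2.symm
  have h := hK l Q hQ lam hmul hone hzero hunit (fun f g hf hg hdvd hrev =>
    hper f g hf hg hdvd fun i _ hi => ?_) d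
  · rwa [sum_monicSet] at h
  · rw [firstCoeff_eq_coeff_reverse, firstCoeff_eq_coeff_reverse, ← sub_eq_zero, ← coeff_sub]
    exact X_pow_dvd_iff.1 hrev i (by omega)
end

section
/- Let F_q be a finite field, let u, v ≥ 0 be integers, and let f ∈ F_q[t] be monic with deg f > max(u, v). Then Vaughan's identity holds: μ(f) = − ∑_{(a,b) monic, ab ∣ f, deg a ≤ u, deg b ≤ v} μ(a)μ(b) + ∑_{(a,b) monic, ab ∣ f, deg a > u, deg b > v} μ(a)μ(b), where both sums range over ordered pairs (a, b) of monic polynomials with ab dividing f. -/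
open Polynomial

open UniqueFactorizationMonoid in
theorem finite_setOf_monic_dvd {F : Type*} [Field F] {f : Polynomial F} (hf : f ≠ 0) :
    {d : Polynomial F | d.Monic ∧ d ∣ f}.Finite := by
  classical
  refine ((normalizedFactors f).powerset.map Multiset.prod).toFinset.finite_toSet.subset ?_
  rintro d ⟨hd, hdf⟩
  simp only [Finset.mem_coe, Multiset.mem_toFinset, Multiset.mem_map, Multiset.mem_powerset]
  refine ⟨normalizedFactors d, (dvd_iff_normalizedFactors_le_normalizedFactors hd.ne_zero hf).1 hdf,
    ?_⟩
  rw [prod_normalizedFactors_eq hd.ne_zero, hd.normalize_eq_self]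

open scoped Classical in
/-- The monic divisors of `f`; the empty set if `f = 0`. -/
noncomputable def monicDivisors {F : Type*} [Field F] (f : Polynomial F) :
    Finset (Polynomial F) :=
  if hf : f = 0 then ∅ else (finite_setOf_monic_dvd hf).toFinset

theorem mem_monicDivisors {F : Type*} [Field F] {f d : Polynomial F} (hf : f ≠ 0) :
    d ∈ monicDivisors f ↔ d.Monic ∧ d ∣ f := by
  simp [monicDivisors, hf]

theorem polyMu_one_s14 {F : Type*} [Field F] : polyMu (1 : Polynomial F) = 1 := by
  simp [polyMu]

theorem squarefree_irreducible_mul {F : Type*} [Field F] {p d : Polynomial F}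
    (hp : Irreducible p) (hpd : ¬ p ∣ d) (hd : Squarefree d) : Squarefree (p * d) :=
  (squarefree_mul_iff).2 ⟨(hp.isRelPrime_iff_not_dvd).2 hpd, hp.squarefree, hd⟩

theorem polyMu_irreducible_mul {F : Type*} [Field F] {p d : Polynomial F}
    (hp : Irreducible p) (hpd : ¬ p ∣ d) (hd : Squarefree d) :
    polyMu (p * d) = -polyMu d := by
  classical
  rw [polyMu, polyMu, if_pos (squarefree_irreducible_mul hp hpd hd), if_pos hd,
    UniqueFactorizationMonoid.normalizedFactors_mul hp.ne_zero hd.ne_zero,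
    UniqueFactorizationMonoid.normalizedFactors_irreducible hp]
  simp [pow_add]

theorem sum_monicDivisors_polyMu_of_ne_one {F : Type*} [Field F] {f : Polynomial F}
    (hf : f.Monic) (h1 : f ≠ 1) : ∑ d ∈ monicDivisors f, polyMu d = 0 := by
  classical
  obtain ⟨p, hpm, hp, hpf⟩ := Polynomial.exists_monic_irreducible_factor f
    (fun h => h1 (hf.eq_one_of_isUnit h))
  rw [← Finset.sum_filter_of_ne (p := Squarefree)
    (fun d _ hd => by by_contra hs; exact hd (if_neg hs))]
  have not_dvd : ∀ e, Squarefree (p * e) → ¬ p ∣ e := fun e he hpe =>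
    hp.not_isUnit (he p (mul_dvd_mul_left p hpe))
  have div_eq : ∀ e, p * e / p = e := fun e => mul_div_cancel_left₀ e hp.ne_zero
  refine Finset.sum_involution (fun d _ => if p ∣ d then d / p else p * d) ?_ ?_ ?_ ?_
  · intro d hd
    simp only [Finset.mem_filter, mem_monicDivisors hf.ne_zero] at hd
    split_ifs with h
    · obtain ⟨e, rfl⟩ := h
      rw [div_eq, polyMu_irreducible_mul hp (not_dvd e hd.2) (hd.2.of_mul_right)]
      ring
    · rw [polyMu_irreducible_mul hp h hd.2]
      ring
  · intro d hd _
    simp only [Finset.mem_filter, mem_monicDivisors hf.ne_zero] at hd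
    split_ifs with h
    · obtain ⟨e, rfl⟩ := h
      rw [div_eq]
      exact fun he => not_dvd e hd.2 (he ▸ dvd_mul_right p e)
    · exact fun he => h (he ▸ dvd_mul_right p d)
  · intro d hd
    simp only [Finset.mem_filter, mem_monicDivisors hf.ne_zero] at hd ⊢
    split_ifs with h
    · obtain ⟨e, rfl⟩ := h
      rw [div_eq]
      exact ⟨⟨hpm.of_mul_monic_left hd.1.1, (dvd_mul_left e p).trans hd.1.2⟩, hd.2.of_mul_right⟩
    · exact ⟨⟨hpm.mul hd.1.1, ((hp.coprime_iff_not_dvd).2 h).mul_dvd hpf hd.1.2⟩,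
        squarefree_irreducible_mul hp h hd.2⟩
  · intro d hd
    simp only [Finset.mem_filter, mem_monicDivisors hf.ne_zero] at hd
    by_cases h : p ∣ d
    · obtain ⟨e, rfl⟩ := h
      simp [div_eq, not_dvd e hd.2]
    · simp [h, div_eq]

theorem sum_monicDivisors_one {F : Type*} [Field F] :
    ∑ d ∈ monicDivisors (1 : Polynomial F), polyMu d = 1 := by
  have : monicDivisors (1 : Polynomial F) = {1} := by
    ext d
    rw [mem_monicDivisors one_ne_zero, Finset.mem_singleton]
    constructor
    · rintro ⟨hd, h⟩
      exact hd.eq_one_of_isUnit (isUnit_of_dvd_one h)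
    · rintro rfl
      exact ⟨monic_one, dvd_rfl⟩
  rw [this, Finset.sum_singleton, polyMu_one_s14]

open scoped Classical in
/-- The ordered pairs of monic polynomials whose product divides `f`. -/
noncomputable def monicDivisorPairs {F : Type*} [Field F] (f : Polynomial F) :
    Finset (Polynomial F × Polynomial F) :=
  (monicDivisors f ×ˢ monicDivisors f).filter fun p => p.1 * p.2 ∣ f

theorem mem_monicDivisorPairs {F : Type*} [Field F] {f : Polynomial F} (hf : f ≠ 0)
    {p : Polynomial F × Polynomial F} :
    p ∈ monicDivisorPairs f ↔ p.1.Monic ∧ p.2.Monic ∧ p.1 * p.2 ∣ f := by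
  simp only [monicDivisorPairs, Finset.mem_filter, Finset.mem_product, mem_monicDivisors hf]
  constructor
  · rintro ⟨⟨h1, h2⟩, h⟩
    exact ⟨h1.1, h2.1, h⟩
  · rintro ⟨h1, h2, h⟩
    exact ⟨⟨⟨h1, (dvd_mul_right _ _).trans h⟩, h2, (dvd_mul_left _ _).trans h⟩, h⟩

/-- Möbius inversion: convolving `w` with `1` and then with `polyMu` gives back `w`. -/
theorem sum_monicDivisorPairs_mul_polyMu {F : Type*} [Field F] {f : Polynomial F}
    (hf : f.Monic) (w : Polynomial F → ℤ) :
    ∑ p ∈ monicDivisorPairs f, w p.1 * polyMu p.2 = w f := by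
  classical
  have inner : ∀ a ∈ monicDivisors f,
      ∑ b ∈ monicDivisors f with a * b ∣ f, w a * polyMu b = if a = f then w a else 0 := by
    intro a hmem
    obtain ⟨ha, c, rfl⟩ := (mem_monicDivisors hf.ne_zero).1 hmem
    have hc : c.Monic := ha.of_mul_monic_left hf
    have hfilter : (monicDivisors (a * c)).filter (fun b => a * b ∣ a * c) = monicDivisors c := by
      ext b
      simp only [Finset.mem_filter, mem_monicDivisors hf.ne_zero, mem_monicDivisors hc.ne_zero,
        mul_dvd_mul_iff_left ha.ne_zero]
      exact ⟨fun h => ⟨h.1.1, h.2⟩, fun h => ⟨⟨h.1, h.2.mul_left a⟩, h.2⟩⟩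
    rw [hfilter, ← Finset.mul_sum]
    by_cases h1 : c = 1
    · simp [h1, sum_monicDivisors_one]
    · rw [sum_monicDivisors_polyMu_of_ne_one hc h1, mul_zero, if_neg]
      exact fun h => h1 ((mul_eq_left₀ ha.ne_zero).1 h.symm)
  rw [monicDivisorPairs, Finset.sum_filter, Finset.sum_product]
  simp only [← Finset.sum_filter]
  rw [Finset.sum_congr rfl inner, Finset.sum_ite_eq' _ f w,
    if_pos ((mem_monicDivisors hf.ne_zero).2 ⟨hf, dvd_rfl⟩)]

theorem sum_monicDivisorPairs_polyMu_mul {F : Type*} [Field F] {f : Polynomial F}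
    (hf : f.Monic) (w : Polynomial F → ℤ) :
    ∑ p ∈ monicDivisorPairs f, polyMu p.1 * w p.2 = w f := by
  rw [← sum_monicDivisorPairs_mul_polyMu hf w]
  refine Finset.sum_equiv (Equiv.prodComm _ _) (fun p => ?_) (fun p _ => mul_comm _ _)
  rw [mem_monicDivisorPairs hf.ne_zero, mem_monicDivisorPairs hf.ne_zero]
  simp only [Equiv.prodComm_apply, Prod.fst_swap, Prod.snd_swap, mul_comm p.2 p.1]
  tauto

theorem finsum_monic_pairs_eq_sum {F : Type*} [Field F] {f : Polynomial F} (hf : f ≠ 0)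
    (P Q : Polynomial F → Prop) [DecidablePred P] [DecidablePred Q]
    (g : Polynomial F × Polynomial F → ℤ) :
    ∑ᶠ (p : Polynomial F × Polynomial F)
        (_ : p.1.Monic ∧ p.2.Monic ∧ p.1 * p.2 ∣ f ∧ P p.1 ∧ Q p.2), g p =
      ∑ p ∈ monicDivisorPairs f, if P p.1 ∧ Q p.2 then g p else 0 := by
  rw [← Finset.sum_filter]
  refine finsum_cond_eq_sum_of_cond_iff _ fun {p} _ => ?_
  rw [Finset.mem_filter, mem_monicDivisorPairs hf]
  tauto

/-- Vaughan's identity over `F_q[t]`: for monic `f` with `deg f > max(u,v)`,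
`μ(f) = -∑_{ab ∣ f, deg a ≤ u, deg b ≤ v} μ(a)μ(b)
        + ∑_{ab ∣ f, deg a > u, deg b > v} μ(a)μ(b)`,
both sums ranging over ordered pairs `(a,b)` of monic polynomials with `ab ∣ f`. -/
theorem vaughan_identity {F : Type*} [Field F] (u v : ℕ) (f : Polynomial F)
    (hf : f.Monic) (hdeg : max u v < f.natDegree) :
    polyMu f =
      -(∑ᶠ (p : Polynomial F × Polynomial F)
          (_ : p.1.Monic ∧ p.2.Monic ∧ p.1 * p.2 ∣ f ∧
                p.1.natDegree ≤ u ∧ p.2.natDegree ≤ v),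
          polyMu p.1 * polyMu p.2) +
      ∑ᶠ (p : Polynomial F × Polynomial F)
          (_ : p.1.Monic ∧ p.2.Monic ∧ p.1 * p.2 ∣ f ∧
                u < p.1.natDegree ∧ v < p.2.natDegree),
          polyMu p.1 * polyMu p.2 := by
  rw [finsum_monic_pairs_eq_sum hf.ne_zero (fun a => a.natDegree ≤ u) (fun b => b.natDegree ≤ v),
    finsum_monic_pairs_eq_sum hf.ne_zero (fun a => u < a.natDegree) (fun b => v < b.natDegree)]
  have hu := sum_monicDivisorPairs_mul_polyMu hf
    (fun a => if a.natDegree ≤ u then polyMu a else 0)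
  have hv := sum_monicDivisorPairs_polyMu_mul hf
    (fun b => if b.natDegree ≤ v then polyMu b else 0)
  have hμ := sum_monicDivisorPairs_mul_polyMu hf polyMu
  simp only [if_neg (not_le.2 ((le_max_left u v).trans_lt hdeg))] at hu
  simp only [if_neg (not_le.2 ((le_max_right u v).trans_lt hdeg))] at hv
  have key := Finset.sum_congr (rfl : monicDivisorPairs f = monicDivisorPairs f) fun p _ =>
    show polyMu p.1 * polyMu p.2 =
      (if p.1.natDegree ≤ u then polyMu p.1 else 0) * polyMu p.2 +
        polyMu p.1 * (if p.2.natDegree ≤ v then polyMu p.2 else 0) -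
        (if p.1.natDegree ≤ u ∧ p.2.natDegree ≤ v then polyMu p.1 * polyMu p.2 else 0) +
        if u < p.1.natDegree ∧ v < p.2.natDegree then polyMu p.1 * polyMu p.2 else 0 by
      by_cases ha : p.1.natDegree ≤ u <;> by_cases hb : p.2.natDegree ≤ v <;>
        simp [ha, hb, ← not_le]
  rw [Finset.sum_add_distrib, Finset.sum_sub_distrib, Finset.sum_add_distrib, hμ, hu, hv] at key
  rw [key]
  ring
end
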